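/- Under Assumptions 1 and 3, for any step size η ∈ (0, η₀ ∧ 1/(m+L)) the stationary distribution π_η of the PRLMC chain satisfies the sharp bound W₂²(π, π_η) ≤ 2κ^{−1} d η² · { L²[10 − 4/K + L²η²/6 + 2κ^{−1}L²η] + 6κ^{−1}dL̃² + ({2 + 4η²L²(2 − 1/K) + L²(1 − 1/K)}/m)·L⁴[(8 − 4/K)η + 3κ^{−1}] + L⁴(η + 3κ^{−1})/m }, where κ = 2mL/(m+L); in particular W₂(π, π_η) = O(η). -/

import Mathlib

open MeasureTheory ProbabilityTheory Filter
open scoped ENNReal NNReal RealInnerProductSpace Topology BigOperators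

noncomputable section

/-- Euclidean space `ℝ^d`. -/
abbrev Euc (d : ℕ) : Type := EuclideanSpace ℝ (Fin d)

/-- Assumption 1: `U` is `C¹`, `m`-strongly convex and `L`-gradient Lipschitz
(expressed through the two-sided quadratic bound), with `∇U(0) = 0`. -/
def StrongAssumption {d : ℕ} (U : Euc d → ℝ) (m L : ℝ) : Prop :=
  ContDiff ℝ 1 U ∧ 0 < m ∧ m ≤ L ∧
  (∀ x y : Euc d,
    m / 2 * ‖x - y‖ ^ 2 ≤ U y - U x - ⟪gradient U x, y - x⟫ ∧
    U y - U x - ⟪gradient U x, y - x⟫ ≤ L / 2 * ‖x - y‖ ^ 2) ∧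
  gradient U 0 = 0

/-- Assumption 3: `U` is `C³` with third derivative uniformly bounded by `Lt`. -/
def ThirdDerivBounded {d : ℕ} (U : Euc d → ℝ) (Lt : ℝ) : Prop :=
  ContDiff ℝ 3 U ∧ ∀ x : Euc d, ‖iteratedFDeriv ℝ 3 U x‖ ≤ Lt

/-- The standard Gaussian measure on `ℝ^d`. -/
def stdGaussian (d : ℕ) : Measure (Euc d) :=
  (Measure.pi fun _ : Fin d => ProbabilityTheory.gaussianReal 0 1).map
    ⇑(EuclideanSpace.equiv (Fin d) ℝ).symm

/-- Bernoulli(p) distribution on `ℝ`, giving mass `p` to `1` and `1-p` to `0`. -/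
def bern (p : ℝ≥0∞) : Measure ℝ :=
  p • Measure.dirac (1 : ℝ) + (1 - p) • Measure.dirac (0 : ℝ)

/-- The `i`-th PRLMC midpoint. -/
def prlmcMid {d : ℕ} (U : Euc d → ℝ) (η : ℝ) (K : ℕ) (x : Euc d)
    (g : Fin K → Euc d) (i : Fin K) : Euc d :=
  x - (((i : ℝ) * η / (K : ℝ)) • gradient U x) + Real.sqrt (2 * (i : ℝ) * η / (K : ℝ)) • g i

/-- One step of the PRLMC scheme with step size `η`, Bernoulli variables `h`,
midpoint Gaussians `g` and driving Gaussian `z`. -/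
def prlmcStep {d : ℕ} (U : Euc d → ℝ) (η : ℝ) (K : ℕ) (x : Euc d)
    (h : Fin K → ℝ) (g : Fin K → Euc d) (z : Euc d) : Euc d :=
  x - η • gradient U x
    + η • ∑ i : Fin K, h i • (gradient U x - gradient U (prlmcMid U η K x g i))
    + Real.sqrt (2 * η) • z

/-- The law of the randomness used at a single step of the PRLMC scheme:
`K` i.i.d. Bernoulli(1/K) variables, `K` i.i.d. standard Gaussians for the midpoints
and one standard Gaussian. -/
def prlmcNoise (d K : ℕ) : Measure ((Fin K → ℝ) × (Fin K → Euc d) × Euc d) :=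
  (Measure.pi fun _ : Fin K => bern (K : ℝ≥0∞)⁻¹).prod
    ((Measure.pi fun _ : Fin K => stdGaussian d).prod (stdGaussian d))

/-- The one-step transition kernel `Q_η` of the PRLMC chain. -/
def prlmcKernel {d : ℕ} (U : Euc d → ℝ) (η : ℝ) (K : ℕ) (x : Euc d) : Measure (Euc d) :=
  (prlmcNoise d K).map fun r => prlmcStep U η K x r.1 r.2.1 r.2.2

/-- The law of the PRLMC chain after `n` steps, started from the distribution `μ`. -/
def prlmcIter {d : ℕ} (U : Euc d → ℝ) (η : ℝ) (K : ℕ) (μ : Measure (Euc d)) :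
    ℕ → Measure (Euc d)
  | 0 => μ
  | n + 1 => (prlmcIter U η K μ n).bind (prlmcKernel U η K)

/-- The law of the decreasing-step PRLMC chain after `n` steps (the `(k+1)`-th step uses
step size `γ (k+1)`), started from the distribution `μ`. -/
def prlmcIterVar {d : ℕ} (U : Euc d → ℝ) (K : ℕ) (γ : ℕ → ℝ) (μ : Measure (Euc d)) :
    ℕ → Measure (Euc d)
  | 0 => μ
  | n + 1 => (prlmcIterVar U K γ μ n).bind (prlmcKernel U (γ (n + 1)) K)

/-- Total variation distance. -/
def dTV {d : ℕ} (μ ν : Measure (Euc d)) : ℝ≥0∞ :=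
  ⨆ (A : Set (Euc d)) (_ : MeasurableSet A), max (μ A - ν A) (ν A - μ A)

/-- 2-Wasserstein distance. -/
def W2 {d : ℕ} (μ ν : Measure (Euc d)) : ℝ≥0∞ :=
  ⨅ (π : Measure (Euc d × Euc d)) (_ : π.map Prod.fst = μ ∧ π.map Prod.snd = ν),
    (∫⁻ p, ((‖p.1 - p.2‖₊ : ℝ≥0∞)) ^ 2 ∂π) ^ (1 / 2 : ℝ)

/-- The Gibbs measure `π(dx) ∝ exp(-U(x)) dx`. -/
def gibbs {d : ℕ} (U : Euc d → ℝ) : Measure (Euc d) :=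
  (∫⁻ x, ENNReal.ofReal (Real.exp (-U x)) ∂(volume : Measure (Euc d)))⁻¹ •
    (volume : Measure (Euc d)).withDensity fun x => ENNReal.ofReal (Real.exp (-U x))

/-- Membership in the functional class `𝒢`: `C²` functions with bounded gradient and
bounded Hessian. -/
def MemG {d : ℕ} (h : Euc d → ℝ) : Prop :=
  ContDiff ℝ 2 h ∧ (∃ M, ∀ x, ‖gradient h x‖ ≤ M) ∧
    (∃ M, ∀ x, ‖iteratedFDeriv ℝ 2 h x‖ ≤ M)

/-- The distance `d_𝒢`. -/
def dG {d : ℕ} (μ ν : Measure (Euc d)) : ℝ :=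
  sSup { r : ℝ | ∃ h : Euc d → ℝ, MemG h ∧ r = (∫ x, h x ∂μ) - ∫ x, h x ∂ν }

/-- `B` is a standard `d`-dimensional Brownian motion on `(Ω, P)`. -/
def IsBrownianMotion {Ω : Type} [MeasurableSpace Ω] {d : ℕ} (P : Measure Ω)
    (B : ℝ → Ω → Euc d) : Prop :=
  (∀ t, Measurable (B t)) ∧
  (∀ᵐ ω ∂P, B 0 ω = 0 ∧ Continuous fun t => B t ω) ∧
  (∀ s t : ℝ, 0 ≤ s → s ≤ t →
    Measure.map (fun ω => B t ω - B s ω) P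
      = Measure.map (fun z => Real.sqrt (t - s) • z) (stdGaussian d)) ∧
  (∀ τ : ℕ → ℝ, Monotone τ → 0 ≤ τ 0 →
    iIndepFun (fun (i : ℕ) ω => B (τ (i + 1)) ω - B (τ i) ω) P)

/-- `X` is a solution of the Langevin SDE `dX_t = -∇U(X_t) dt + √2 dB_t` started at `x`. -/
def SolvesLangevin {Ω : Type} [MeasurableSpace Ω] {d : ℕ} (U : Euc d → ℝ) (P : Measure Ω)
    (B X : ℝ → Ω → Euc d) (x : Euc d) : Prop :=
  (∀ t, Measurable (X t)) ∧
  ∀ᵐ ω ∂P, (Continuous fun t => X t ω) ∧ ∀ t, 0 ≤ t →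
    X t ω = x - (∫ s in (0:ℝ)..t, gradient U (X s ω)) + Real.sqrt 2 • B t ω

/-- `κ = 2mL/(m+L)`. -/
def kap (m L : ℝ) : ℝ := 2 * m * L / (m + L)

/-- Cumulative times `t_n = γ_1 + ⋯ + γ_n`. -/
def tseq (γ : ℕ → ℝ) (n : ℕ) : ℝ := ∑ k ∈ Finset.Icc 1 n, γ k

/-! ### Deterministic facts about the potential -/

/-- Co-coercivity-type inequality. -/
lemma grad_coco {d : ℕ} {U : Euc d → ℝ} {m L : ℝ} (hU : StrongAssumption U m L) (x y : Euc d) :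
    1 / (2 * L) * ‖gradient U x - gradient U y‖ ^ 2 ≤ U y - U x - ⟪gradient U x, y - x⟫ := by
  obtain ⟨_, hm, hmL, hq, _⟩ := hU
  have hL : 0 < L := lt_of_lt_of_le hm hmL
  set g := gradient U y - gradient U x with hg
  set w := y - (1 / L) • g with hw
  have h1 := (hq x w).1
  have h2 := (hq y w).2
  have e1 : y - w = (1 / L) • g := by rw [hw]; abel
  have e2 : w - y = -((1 / L) • g) := by rw [hw]; abel
  have e3 : w - x = (y - x) - (1 / L) • g := by rw [hw]; abel
  rw [e1, e2, inner_neg_right, inner_smul_right, norm_smul, mul_pow] at h2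
  rw [e3, inner_sub_right, inner_smul_right] at h1
  have h0 : 0 ≤ m / 2 * ‖x - w‖ ^ 2 := by positivity
  have hgg : ⟪gradient U y, g⟫ - ⟪gradient U x, g⟫ = ‖g‖ ^ 2 := by
    rw [← inner_sub_left, ← hg, real_inner_self_eq_norm_sq]
  have e4 : ‖gradient U x - gradient U y‖ = ‖g‖ := by rw [hg, norm_sub_rev]
  rw [e4]
  have e5 : ‖(1 / L : ℝ)‖ ^ 2 = 1 / L ^ 2 := by
    rw [Real.norm_eq_abs, sq_abs]; field_simp
  rw [e5] at h2
  have e6 : L / 2 * (1 / L ^ 2 * ‖g‖ ^ 2) = 1 / (2 * L) * ‖g‖ ^ 2 := by field_simp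
  rw [e6] at h2
  have e7 : 1 / L * ⟪gradient U y, g⟫ - 1 / L * ⟪gradient U x, g⟫ = 2 * (1 / (2 * L) * ‖g‖ ^ 2) := by
    rw [← mul_sub, hgg]; field_simp
  linarith

lemma grad_mono {d : ℕ} {U : Euc d → ℝ} {m L : ℝ} (hU : StrongAssumption U m L) (x y : Euc d) :
    m * ‖x - y‖ ^ 2 ≤ ⟪x - y, gradient U x - gradient U y⟫ := by
  obtain ⟨_, hm, hmL, hq, _⟩ := hU
  have h1 := (hq x y).1
  have h2 := (hq y x).1
  rw [norm_sub_rev y x] at h2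
  have e1 : ⟪x - y, gradient U x - gradient U y⟫
      = -⟪gradient U x, y - x⟫ - ⟪gradient U y, x - y⟫ := by
    rw [inner_sub_right, real_inner_comm, real_inner_comm (gradient U y), ← neg_sub y x, inner_neg_right]
  linarith

lemma grad_lip {d : ℕ} {U : Euc d → ℝ} {m L : ℝ} (hU : StrongAssumption U m L) (x y : Euc d) :
    ‖gradient U x - gradient U y‖ ≤ L * ‖x - y‖ := by
  have h1 := grad_coco hU x y
  have h2 := grad_coco hU y x
  obtain ⟨_, hm, hmL, hq, _⟩ := hU
  have hL : 0 < L := lt_of_lt_of_le hm hmL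
  rw [norm_sub_rev (gradient U y)] at h2
  have e1 : ⟪x - y, gradient U x - gradient U y⟫
      = -⟪gradient U x, y - x⟫ - ⟪gradient U y, x - y⟫ := by
    rw [inner_sub_right, real_inner_comm, real_inner_comm (gradient U y), ← neg_sub y x, inner_neg_right]
  have h3 := real_inner_le_norm (x - y) (gradient U x - gradient U y)
  set G := ‖gradient U x - gradient U y‖
  have h4 : 1 / L * G ^ 2 ≤ ‖x - y‖ * G := by
    have : 1 / L * G ^ 2 = 2 * (1 / (2 * L) * G ^ 2) := by field_simp
    linarith
  have h5 : G * G ≤ G * (L * ‖x - y‖) := by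
    have : 1 / L * G ^ 2 * L = G * G := by field_simp
    nlinarith
  have hG0 : 0 ≤ G := norm_nonneg _
  rcases hG0.eq_or_lt with h | h
  · have : 0 ≤ L * ‖x - y‖ := by positivity
    linarith
  · exact le_of_mul_le_mul_left h5 h

lemma grad_bound {d : ℕ} {U : Euc d → ℝ} {m L : ℝ} (hU : StrongAssumption U m L) (x : Euc d) :
    ‖gradient U x‖ ≤ L * ‖x‖ := by
  have := grad_lip hU x 0
  rwa [hU.2.2.2.2, sub_zero, sub_zero] at this

lemma grad_cont {d : ℕ} {U : Euc d → ℝ} {m L : ℝ} (hU : StrongAssumption U m L) :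
    Continuous (gradient U) := by
  have hL : 0 < L := lt_of_lt_of_le hU.2.1 hU.2.2.1
  refine (LipschitzWith.of_dist_le_mul (K := ⟨L, hL.le⟩) fun x y => ?_).continuous
  rw [dist_eq_norm, dist_eq_norm]; exact grad_lip hU x y

/-- Second order Taylor expansion of the gradient. -/
lemma taylor_two {E F : Type*} [NormedAddCommGroup E] [NormedSpace ℝ E] [NormedAddCommGroup F]
    [NormedSpace ℝ F] {V : E → F} {Lt : ℝ}
    (hC1 : ContDiff ℝ 2 V) (hb : ∀ x : E, ‖iteratedFDeriv ℝ 2 V x‖ ≤ Lt) (x w : E) :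
    ‖V (x + w) - V x - fderiv ℝ V x w‖ ≤ Lt / 2 * ‖w‖ ^ 2 := by
  have hC2 : ContDiff ℝ 1 (fderiv ℝ V) := hC1.fderiv_right (by norm_num)
  have hb2 : ∀ z, ‖fderiv ℝ (fderiv ℝ V) z‖ ≤ Lt := by
    intro z
    have := hb z
    rwa [← norm_iteratedFDeriv_fderiv, ← norm_iteratedFDeriv_fderiv,
      norm_iteratedFDeriv_zero] at this
  have hLt : 0 ≤ Lt := (norm_nonneg (iteratedFDeriv ℝ 2 V 0)).trans (hb 0)
  have hlip : ∀ z, ‖fderiv ℝ V z - fderiv ℝ V x‖ ≤ Lt * ‖z - x‖ := by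
    intro z
    exact Convex.norm_image_sub_le_of_norm_fderiv_le (𝕜 := ℝ) (s := Set.univ)
      (fun u _ => (hC2.differentiable one_ne_zero) u) (fun u _ => hb2 u) convex_univ (Set.mem_univ _)
      (Set.mem_univ _)
  let f : ℝ → (F) := fun t => V (x + t • w) - V x - t • fderiv ℝ V x w
  let f' : ℝ → (F) := fun t => fderiv ℝ V (x + t • w) w - fderiv ℝ V x w
  have hf : ∀ t, HasDerivAt f (f' t) t := by
    intro t
    have h1 : HasDerivAt (fun t : ℝ => x + t • w) w t := by
      simpa using ((hasDerivAt_id t).smul_const w).const_add x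
    have h2 : HasDerivAt (fun t : ℝ => V (x + t • w)) (fderiv ℝ V (x + t • w) w) t :=
      ((hC1.differentiable two_ne_zero (x + t • w)).hasFDerivAt).comp_hasDerivAt t h1
    have h3 := ((hasDerivAt_id t).smul_const (fderiv ℝ V x w))
    have := (h2.sub_const (V x)).sub h3
    rw [one_smul] at this
    exact this
  have key := image_norm_le_of_norm_deriv_right_le_deriv_boundary (f := f) (f' := f') (a := 0) (b := 1)
    (B := fun t => Lt / 2 * ‖w‖ ^ 2 * t ^ 2) (B' := fun t => Lt * ‖w‖ ^ 2 * t)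
    (fun t _ => (hf t).continuousAt.continuousWithinAt) (fun t _ => (hf t).hasDerivWithinAt)
    (by simp [f]) (fun t => by
      have := ((hasDerivAt_id t).pow 2).const_mul (Lt / 2 * ‖w‖ ^ 2)
      refine this.congr_deriv ?_
      simp only [id, Nat.cast_ofNat]; ring)
    (fun t ht => by
      have : f' t = (fderiv ℝ V (x + t • w) - fderiv ℝ V x) w := by simp [f']
      rw [this]
      refine (ContinuousLinearMap.le_opNorm _ _).trans ?_
      have h := hlip (x + t • w)
      rw [add_sub_cancel_left, norm_smul, Real.norm_of_nonneg ht.1] at h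
      calc _ ≤ (Lt * (t * ‖w‖)) * ‖w‖ := by gcongr
        _ = _ := by ring)
  have := key (Set.right_mem_Icc.2 zero_le_one)
  simpa [f] using this

lemma fderiv_taylor {d : ℕ} {U : Euc d → ℝ} {Lt : ℝ} (hU : ThirdDerivBounded U Lt) (x w : Euc d) :
    ‖fderiv ℝ U (x + w) - fderiv ℝ U x - fderiv ℝ (fderiv ℝ U) x w‖ ≤ Lt / 2 * ‖w‖ ^ 2 := by
  refine taylor_two (hU.1.fderiv_right (by norm_num)) (fun z => ?_) x w
  rw [norm_iteratedFDeriv_fderiv]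
  exact hU.2 z

/-- the Riesz map -/
def riesz (d : ℕ) : (Euc d →L[ℝ] ℝ) →L[ℝ] Euc d where
  toFun := (InnerProductSpace.toDual ℝ (Euc d)).symm
  map_add' := by intro x y; simp
  map_smul' := by intro c x; simp
  cont := (InnerProductSpace.toDual ℝ (Euc d)).symm.continuous

lemma grad_eq_riesz {d : ℕ} (U : Euc d → ℝ) : gradient U = fun x => riesz d (fderiv ℝ U x) := rfl

lemma riesz_norm {d : ℕ} (f : Euc d →L[ℝ] ℝ) : ‖riesz d f‖ = ‖f‖ :=
  (InnerProductSpace.toDual ℝ (Euc d)).symm.norm_map f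

lemma inner_riesz {d : ℕ} (f : Euc d →L[ℝ] ℝ) (w : Euc d) : ⟪riesz d f, w⟫ = f w :=
  InnerProductSpace.toDual_symm_apply

/-- the Hessian as an operator -/
def hess {d : ℕ} (U : Euc d → ℝ) (x : Euc d) : Euc d →L[ℝ] Euc d :=
  (riesz d).comp (fderiv ℝ (fderiv ℝ U) x)

lemma grad_taylor {d : ℕ} {U : Euc d → ℝ} {Lt : ℝ} (hU : ThirdDerivBounded U Lt) (x w : Euc d) :
    ‖gradient U (x + w) - gradient U x - hess U x w‖ ≤ Lt / 2 * ‖w‖ ^ 2 := by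
  have := fderiv_taylor hU x w
  rw [← riesz_norm] at this
  simp only [map_sub] at this
  exact this

lemma U_hasDeriv {d : ℕ} {U : Euc d → ℝ} {m L : ℝ} (hU : StrongAssumption U m L) (x w : Euc d) (t : ℝ) :
    HasDerivAt (fun t : ℝ => U (x + t • w)) ⟪gradient U (x + t • w), w⟫ t := by
  have h1 : HasDerivAt (fun t : ℝ => x + t • w) w t := by
    simpa using ((hasDerivAt_id t).smul_const w).const_add x
  have h2 := ((hU.1.differentiable one_ne_zero (x + t • w)).hasFDerivAt).comp_hasDerivAt t h1
  have e : ⟪gradient U (x + t • w), w⟫ = fderiv ℝ U (x + t • w) w := inner_riesz _ _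
  rw [e]
  exact h2

/-- Trapezoidal rule error. -/
lemma trapezoid {d : ℕ} {U : Euc d → ℝ} {m L Lt : ℝ} (hU : StrongAssumption U m L)
    (hU3 : ThirdDerivBounded U Lt) (x w : Euc d) :
    |U (x + w) - U x - 1 / 2 * ⟪gradient U (x + w) + gradient U x, w⟫| ≤ Lt / 4 * ‖w‖ ^ 3 := by
  have hgd : ∀ z : Euc d, HasFDerivAt (gradient U) (hess U z) z := by
    intro z
    have hC1 : ContDiff ℝ 2 (fderiv ℝ U) := hU3.1.fderiv_right (by norm_num)
    have h2 := (hC1.differentiable two_ne_zero z).hasFDerivAt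
    exact (riesz d).hasFDerivAt.comp z h2
  have hLt : 0 ≤ Lt := (norm_nonneg _).trans (hU3.2 0)
  let f : ℝ → ℝ := fun t => U (x + t • w) - U x - t / 2 * ⟪gradient U (x + t • w) + gradient U x, w⟫
  let f' : ℝ → ℝ := fun t => ⟪gradient U (x + t • w), w⟫ -
    (1 / 2 * ⟪gradient U (x + t • w) + gradient U x, w⟫ + t / 2 * ⟪hess U (x + t • w) w, w⟫)
  have hf : ∀ t, HasDerivAt f (f' t) t := by
    intro t
    have h1 : HasDerivAt (fun t : ℝ => x + t • w) w t := by
      simpa using ((hasDerivAt_id t).smul_const w).const_add x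
    have h2 : HasDerivAt (fun t : ℝ => gradient U (x + t • w) + gradient U x) (hess U (x + t • w) w) t :=
      ((hgd (x + t • w)).comp_hasDerivAt t h1).add_const _
    have h3 : HasDerivAt (fun t : ℝ => ⟪gradient U (x + t • w) + gradient U x, w⟫)
        (⟪hess U (x + t • w) w, w⟫) t := by
      have := h2.inner ℝ (hasDerivAt_const t w)
      simpa using this
    have h4 : HasDerivAt (fun t : ℝ => t / 2) (1 / 2) t := (hasDerivAt_id t).div_const 2
    exact ((U_hasDeriv hU x w t).sub_const (U x)).sub (h4.mul h3)
  have hbd : ∀ t ∈ Set.Icc (0:ℝ) 1, ‖f' t‖ ≤ Lt / 4 * ‖w‖ ^ 3 := by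
    intro t ht
    have h := grad_taylor hU3 (x + t • w) (-(t • w))
    rw [add_neg_cancel_right, norm_neg, map_neg, map_smul, norm_smul, Real.norm_of_nonneg ht.1] at h
    have e : f' t = -(1 / 2) * ⟪gradient U x - gradient U (x + t • w) - -(t • hess U (x + t • w) w), w⟫ := by
      simp only [f', inner_add_left, inner_sub_left, inner_neg_left, real_inner_smul_left]; ring
    rw [e, norm_mul]
    have h5 := norm_inner_le_norm (𝕜 := ℝ) (gradient U x - gradient U (x + t • w) - -(t • hess U (x + t • w) w)) w
    have h6 : ‖(-(1/2) : ℝ)‖ = 1 / 2 := by rw [norm_neg]; norm_num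
    rw [h6]
    have h7 : (t * ‖w‖) ^ 2 ≤ ‖w‖ ^ 2 := by
      have : t * ‖w‖ ≤ ‖w‖ := by nlinarith [norm_nonneg w, ht.2]
      exact pow_le_pow_left₀ (mul_nonneg ht.1 (norm_nonneg _)) this 2
    calc _ ≤ 1 / 2 * ((Lt / 2 * (t * ‖w‖) ^ 2) * ‖w‖) := by
            gcongr; exact h5.trans (by gcongr)
      _ ≤ 1 / 2 * ((Lt / 2 * ‖w‖ ^ 2) * ‖w‖) := by gcongr
      _ = _ := by ring
  have := norm_image_sub_le_of_norm_deriv_le_segment_01' (f := f) (f' := f')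
    (fun t _ => (hf t).hasDerivWithinAt) (C := Lt / 4 * ‖w‖ ^ 3) (fun t ht => hbd t ⟨ht.1, ht.2.le⟩)
  simpa [f] using this

/-! ### Gaussian facts -/

lemma gau_eq (d : ℕ) : _root_.stdGaussian d = ProbabilityTheory.stdGaussian (Euc d) := by
  rw [← map_pi_eq_stdGaussian]; rfl

instance gau_gaussian (d : ℕ) : IsGaussian (_root_.stdGaussian d) := by
  rw [gau_eq]; infer_instance

instance gau_prob (d : ℕ) : IsProbabilityMeasure (_root_.stdGaussian d) := by
  rw [gau_eq]; infer_instance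

lemma gau_charFun (d : ℕ) (t : Euc d) :
    charFun (_root_.stdGaussian d) t = Complex.exp (-‖t‖ ^ 2 / 2) := by
  rw [gau_eq, charFun_stdGaussian]

lemma gau_memLp (d : ℕ) (p : ℝ≥0∞) (hp : p ≠ ∞) : MemLp (fun z : Euc d => z) p (_root_.stdGaussian d) :=
  IsGaussian.memLp_id _ p hp

lemma gau_inner (d : ℕ) (v : Euc d) : ∫ z, ⟪v, z⟫ ∂(_root_.stdGaussian d) = 0 := by
  rw [gau_eq]
  exact integral_strongDual_stdGaussian (innerSL ℝ v)

lemma gau_inner_sq (d : ℕ) (v : Euc d) : ∫ z, ⟪v, z⟫ ^ 2 ∂(_root_.stdGaussian d) = ‖v‖ ^ 2 := by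
  have h := variance_dual_stdGaussian (E := Euc d) (innerSL ℝ v)
  rw [variance_eq_integral (by fun_prop), integral_strongDual_stdGaussian] at h
  simp only [sub_zero, innerSL_apply_norm, innerSL_apply_apply] at h
  rw [gau_eq]; exact h

lemma gau_norm_sq (d : ℕ) : ∫ z, ‖z‖ ^ 2 ∂(_root_.stdGaussian d) = d := by
  have h : ∀ z : Euc d, ‖z‖ ^ 2 = ∑ i, ⟪EuclideanSpace.basisFun (Fin d) ℝ i, z⟫ ^ 2 := by
    intro z
    rw [EuclideanSpace.norm_sq_eq]
    simp [EuclideanSpace.inner_single_left]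
  simp_rw [h]
  rw [integral_finsetSum]
  · simp_rw [gau_inner_sq]; simp
  · intro i _
    have : MemLp (fun z : Euc d => ⟪EuclideanSpace.basisFun (Fin d) ℝ i, z⟫) 2 (_root_.stdGaussian d) :=
      (gau_memLp d 2 (by simp)).const_inner _
    exact this.integrable_sq

lemma gau_conv (d : ℕ) (j : ℕ) :
    (((_root_.stdGaussian d).map (fun z => Real.sqrt j • z)).prod (_root_.stdGaussian d)).map
      (fun p => p.1 + p.2) = (_root_.stdGaussian d).map (fun z => Real.sqrt ((j + 1 : ℕ) : ℝ) • z) := by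
  have : IsProbabilityMeasure ((_root_.stdGaussian d).map (fun z => Real.sqrt j • z)) :=
    Measure.isProbabilityMeasure_map (by fun_prop)
  apply Measure.ext_of_charFun
  ext t
  have := charFun_conv (μ := ((_root_.stdGaussian d).map (fun z => Real.sqrt j • z)))
    (ν := _root_.stdGaussian d) t
  rw [Measure.conv] at this
  rw [this, charFun_map_smul, charFun_map_smul, gau_charFun, gau_charFun, gau_charFun, ← Complex.exp_add]
  congr 1
  simp only [norm_smul, Real.norm_of_nonneg (Real.sqrt_nonneg _), Complex.ofReal_mul, mul_pow,
    ← Complex.ofReal_pow, Real.sq_sqrt (Nat.cast_nonneg _)]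
  push_cast; ring

lemma gau_density (d : ℕ) : ∃ c : ℝ≥0∞, c ≠ 0 ∧ c ≠ ∞ ∧ _root_.stdGaussian d =
    c • (volume : Measure (Euc d)).withDensity fun z => ENNReal.ofReal (Real.exp (-(1/2) * ‖z‖ ^ 2)) := by
  set I : ℝ := ∫ v : Euc d, Real.exp (-(1/2) * ‖v‖ ^ 2) with hI
  have hI' : I = (Real.pi / (1/2)) ^ ((Module.finrank ℝ (Euc d) : ℝ) / 2) :=
    GaussianFourier.integral_rexp_neg_mul_sq_norm (by norm_num)
  have hIpos : 0 < I := by rw [hI']; positivity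
  have hintgr : Integrable (fun v : Euc d => Real.exp (-(1/2) * ‖v‖ ^ 2)) := by
    by_contra h
    rw [hI, integral_undef h] at hIpos
    exact lt_irrefl _ hIpos
  refine ⟨ENNReal.ofReal I⁻¹, by simpa using hIpos, by simp, ?_⟩
  set ρ := (volume : Measure (Euc d)).withDensity fun z => ENNReal.ofReal (Real.exp (-(1/2) * ‖z‖ ^ 2))
  have : IsFiniteMeasure ρ := isFiniteMeasure_withDensity_ofReal hintgr.2
  have : IsFiniteMeasure (ENNReal.ofReal I⁻¹ • ρ) := Measure.smul_finite _ (by simp)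
  apply Measure.ext_of_charFun
  ext t
  rw [gau_charFun, charFun_apply, integral_smul_measure,
    integral_withDensity_eq_integral_toReal_smul (by fun_prop) (by simp)]
  have h := GaussianFourier.integral_cexp_neg_mul_sq_norm_add (V := Euc d) (b := (1/2 : ℂ)) (by norm_num) Complex.I t
  have e : ∀ x : Euc d, (ENNReal.ofReal (Real.exp (-(1/2) * ‖x‖ ^ 2))).toReal • Complex.exp (⟪x, t⟫ * Complex.I)
      = Complex.exp (-(1/2) * ‖x‖ ^ 2 + Complex.I * ⟪t, x⟫) := by
    intro x
    rw [ENNReal.toReal_ofReal (Real.exp_nonneg _), Complex.exp_add, Complex.real_smul, real_inner_comm]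
    push_cast
    rw [mul_comm Complex.I]
  simp_rw [e]
  rw [h, ENNReal.toReal_ofReal (by positivity), Complex.real_smul, hI']
  have h2 : ((Real.pi / (1/2) : ℝ) ^ ((Module.finrank ℝ (Euc d) : ℝ) / 2) : ℝ)
      = ((Real.pi / (1/2) : ℂ)) ^ ((Module.finrank ℝ (Euc d) : ℂ) / 2) := by
    rw [Complex.ofReal_cpow (by positivity)]; push_cast; rfl
  rw [Complex.ofReal_inv, h2, ← mul_assoc, inv_mul_cancel₀, one_mul]
  · congr 1
    rw [Complex.I_sq]; ring
  · rw [← h2, ← hI']; exact_mod_cast hIpos.ne'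

/-- Mean of the gradient after a Gaussian perturbation. -/
lemma gau_taylor {d : ℕ} {U : Euc d → ℝ} {m L Lt : ℝ} (hU : StrongAssumption U m L)
    (hU3 : ThirdDerivBounded U Lt) (x v : Euc d) (c : ℝ) :
    |∫ z, ⟪v, gradient U (x + c • z) - gradient U x⟫ ∂(_root_.stdGaussian d)| ≤
      ‖v‖ * (Lt / 2 * c ^ 2 * d) := by
  have h1 : MemLp (fun z : Euc d => z) 2 (_root_.stdGaussian d) := gau_memLp d 2 (by simp)
  have hsq : Integrable (fun z : Euc d => ‖z‖ ^ 2) (_root_.stdGaussian d) := h1.integrable_norm_pow (by norm_num)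
  have hlin : Integrable (fun z : Euc d => ⟪v, hess U x (c • z)⟫) (_root_.stdGaussian d) := by
    have : MemLp (fun z : Euc d => hess U x (c • z)) 2 (_root_.stdGaussian d) := by
      exact (hess U x).comp_memLp' (h1.const_smul c)
    exact (this.const_inner v).integrable (by norm_num)
  have hlin0 : ∫ z, ⟪v, hess U x (c • z)⟫ ∂(_root_.stdGaussian d) = 0 := by
    have := gau_inner d (c • (hess U x).adjoint v)
    rw [← this]
    congr 1; ext z
    rw [real_inner_smul_left, ContinuousLinearMap.adjoint_inner_left, map_smul, inner_smul_right]
  have hcont := grad_cont hU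
  have hrem : ∀ z, ‖⟪v, gradient U (x + c • z) - gradient U x⟫ - ⟪v, hess U x (c • z)⟫‖ ≤
      ‖v‖ * (Lt / 2 * c ^ 2) * ‖z‖ ^ 2 := by
    intro z
    rw [← inner_sub_right]
    refine (norm_inner_le_norm _ _).trans ?_
    have := grad_taylor hU3 x (c • z)
    rw [norm_smul, mul_pow, Real.norm_eq_abs, sq_abs] at this
    calc _ ≤ ‖v‖ * (Lt / 2 * (c ^ 2 * ‖z‖ ^ 2)) := by gcongr
      _ = _ := by ring
  have hintr : Integrable (fun z => ⟪v, gradient U (x + c • z) - gradient U x⟫ - ⟪v, hess U x (c • z)⟫)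
      (_root_.stdGaussian d) := by
    refine (hsq.const_mul (‖v‖ * (Lt / 2 * c ^ 2))).mono' ?_ (ae_of_all _ hrem)
    exact (by fun_prop : Continuous _).aestronglyMeasurable
  have e : ∫ z, ⟪v, gradient U (x + c • z) - gradient U x⟫ ∂(_root_.stdGaussian d) =
      ∫ z, (⟪v, gradient U (x + c • z) - gradient U x⟫ - ⟪v, hess U x (c • z)⟫) ∂(_root_.stdGaussian d) := by
    have := integral_add hintr hlin
    rw [hlin0, add_zero] at this
    rw [← this]; congr 1; ext z; simp
  rw [e, ← Real.norm_eq_abs]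
  refine (norm_integral_le_of_norm_le (hsq.const_mul _) (ae_of_all _ hrem)).trans ?_
  rw [integral_const_mul, gau_norm_sq, mul_assoc]

/-! ### Gibbs measure -/

lemma U_cont {d : ℕ} {U : Euc d → ℝ} {m L : ℝ} (hU : StrongAssumption U m L) : Continuous U :=
  hU.1.continuous

lemma U_lower {d : ℕ} {U : Euc d → ℝ} {m L : ℝ} (hU : StrongAssumption U m L) (x : Euc d) :
    U 0 + m / 2 * ‖x‖ ^ 2 ≤ U x := by
  have := (hU.2.2.2.1 0 x).1
  rw [hU.2.2.2.2] at this
  simp at this; linarith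

lemma exp_sq_integrable (d : ℕ) {b : ℝ} (hb : 0 < b) :
    Integrable (fun v : Euc d => Real.exp (-b * ‖v‖ ^ 2)) := by
  have h := GaussianFourier.integral_rexp_neg_mul_sq_norm (V := Euc d) hb
  have hpos : 0 < ∫ v : Euc d, Real.exp (-b * ‖v‖ ^ 2) := by rw [h]; positivity
  by_contra h2
  rw [integral_undef h2] at hpos
  exact lt_irrefl _ hpos

lemma pow_exp_integrable {d : ℕ} {U : Euc d → ℝ} {m L : ℝ} (hU : StrongAssumption U m L) (n : ℕ) :
    Integrable (fun x : Euc d => ‖x‖ ^ n * Real.exp (-U x)) := by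
  have hm := hU.2.1
  have h1 : Integrable (fun v : Euc d => (1 + n.factorial / (m/4) ^ n) * Real.exp (-U 0) * Real.exp (-(m/4) * ‖v‖ ^ 2)) :=
    (exp_sq_integrable d (by positivity : 0 < m/4)).const_mul _
  refine h1.mono' ((by have := U_cont hU; fun_prop : Continuous _).aestronglyMeasurable) (ae_of_all _ fun x => ?_)
  rw [Real.norm_of_nonneg (by positivity)]
  have e1 : ‖x‖ ^ n ≤ 1 + ‖x‖ ^ (2 * n) := by
    rw [mul_comm, pow_mul]
    nlinarith [sq_nonneg (‖x‖ ^ n - 1)]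
  have e2 : (m/4 * ‖x‖ ^ 2) ^ n / n.factorial ≤ Real.exp (m/4 * ‖x‖ ^ 2) :=
    Real.pow_div_factorial_le_exp _ (by positivity) n
  have e3 : ‖x‖ ^ (2 * n) ≤ n.factorial / (m/4) ^ n * Real.exp (m/4 * ‖x‖ ^ 2) := by
    rw [div_le_iff₀ (by positivity), mul_pow] at e2
    rw [div_mul_eq_mul_div, le_div_iff₀ (by positivity), pow_mul]
    linarith
  have e4 : (1:ℝ) ≤ Real.exp (m/4 * ‖x‖ ^ 2) := Real.one_le_exp (by positivity)
  have e5 : Real.exp (-U x) ≤ Real.exp (-U 0) * (Real.exp (-(m/4) * ‖x‖ ^ 2) * Real.exp (-(m/4) * ‖x‖ ^ 2)) := by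
    rw [← Real.exp_add, ← Real.exp_add]
    apply Real.exp_le_exp.2
    have := U_lower hU x
    linarith
  calc ‖x‖ ^ n * Real.exp (-U x) ≤ ((1 + n.factorial / (m/4) ^ n) * Real.exp (m/4 * ‖x‖ ^ 2)) *
        (Real.exp (-U 0) * (Real.exp (-(m/4) * ‖x‖ ^ 2) * Real.exp (-(m/4) * ‖x‖ ^ 2))) := by
        apply mul_le_mul _ e5 (Real.exp_nonneg _) (by positivity)
        linarith
    _ = (1 + n.factorial / (m/4) ^ n) * Real.exp (-U 0) * Real.exp (-(m/4) * ‖x‖ ^ 2) *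
        (Real.exp (m/4 * ‖x‖ ^ 2) * Real.exp (-(m/4) * ‖x‖ ^ 2)) := by ring
    _ = _ := by rw [← Real.exp_add]; simp

lemma expU_integrable {d : ℕ} {U : Euc d → ℝ} {m L : ℝ} (hU : StrongAssumption U m L) :
    Integrable (fun x : Euc d => Real.exp (-U x)) := by
  simpa using pow_exp_integrable hU 0

/-- normalizing constant -/
def gZ {d : ℕ} (U : Euc d → ℝ) : ℝ≥0∞ := ∫⁻ x, ENNReal.ofReal (Real.exp (-U x)) ∂(volume : Measure (Euc d))

lemma gZ_ne_top {d : ℕ} {U : Euc d → ℝ} {m L : ℝ} (hU : StrongAssumption U m L) : gZ U ≠ ∞ :=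
  (expU_integrable hU).lintegral_lt_top.ne

lemma gZ_ne_zero {d : ℕ} {U : Euc d → ℝ} {m L : ℝ} (hU : StrongAssumption U m L) : gZ U ≠ 0 := by
  have := U_cont hU
  unfold gZ
  rw [Ne, lintegral_eq_zero_iff (by fun_prop)]
  intro h
  have h2 : ∀ᵐ x : Euc d, False := by
    filter_upwards [h] with x hx
    simp at hx
    exact absurd hx (not_le.2 (Real.exp_pos _))
  rw [ae_iff] at h2
  simp at h2
  exact NeZero.ne (volume : Measure (Euc d)) h2

lemma gibbs_def {d : ℕ} (U : Euc d → ℝ) : gibbs U = (gZ U)⁻¹ •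
    (volume : Measure (Euc d)).withDensity fun x => ENNReal.ofReal (Real.exp (-U x)) := rfl

lemma gibbs_prob {d : ℕ} {U : Euc d → ℝ} {m L : ℝ} (hU : StrongAssumption U m L) :
    IsProbabilityMeasure (gibbs U) := by
  constructor
  rw [gibbs_def, Measure.smul_apply, withDensity_apply _ MeasurableSet.univ, Measure.restrict_univ]
  exact ENNReal.inv_mul_cancel (gZ_ne_zero hU) (gZ_ne_top hU)

lemma gibbs_integrable {d : ℕ} {U : Euc d → ℝ} {m L : ℝ} (hU : StrongAssumption U m L) {f : Euc d → ℝ}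
    (hf : Integrable (fun x => Real.exp (-U x) * f x)) : Integrable f (gibbs U) := by
  have := U_cont hU
  rw [gibbs_def]
  apply Integrable.smul_measure _ (by simpa using gZ_ne_zero hU)
  rw [integrable_withDensity_iff_integrable_smul' (by fun_prop) (by simp)]
  refine hf.congr (ae_of_all _ fun x => ?_)
  simp [ENNReal.toReal_ofReal (Real.exp_nonneg _)]

lemma gibbs_integral {d : ℕ} {U : Euc d → ℝ} {m L : ℝ} (hU : StrongAssumption U m L) (f : Euc d → ℝ) :
    ∫ x, f x ∂(gibbs U) = (gZ U).toReal⁻¹ * ∫ x, Real.exp (-U x) * f x := by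
  have := U_cont hU
  rw [gibbs_def, integral_smul_measure, integral_withDensity_eq_integral_toReal_smul (by fun_prop) (by simp)]
  simp [ENNReal.toReal_ofReal (Real.exp_nonneg _), ENNReal.toReal_inv]

lemma gibbs_memLp {d : ℕ} {U : Euc d → ℝ} {m L : ℝ} (hU : StrongAssumption U m L) (n : ℕ) (hn : n ≠ 0) :
    MemLp (fun x : Euc d => x) n (gibbs U) := by
  rw [← integrable_norm_rpow_iff (by fun_prop) (by exact_mod_cast hn) (by simp)]
  apply gibbs_integrable hU
  refine (pow_exp_integrable hU n).congr (ae_of_all _ fun x => ?_)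
  simp [mul_comm]

lemma expU_ibp {d : ℕ} {U : Euc d → ℝ} {m L : ℝ} (hU : StrongAssumption U m L) (i : Fin d) :
    Integrable (fun x : Euc d => Real.exp (-U x) * (x i * gradient U x i)) ∧
    ∫ x : Euc d, Real.exp (-U x) * (x i * gradient U x i) = ∫ x : Euc d, Real.exp (-U x) := by
  have hc := U_cont hU
  have hg := grad_cont hU
  have hd : Differentiable ℝ U := hU.1.differentiable (by norm_num)
  let v : Euc d := EuclideanSpace.single i 1
  have hi : ∀ x : Euc d, |x i| ≤ ‖x‖ := fun x => by simpa using PiLp.norm_apply_le x i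
  have hfg : ∀ x, fderiv ℝ (fun x => Real.exp (-U x)) x v = - (Real.exp (-U x) * gradient U x i) := by
    intro x
    have h1 : HasFDerivAt (fun x => Real.exp (-U x)) (Real.exp (-U x) • (-(fderiv ℝ U x))) x :=
      ((hd x).hasFDerivAt.neg).exp
    rw [h1.fderiv]
    have h2 : fderiv ℝ U x v = ⟪gradient U x, v⟫ := by
      simp [gradient]
    have h3 : ⟪gradient U x, v⟫ = gradient U x i := by
      rw [EuclideanSpace.inner_single_right]; simp
    rw [ContinuousLinearMap.smul_apply, ContinuousLinearMap.neg_apply, h2, h3, smul_eq_mul, mul_neg]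
  have hff : ∀ x : Euc d, fderiv ℝ (fun x : Euc d => x i) x v = 1 := by
    intro x
    have : HasFDerivAt (fun x : Euc d => x i) (EuclideanSpace.proj i : Euc d →L[ℝ] ℝ) x :=
      (EuclideanSpace.proj i : Euc d →L[ℝ] ℝ).hasFDerivAt
    rw [this.fderiv]; simp [v]
  have hintgr : Integrable (fun x : Euc d => Real.exp (-U x) * (x i * gradient U x i)) := by
    refine ((pow_exp_integrable hU 2).const_mul L).mono' ((by fun_prop : Continuous _).aestronglyMeasurable)
      (ae_of_all _ fun x => ?_)
    rw [norm_mul, norm_mul, Real.norm_of_nonneg (Real.exp_nonneg _)]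
    have := grad_bound hU x
    calc _ ≤ Real.exp (-U x) * (‖x‖ * (L * ‖x‖)) := by
          gcongr
          · exact hi x
          · exact (hi _).trans this
      _ = _ := by ring
  have key := integral_mul_fderiv_eq_neg_fderiv_mul_of_integrable (μ := (volume : Measure (Euc d)))
    (f := fun x : Euc d => x i) (g := fun x => Real.exp (-U x)) (v := v) ?_ ?_ ?_ ?_ ?_
  · refine ⟨hintgr, ?_⟩
    simp only [hfg, hff, one_mul, mul_neg, integral_neg, neg_inj] at key
    rw [← key]
    congr 1; ext x; ring
  · simpa [hff] using expU_integrable hU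
  · simp only [hfg]
    refine hintgr.neg.congr (ae_of_all _ fun x => ?_)
    simp; ring
  · refine ((pow_exp_integrable hU 1)).mono' ((by fun_prop : Continuous _).aestronglyMeasurable)
      (ae_of_all _ fun x => ?_)
    rw [norm_mul, Real.norm_of_nonneg (Real.exp_nonneg _), pow_one]
    gcongr; exact hi x
  · intro x _
    exact (EuclideanSpace.proj i : Euc d →L[ℝ] ℝ).differentiableAt
  · intro x _
    exact (hd x).neg.exp

lemma gibbs_second {d : ℕ} {U : Euc d → ℝ} {m L : ℝ} (hU : StrongAssumption U m L) :
    ∫ x, ‖x‖ ^ 2 ∂(gibbs U) ≤ d / m := by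
  have hm := hU.2.1
  have hZ : 0 < (gZ U).toReal := ENNReal.toReal_pos (gZ_ne_zero hU) (gZ_ne_top hU)
  have hZi : ∫ x : Euc d, Real.exp (-U x) = (gZ U).toReal := by
    rw [gZ, integral_eq_lintegral_of_nonneg_ae (ae_of_all _ fun x => Real.exp_nonneg _)
      (expU_integrable hU).1]
  have hs : ∫ x : Euc d, Real.exp (-U x) * ⟪x, gradient U x⟫ = d * (gZ U).toReal := by
    have : ∀ x : Euc d, Real.exp (-U x) * ⟪x, gradient U x⟫ = ∑ i, Real.exp (-U x) * (x i * gradient U x i) := by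
      intro x
      rw [← Finset.mul_sum]
      congr 1
      rw [PiLp.inner_apply]
      refine Finset.sum_congr rfl fun i _ => ?_
      simp [mul_comm]
    simp_rw [this]
    rw [integral_finsetSum _ (fun i _ => (expU_ibp hU i).1)]
    simp_rw [(expU_ibp hU _).2, hZi]
    simp
  have hsi : Integrable (fun x : Euc d => Real.exp (-U x) * ⟪x, gradient U x⟫) := by
    have hc := U_cont hU
    have hg := grad_cont hU
    refine ((pow_exp_integrable hU 2).const_mul L).mono' ((by fun_prop : Continuous _).aestronglyMeasurable)
      (ae_of_all _ fun x => ?_)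
    rw [norm_mul, Real.norm_of_nonneg (Real.exp_nonneg _)]
    have := grad_bound hU x
    calc _ ≤ Real.exp (-U x) * (‖x‖ * (L * ‖x‖)) := by
          gcongr
          exact (norm_inner_le_norm _ _).trans (by gcongr)
      _ = _ := by ring
  have hle : m * ∫ x : Euc d, Real.exp (-U x) * ‖x‖ ^ 2 ≤ d * (gZ U).toReal := by
    rw [← hs, ← integral_const_mul]
    apply integral_mono _ hsi
    · intro x
      have := grad_mono hU x 0
      simp only [sub_zero, hU.2.2.2.2] at this
      simp only
      nlinarith [Real.exp_pos (-U x)]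
    · refine ((pow_exp_integrable hU 2).const_mul m).congr (ae_of_all _ fun x => ?_)
      simp only; ring
  rw [gibbs_integral hU, inv_mul_le_iff₀ hZ, mul_div_assoc', le_div_iff₀ hm]
  linarith

/-! ### A Metropolis adjusted fine-step chain -/

def malaY {d : ℕ} (U : Euc d → ℝ) (s : ℝ) (x z : Euc d) : Euc d :=
  x - (s ^ 2) • gradient U x + (Real.sqrt 2 * s) • z

def malaD {d : ℕ} (U : Euc d → ℝ) (s : ℝ) (x y : Euc d) : ℝ :=
  U x - U y + 1 / 2 * ⟪gradient U y + gradient U x, y - x⟫ +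
    s ^ 2 / 4 * (‖gradient U x‖ ^ 2 - ‖gradient U y‖ ^ 2)

def malaT {d : ℕ} (U : Euc d → ℝ) (s : ℝ) (x : Euc d) (r : Euc d × ℝ) : Euc d :=
  if r.2 ≤ Real.exp (malaD U s x (malaY U s x r.1)) then malaY U s x r.1 else x

def malaNoise (d : ℕ) : Measure (Euc d × ℝ) :=
  (_root_.stdGaussian d).prod (volume.restrict (Set.Icc (0:ℝ) 1))

instance unif_prob : IsProbabilityMeasure (volume.restrict (Set.Icc (0:ℝ) 1)) := ⟨by simp⟩

instance malaNoise_prob (d : ℕ) : IsProbabilityMeasure (malaNoise d) := by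
  unfold malaNoise; infer_instance

lemma mset_le (a : ℝ) : MeasurableSet {u : ℝ | u ≤ a} := measurableSet_Iic

lemma unif_le (a : ℝ) (ha : 0 ≤ a) :
    (volume.restrict (Set.Icc (0:ℝ) 1)) {u | u ≤ a} = ENNReal.ofReal (min 1 a) := by
  rw [Measure.restrict_apply (mset_le a)]
  have : {u : ℝ | u ≤ a} ∩ Set.Icc 0 1 = Set.Icc 0 (min 1 a) := by
    ext u; simp; tauto
  rw [this, Real.volume_Icc, sub_zero]

lemma unif_gt (a : ℝ) (ha : 0 ≤ a) :
    (volume.restrict (Set.Icc (0:ℝ) 1)) {u | ¬ u ≤ a} = ENNReal.ofReal (1 - min 1 a) := by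
  have h : {u : ℝ | ¬ u ≤ a} = {u | u ≤ a}ᶜ := rfl
  rw [h, prob_compl_eq_one_sub (mset_le a), unif_le a ha,
    ENNReal.ofReal_sub _ (by positivity), ENNReal.ofReal_one]

lemma malaY_cont {d : ℕ} {U : Euc d → ℝ} {m L : ℝ} (hU : StrongAssumption U m L) (s : ℝ) :
    Continuous (fun p : Euc d × Euc d => malaY U s p.1 p.2) := by
  have := grad_cont hU
  unfold malaY; fun_prop

lemma malaD_cont {d : ℕ} {U : Euc d → ℝ} {m L : ℝ} (hU : StrongAssumption U m L) (s : ℝ) :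
    Continuous (fun p : Euc d × Euc d => malaD U s p.1 p.2) := by
  have := grad_cont hU
  have := U_cont hU
  unfold malaD; fun_prop

lemma malaT_meas {d : ℕ} {U : Euc d → ℝ} {m L : ℝ} (hU : StrongAssumption U m L) (s : ℝ) :
    Measurable (fun p : Euc d × (Euc d × ℝ) => malaT U s p.1 p.2) := by
  have h1 : Measurable (fun p : Euc d × (Euc d × ℝ) => malaY U s p.1 p.2.1) :=
    (malaY_cont hU s).measurable.comp (by fun_prop : Measurable fun p : Euc d × (Euc d × ℝ) => (p.1, p.2.1))
  have h2 : Measurable (fun p : Euc d × (Euc d × ℝ) => malaD U s p.1 (malaY U s p.1 p.2.1)) :=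
    (malaD_cont hU s).measurable.comp (measurable_fst.prodMk h1)
  unfold malaT
  exact Measurable.ite (measurableSet_le (by fun_prop) (by fun_prop)) h1 measurable_fst

/-- the log of the joint proposal density -/
def malaA {d : ℕ} (U : Euc d → ℝ) (s : ℝ) (x y : Euc d) : ℝ :=
  -U x - 1 / (4 * s ^ 2) * ‖y - x + s ^ 2 • gradient U x‖ ^ 2

lemma malaD_eq {d : ℕ} (U : Euc d → ℝ) {s : ℝ} (hs : 0 < s) (x y : Euc d) :
    malaD U s x y = malaA U s y x - malaA U s x y := by
  unfold malaD malaA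
  rw [norm_add_sq_real, norm_add_sq_real, norm_smul, norm_smul, inner_smul_right, inner_smul_right,
    ← norm_neg (y - x), neg_sub, ← neg_sub x y, inner_neg_left, inner_neg_right, inner_add_left,
    real_inner_comm _ (x - y), real_inner_comm _ (x-y), Real.norm_of_nonneg (by positivity)]
  field_simp
  ring

lemma lint_affine {d : ℕ} (a : Euc d) {c : ℝ} (hc : 0 < c) : ∃ C : ℝ≥0∞, 
    ∀ φ : Euc d → ℝ≥0∞, Measurable φ → ∫⁻ z, φ z = C * ∫⁻ y, φ (c⁻¹ • (y - a)) := by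
  refine ⟨(ENNReal.ofReal |((c⁻¹) ^ (Module.finrank ℝ (Euc d)))⁻¹|)⁻¹, fun φ hφ => ?_⟩
  have h1 : ∫⁻ y, φ (c⁻¹ • (y - a)) = ∫⁻ y, φ (c⁻¹ • y) :=
    lintegral_sub_right_eq_self (fun y => φ (c⁻¹ • y)) a
  have h2 : ∫⁻ y, φ (c⁻¹ • y) = ∫⁻ y, φ y ∂((volume : Measure (Euc d)).map (fun y => c⁻¹ • y)) := by
    rw [lintegral_map hφ (by fun_prop)]
  rw [h1, h2, Measure.map_addHaar_smul _ (by positivity), lintegral_smul_measure, smul_eq_mul, ← mul_assoc,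
    ENNReal.inv_mul_cancel, one_mul]
  · rw [Ne, ENNReal.ofReal_eq_zero, not_le]; positivity
  · simp

lemma lint_affine' {d : ℕ} {c : ℝ} (hc : 0 < c) : ∃ C : ℝ≥0∞, ∀ a : Euc d,
    ∀ φ : Euc d → ℝ≥0∞, Measurable φ → ∫⁻ z, φ z = C * ∫⁻ y, φ (c⁻¹ • (y - a)) := by
  obtain ⟨C, hC⟩ := lint_affine (d := d) 0 hc
  refine ⟨C, fun a φ hφ => ?_⟩
  rw [hC φ hφ]
  congr 1
  have h1 := lintegral_sub_right_eq_self (μ := (volume : Measure (Euc d))) (fun y => φ (c⁻¹ • y)) a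
  simpa using h1.symm

lemma mala_inner {d : ℕ} {U : Euc d → ℝ} {m L : ℝ} (hU : StrongAssumption U m L) {s : ℝ} (hs : 0 < s) :
    ∃ C : ℝ≥0∞, ∀ (x : Euc d) (F : Euc d → ℝ≥0∞), Measurable F →
      ∫⁻ z, F (malaY U s x z) ∂(_root_.stdGaussian d) =
      C * ∫⁻ y, ENNReal.ofReal (Real.exp (-(1 / (4 * s ^ 2)) * ‖y - x + s ^ 2 • gradient U x‖ ^ 2)) * F y := by
  obtain ⟨c, -, -, hγ⟩ := gau_density d
  obtain ⟨C, hC⟩ := lint_affine' (d := d) (c := Real.sqrt 2 * s) (by positivity)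
  have hY := malaY_cont hU s
  refine ⟨c * C, fun x F hF => ?_⟩
  have mY : Measurable (fun z => malaY U s x z) := by
    have : Continuous (fun z => malaY U s x z) := hY.comp (by fun_prop : Continuous fun z => (x, z))
    exact this.measurable
  have mfY : Measurable (fun z => F (malaY U s x z)) := hF.comp mY
  have mg : Measurable (fun z : Euc d => ENNReal.ofReal (Real.exp (-(1/2) * ‖z‖ ^ 2))) := by fun_prop
  rw [hγ, lintegral_smul_measure, smul_eq_mul, lintegral_withDensity_eq_lintegral_mul _ mg mfY,
    hC (x - s ^ 2 • gradient U x) _ (Measurable.mul mg mfY), mul_assoc]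
  congr 2
  apply lintegral_congr
  intro y
  have e1 : malaY U s x ((Real.sqrt 2 * s)⁻¹ • (y - (x - s ^ 2 • gradient U x))) = y := by
    unfold malaY
    rw [smul_smul, mul_inv_cancel₀ (by positivity), one_smul]; abel
  have e2 : -(1/2) * ‖(Real.sqrt 2 * s)⁻¹ • (y - (x - s ^ 2 • gradient U x))‖ ^ 2 =
      -(1 / (4 * s ^ 2)) * ‖y - x + s ^ 2 • gradient U x‖ ^ 2 := by
    rw [norm_smul, mul_pow, Real.norm_of_nonneg (by positivity), inv_pow, mul_pow,
      Real.sq_sqrt (by norm_num), sub_sub_eq_add_sub, add_sub_right_comm]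
    field_simp
    ring
  simp only [Pi.mul_apply, e1, e2]

lemma mala_dens {d : ℕ} (U : Euc d → ℝ) {s : ℝ} (hs : 0 < s) (x y : Euc d) :
    ENNReal.ofReal (Real.exp (-U x)) *
      (ENNReal.ofReal (Real.exp (-(1 / (4 * s ^ 2)) * ‖y - x + s ^ 2 • gradient U x‖ ^ 2)) *
        ENNReal.ofReal (min 1 (Real.exp (malaD U s x y)))) =
      ENNReal.ofReal (Real.exp (min (malaA U s x y) (malaA U s y x))) := by
  have e3 : min 1 (Real.exp (malaD U s x y)) = Real.exp (min 0 (malaD U s x y)) := by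
    rw [← Real.exp_zero, Real.exp_monotone.map_min]
  have e4 : -U x + -(1 / (4 * s ^ 2)) * ‖y - x + s ^ 2 • gradient U x‖ ^ 2 = malaA U s x y := by
    unfold malaA; ring
  rw [e3, ← ENNReal.ofReal_mul (Real.exp_nonneg _), ← ENNReal.ofReal_mul (Real.exp_nonneg _), ← Real.exp_add,
    ← Real.exp_add, ← add_assoc, e4, malaD_eq U hs, ← min_add_add_left, add_zero, add_sub_cancel]

lemma mala_joint {d : ℕ} {U : Euc d → ℝ} {m L : ℝ} (hU : StrongAssumption U m L) {s : ℝ} (hs : 0 < s) :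
    ∃ C : ℝ≥0∞, ∀ G : Euc d × Euc d → ℝ≥0∞, Measurable G →
      ∫⁻ x, ∫⁻ z, ENNReal.ofReal (min 1 (Real.exp (malaD U s x (malaY U s x z)))) * G (x, malaY U s x z)
        ∂(_root_.stdGaussian d) ∂(gibbs U) =
      C * ∫⁻ x, ∫⁻ y, ENNReal.ofReal (Real.exp (min (malaA U s x y) (malaA U s y x))) * G (x, y) := by
  obtain ⟨C, hC⟩ := mala_inner hU hs
  have hUc := U_cont hU
  have hg := grad_cont hU
  have hDm := (malaD_cont hU s).measurable
  have mU : Measurable (fun x : Euc d => ENNReal.ofReal (Real.exp (-U x))) := by fun_prop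
  refine ⟨(gZ U)⁻¹ * C, fun G hG => ?_⟩
  have hin : ∀ x, ∫⁻ z, ENNReal.ofReal (min 1 (Real.exp (malaD U s x (malaY U s x z)))) * G (x, malaY U s x z)
      ∂(_root_.stdGaussian d) = C * ∫⁻ y, ENNReal.ofReal (Real.exp (-(1 / (4 * s ^ 2)) * ‖y - x + s ^ 2 • gradient U x‖ ^ 2)) *
        (ENNReal.ofReal (min 1 (Real.exp (malaD U s x y))) * G (x, y)) := by
    intro x
    have mD : Measurable (fun y => malaD U s x y) := hDm.comp (measurable_prodMk_left (x := x))
    have mG : Measurable (fun y => G (x, y)) := hG.comp (measurable_prodMk_left (x := x))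
    exact hC x (fun y => ENNReal.ofReal (min 1 (Real.exp (malaD U s x y))) * G (x, y))
      ((measurable_const.min mD.exp).ennreal_ofReal.mul mG)
  rw [lintegral_congr hin]
  have mgau : Measurable (fun p : Euc d × Euc d => ENNReal.ofReal (Real.exp (-(1 / (4 * s ^ 2)) *
      ‖p.2 - p.1 + s ^ 2 • gradient U p.1‖ ^ 2))) := by
    have : Continuous (fun p : Euc d × Euc d => Real.exp (-(1 / (4 * s ^ 2)) *
      ‖p.2 - p.1 + s ^ 2 • gradient U p.1‖ ^ 2)) := by fun_prop
    exact this.measurable.ennreal_ofReal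
  have mjoint : Measurable (fun p : Euc d × Euc d => ENNReal.ofReal (Real.exp (-(1 / (4 * s ^ 2)) *
      ‖p.2 - p.1 + s ^ 2 • gradient U p.1‖ ^ 2)) *
        (ENNReal.ofReal (min 1 (Real.exp (malaD U s p.1 p.2))) * G (p.1, p.2))) :=
    mgau.mul ((measurable_const.min hDm.exp).ennreal_ofReal.mul hG)
  generalize hJ : (fun x y => ENNReal.ofReal (Real.exp (-(1 / (4 * s ^ 2)) *
      ‖y - x + s ^ 2 • gradient U x‖ ^ 2)) *
        (ENNReal.ofReal (min 1 (Real.exp (malaD U s x y))) * G (x, y)) : Euc d → Euc d → ℝ≥0∞) = J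
  have hJ' : ∀ x y, ENNReal.ofReal (Real.exp (-(1 / (4 * s ^ 2)) *
      ‖y - x + s ^ 2 • gradient U x‖ ^ 2)) *
        (ENNReal.ofReal (min 1 (Real.exp (malaD U s x y))) * G (x, y)) = J x y := fun x y => by rw [← hJ]
  simp only [hJ'] at mjoint ⊢
  have mint : Measurable (fun x => ∫⁻ y, J x y) := mjoint.lintegral_prod_right'
  rw [lintegral_const_mul _ mint, gibbs_def, lintegral_smul_measure, smul_eq_mul,
    lintegral_withDensity_eq_lintegral_mul _ mU mint, mul_left_comm, ← mul_assoc]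
  congr 1
  apply lintegral_congr
  intro x
  have mx : Measurable (fun y => J x y) := mjoint.comp (measurable_prodMk_left (x := x))
  rw [Pi.mul_apply, ← lintegral_const_mul _ mx]
  apply lintegral_congr
  intro y
  rw [← hJ', ← mala_dens U hs]
  ring

lemma mala_rev {d : ℕ} {U : Euc d → ℝ} {m L : ℝ} (hU : StrongAssumption U m L) {s : ℝ} (hs : 0 < s)
    (f : Euc d → ℝ≥0∞) (hf : Measurable f) :
    ∫⁻ x, ∫⁻ z, ENNReal.ofReal (min 1 (Real.exp (malaD U s x (malaY U s x z)))) * f (malaY U s x z)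
        ∂(_root_.stdGaussian d) ∂(gibbs U) =
    ∫⁻ x, ∫⁻ z, ENNReal.ofReal (min 1 (Real.exp (malaD U s x (malaY U s x z)))) * f x
        ∂(_root_.stdGaussian d) ∂(gibbs U) := by
  obtain ⟨C, hC⟩ := mala_joint hU hs
  have hUc := U_cont hU
  have hg := grad_cont hU
  have hAc : Measurable (fun p : Euc d × Euc d => malaA U s p.1 p.2) := by
    have : Continuous (fun p : Euc d × Euc d => malaA U s p.1 p.2) := by
      unfold malaA; fun_prop
    exact this.measurable
  have hAc' : Measurable (fun p : Euc d × Euc d => malaA U s p.2 p.1) := hAc.comp measurable_swap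
  have h1 := hC (fun p => f p.2) (by fun_prop)
  have h2 := hC (fun p => f p.1) (by fun_prop)
  simp only at h1 h2
  rw [h1, h2]
  congr 1
  rw [lintegral_lintegral_swap]
  · apply lintegral_congr; intro x
    apply lintegral_congr; intro y
    rw [min_comm]
  · apply Measurable.aemeasurable
    unfold Function.uncurry
    fun_prop

lemma mala_inv {d : ℕ} {U : Euc d → ℝ} {m L : ℝ} (hU : StrongAssumption U m L) {s : ℝ} (hs : 0 < s) :
    ((gibbs U).prod (malaNoise d)).map (fun p => malaT U s p.1 p.2) = gibbs U := by
  have := gibbs_prob hU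
  have hT := malaT_meas hU s
  have hY := (malaY_cont hU s).measurable
  have hD := (malaD_cont hU s).measurable
  have hD' : Measurable (fun p : Euc d × Euc d => malaD U s p.1 (malaY U s p.1 p.2)) :=
    hD.comp (measurable_fst.prodMk hY)
  apply Measure.ext_of_lintegral
  intro f hf
  have hfT : Measurable (fun p : Euc d × (Euc d × ℝ) => f (malaT U s p.1 p.2)) := hf.comp hT
  rw [lintegral_map hf hT, lintegral_prod _ hfT.aemeasurable]
  have h1 : ∀ x, ∫⁻ r, f (malaT U s x r) ∂(malaNoise d) = 
    ∫⁻ z, ENNReal.ofReal (min 1 (Real.exp (malaD U s x (malaY U s x z)))) * f (malaY U s x z)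
      + ENNReal.ofReal (1 - min 1 (Real.exp (malaD U s x (malaY U s x z)))) * f x ∂(_root_.stdGaussian d) := by
    intro x
    have hfT2 : Measurable (fun r : Euc d × ℝ => f (malaT U s x r)) :=
      hfT.comp (by fun_prop : Measurable fun r : Euc d × ℝ => (x, r))
    rw [malaNoise, lintegral_prod _ hfT2.aemeasurable]
    apply lintegral_congr
    intro z
    set a := Real.exp (malaD U s x (malaY U s x z)) with ha
    have e : ∀ u : ℝ, f (malaT U s x (z, u)) = Set.indicator {u | u ≤ a} (fun _ => f (malaY U s x z)) u +
        Set.indicator {u | ¬ u ≤ a} (fun _ => f x) u := by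
      intro u
      by_cases h : u ≤ a
      · simp [malaT, ← ha, h]
      · simp only [malaT, ← ha, h, Set.indicator, Set.mem_ofPred_eq, if_false, if_true, not_false_iff, zero_add]
    simp_rw [e]
    have m1 : MeasurableSet {u : ℝ | u ≤ a} := measurableSet_le measurable_id measurable_const
    have m2 : MeasurableSet {u : ℝ | ¬ u ≤ a} := m1.compl
    rw [lintegral_add_left (measurable_const.indicator m1), lintegral_indicator_const m1,
      lintegral_indicator_const m2, unif_le a (Real.exp_nonneg _), unif_gt a (Real.exp_nonneg _),
      mul_comm, mul_comm (f x)]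
  simp_rw [h1]
  have hsum : ∀ x, (∫⁻ z, ENNReal.ofReal (min 1 (Real.exp (malaD U s x (malaY U s x z)))) * f (malaY U s x z)
      + ENNReal.ofReal (1 - min 1 (Real.exp (malaD U s x (malaY U s x z)))) * f x ∂(_root_.stdGaussian d)) = 
      (∫⁻ z, ENNReal.ofReal (min 1 (Real.exp (malaD U s x (malaY U s x z)))) * f (malaY U s x z) ∂(_root_.stdGaussian d))
      + ∫⁻ z, ENNReal.ofReal (1 - min 1 (Real.exp (malaD U s x (malaY U s x z)))) * f x ∂(_root_.stdGaussian d) := by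
    intro x
    rw [lintegral_add_left]
    have m1 : Measurable (fun z => malaY U s x z) := hY.comp (by fun_prop : Measurable fun z : Euc d => (x, z))
    have m2 : Measurable (fun z => malaD U s x (malaY U s x z)) := hD'.comp (by fun_prop : Measurable fun z : Euc d => (x, z))
    fun_prop
  have hsum2 : ∀ x, f x = 
      (∫⁻ z, ENNReal.ofReal (min 1 (Real.exp (malaD U s x (malaY U s x z)))) * f x ∂(_root_.stdGaussian d))
      + ∫⁻ z, ENNReal.ofReal (1 - min 1 (Real.exp (malaD U s x (malaY U s x z)))) * f x ∂(_root_.stdGaussian d) := by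
    intro x
    rw [← lintegral_add_left]
    · simp_rw [← add_mul]
      have : ∀ z, ENNReal.ofReal (min 1 (Real.exp (malaD U s x (malaY U s x z)))) +
          ENNReal.ofReal (1 - min 1 (Real.exp (malaD U s x (malaY U s x z)))) = 1 := by
        intro z
        rw [← ENNReal.ofReal_add (by positivity) (by simp)]; simp
      simp_rw [this]; simp
    have m2 : Measurable (fun z => malaD U s x (malaY U s x z)) := hD'.comp (by fun_prop : Measurable fun z : Euc d => (x, z))
    fun_prop
  simp_rw [hsum]
  conv_rhs => rw [lintegral_congr hsum2]
  rw [lintegral_add_left, lintegral_add_left, mala_rev hU hs f hf]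
  · exact Measurable.lintegral_prod_right' (f := fun p : Euc d × Euc d => 
      ENNReal.ofReal (min 1 (Real.exp (malaD U s p.1 (malaY U s p.1 p.2)))) * f p.1) (by fun_prop)
  · exact Measurable.lintegral_prod_right' (f := fun p : Euc d × Euc d => 
      ENNReal.ofReal (min 1 (Real.exp (malaD U s p.1 (malaY U s p.1 p.2)))) * f (malaY U s p.1 p.2)) (by fun_prop)

set_option linter.unusedSectionVars false

/-! ### Bounds in `L²` -/

def L2le {Ω E : Type*} [MeasurableSpace Ω] [NormedAddCommGroup E] (μ : Measure Ω) (f : Ω → E) (c : ℝ) : Prop :=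
  AEStronglyMeasurable f μ ∧ 0 ≤ c ∧ eLpNorm f 2 μ ≤ ENNReal.ofReal c

namespace L2le
variable {Ω Ω' E : Type*} [MeasurableSpace Ω] [MeasurableSpace Ω'] [NormedAddCommGroup E] [InnerProductSpace ℝ E]
  {μ : Measure Ω} {f g : Ω → E} {a b : ℝ}

lemma memLp (h : L2le μ f a) : MemLp f 2 μ := ⟨h.1, h.2.2.trans_lt ENNReal.ofReal_lt_top⟩

lemma nonneg (h : L2le μ f a) : 0 ≤ a := h.2.1

lemma add (hf : L2le μ f a) (hg : L2le μ g b) : L2le μ (fun x => f x + g x) (a + b) :=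
  ⟨hf.1.add hg.1, add_nonneg hf.2.1 hg.2.1, (eLpNorm_add_le hf.1 hg.1 (by norm_num)).trans (by
    rw [ENNReal.ofReal_add hf.2.1 hg.2.1]; exact add_le_add hf.2.2 hg.2.2)⟩

lemma sub (hf : L2le μ f a) (hg : L2le μ g b) : L2le μ (fun x => f x - g x) (a + b) :=
  ⟨hf.1.sub hg.1, add_nonneg hf.2.1 hg.2.1, (eLpNorm_sub_le hf.1 hg.1 (by norm_num)).trans (by
    rw [ENNReal.ofReal_add hf.2.1 hg.2.1]; exact add_le_add hf.2.2 hg.2.2)⟩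

lemma mono (hf : L2le μ f a) (h : a ≤ b) : L2le μ f b :=
  ⟨hf.1, hf.2.1.trans h, hf.2.2.trans (ENNReal.ofReal_le_ofReal h)⟩

lemma dom {E' : Type*} [NormedAddCommGroup E'] {f : Ω → E'} {k : ℝ} (hk : 0 ≤ k) (hf : AEStronglyMeasurable f μ)
    (hg : L2le μ g b) (h : ∀ x, ‖f x‖ ≤ k * ‖g x‖) : L2le μ f (k * b) := by
  refine ⟨hf, mul_nonneg hk hg.2.1, ?_⟩
  refine (eLpNorm_le_mul_eLpNorm_of_ae_le_mul (ae_of_all _ h) 2).trans ?_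
  rw [ENNReal.ofReal_mul hk]
  exact mul_le_mul_right hg.2.2 _

lemma smul (k : ℝ) (hf : L2le μ f a) : L2le μ (fun x => k • f x) (|k| * a) :=
  dom (abs_nonneg k) (hf.1.const_smul k) hf (fun x => by rw [norm_smul, Real.norm_eq_abs])

lemma comp {ν : Measure Ω'} {T : Ω' → Ω} (hT : Measurable T) (hf : L2le (ν.map T) f a) :
    L2le ν (fun x => f (T x)) a := by
  refine ⟨hf.1.comp_measurable hT, hf.2.1, ?_⟩
  have := hf.2.2
  rwa [eLpNorm_map_measure hf.1 hT.aemeasurable] at this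

lemma of_comp {ν : Measure Ω'} {T : Ω' → Ω} (hT : Measurable T) (hm : AEStronglyMeasurable f (ν.map T))
    (hf : L2le ν (fun x => f (T x)) a) : L2le (ν.map T) f a := by
  refine ⟨hm, hf.2.1, ?_⟩
  rw [eLpNorm_map_measure hm hT.aemeasurable]
  exact hf.2.2

lemma sq_eq (μ : Measure Ω) (f : Ω → E) : eLpNorm f 2 μ ^ 2 = ∫⁻ x, ‖f x‖ₑ ^ 2 ∂μ := by
  have := eLpNorm_nnreal_pow_eq_lintegral (μ := μ) (f := f) (p := 2) (by norm_num)
  simpa using this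

lemma lintegral_le (hf : L2le μ f a) : ∫⁻ x, ‖f x‖ₑ ^ 2 ∂μ ≤ ENNReal.ofReal (a ^ 2) := by
  rw [← sq_eq, ENNReal.ofReal_pow hf.2.1]
  exact pow_le_pow_left' hf.2.2 2

lemma of_lintegral (hf : AEStronglyMeasurable f μ) (ha : 0 ≤ a)
    (h : ∫⁻ x, ‖f x‖ₑ ^ 2 ∂μ ≤ ENNReal.ofReal (a ^ 2)) : L2le μ f a := by
  refine ⟨hf, ha, ?_⟩
  rw [← sq_eq, ENNReal.ofReal_pow ha] at h
  exact (ENNReal.pow_le_pow_left_iff (by norm_num)).1 h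

lemma integrable_sq (hf : L2le μ f a) : Integrable (fun x => ‖f x‖ ^ 2) μ :=
  MemLp.integrable_norm_pow (p := 2) hf.memLp (by norm_num)

lemma lint_int (hf : MemLp f 2 μ) : ∫⁻ x, ‖f x‖ₑ ^ 2 ∂μ = ENNReal.ofReal (∫ x, ‖f x‖ ^ 2 ∂μ) := by
  rw [ofReal_integral_eq_lintegral_ofReal (MemLp.integrable_norm_pow (p := 2) hf (by norm_num))
    (ae_of_all _ fun x => by positivity)]
  apply lintegral_congr; intro x
  rw [ENNReal.ofReal_pow (norm_nonneg _), ofReal_norm]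

lemma integral_le (hf : L2le μ f a) : ∫ x, ‖f x‖ ^ 2 ∂μ ≤ a ^ 2 := by
  have := hf.lintegral_le
  rw [lint_int hf.memLp] at this
  exact (ENNReal.ofReal_le_ofReal_iff (by positivity)).1 this

lemma of_integral (hf : MemLp f 2 μ) (ha : 0 ≤ a) (h : ∫ x, ‖f x‖ ^ 2 ∂μ ≤ a ^ 2) : L2le μ f a := by
  apply of_lintegral hf.1 ha
  rw [lint_int hf]
  exact ENNReal.ofReal_le_ofReal h

lemma of_memLp (hf : MemLp f 2 μ) : L2le μ f (Real.sqrt (∫ x, ‖f x‖ ^ 2 ∂μ)) :=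
  of_integral hf (Real.sqrt_nonneg _) (by rw [Real.sq_sqrt (integral_nonneg fun x => by positivity)])

lemma inner_integrable (hf : L2le μ f a) (hg : L2le μ g b) : Integrable (fun x => ⟪f x, g x⟫) μ := by
  refine (hf.integrable_sq.add hg.integrable_sq).mono' (hf.1.inner hg.1) (ae_of_all _ fun x => ?_)
  refine (norm_inner_le_norm _ _).trans ?_
  simp only [Pi.add_apply]
  nlinarith [sq_nonneg (‖f x‖ - ‖g x‖), sq_nonneg (‖f x‖ + ‖g x‖)]

lemma inner_le (hf : L2le μ f a) (hg : L2le μ g b) : |∫ x, ⟪f x, g x⟫ ∂μ| ≤ a * b := by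
  have key : ∀ t : ℝ, 0 < t → |∫ x, ⟪f x, g x⟫ ∂μ| ≤ (t * a ^ 2 + t⁻¹ * b ^ 2) / 2 := by
    intro t ht
    rw [← Real.norm_eq_abs]
    refine (norm_integral_le_of_norm_le (g := fun x => (t * ‖f x‖ ^ 2 + t⁻¹ * ‖g x‖ ^ 2) / 2) ?_
      (ae_of_all _ fun x => ?_)).trans ?_
    · exact ((hf.integrable_sq.const_mul t).add (hg.integrable_sq.const_mul t⁻¹)).div_const 2
    · refine (norm_inner_le_norm _ _).trans ?_
      have : 0 ≤ t⁻¹ * (t * ‖f x‖ - ‖g x‖) ^ 2 := by positivity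
      have e : t⁻¹ * (t * ‖f x‖ - ‖g x‖) ^ 2 = t * ‖f x‖ ^ 2 - 2 * (‖f x‖ * ‖g x‖) + t⁻¹ * ‖g x‖ ^ 2 := by
        field_simp; ring
      linarith
    · rw [integral_div, integral_add (hf.integrable_sq.const_mul t) (hg.integrable_sq.const_mul t⁻¹),
        integral_const_mul, integral_const_mul]
      have := hf.integral_le
      have := hg.integral_le
      gcongr
  have ha := hf.nonneg
  have hb := hg.nonneg
  rcases eq_or_lt_of_le ha with h0 | h0
  · rw [← h0, zero_mul]
    apply le_of_forall_pos_le_add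
    intro ε hε
    refine (key ((b ^ 2 + 1) / ε) (by positivity)).trans ?_
    rw [← h0, inv_div]
    have : ε / (b ^ 2 + 1) * b ^ 2 ≤ ε := by
      rw [div_mul_eq_mul_div, div_le_iff₀ (by positivity)]; nlinarith
    simp; linarith
  · rcases eq_or_lt_of_le hb with h1 | h1
    · rw [← h1, mul_zero]
      apply le_of_forall_pos_le_add
      intro ε hε
      refine (key (ε / (a ^ 2)) (by positivity)).trans ?_
      rw [← h1]
      field_simp
      nlinarith
    · refine (key (b / a) (by positivity)).trans ?_
      field_simp
      linarith

end L2le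

/-! ### Rejection estimate -/

lemma malaD_bound {d : ℕ} {U : Euc d → ℝ} {m L Lt : ℝ} (hU : StrongAssumption U m L)
    (hU3 : ThirdDerivBounded U Lt) : ∃ C : ℝ, 0 ≤ C ∧ ∀ (s : ℝ), 0 < s → s ≤ 1 → ∀ x z : Euc d,
      |malaD U s x (malaY U s x z)| * ‖malaY U s x z - x‖ ^ 2 ≤ C * s ^ 5 * (1 + ‖x‖ + ‖z‖) ^ 5 := by
  have hL : 0 < L := hU.2.1.trans_le hU.2.2.1
  have hLt : 0 ≤ Lt := (norm_nonneg _).trans (hU3.2 0)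
  set B := L + 2 with hB
  have hB0 : 0 < B := by positivity
  refine ⟨(Lt / 4 * B ^ 3 + 1 / 4 * (L * B * (2 * L + L * B))) * B ^ 2, by positivity, fun s hs hs1 x z => ?_⟩
  set R := 1 + ‖x‖ + ‖z‖ with hR
  have hR1 : 1 ≤ R := by have := norm_nonneg x; have := norm_nonneg z; linarith
  set y := malaY U s x z with hy
  set w := y - x with hw
  have hyw : y = x + w := by rw [hw]; abel
  have hwb : ‖w‖ ≤ s * B * R := by
    have e : w = -(s ^ 2 • gradient U x) + (Real.sqrt 2 * s) • z := by
      rw [hw, hy, malaY]; abel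
    rw [e]
    refine (norm_add_le _ _).trans ?_
    rw [norm_neg, norm_smul, norm_smul, Real.norm_of_nonneg (by positivity), Real.norm_of_nonneg (by positivity)]
    have h1 := grad_bound hU x
    have h2 : Real.sqrt 2 ≤ 2 := by
      rw [Real.sqrt_le_left (by norm_num)]; norm_num
    have h3 : s ^ 2 * ‖gradient U x‖ ≤ s * (L * R) := by
      have : s ^ 2 ≤ s := by nlinarith
      calc _ ≤ s * (L * ‖x‖) := by gcongr
        _ ≤ s * (L * R) := by gcongr; have := norm_nonneg z; linarith
    have h4 : Real.sqrt 2 * s * ‖z‖ ≤ 2 * s * R := by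
      gcongr; have := norm_nonneg x; linarith
    rw [hB]; nlinarith
  have hxR : ‖x‖ ≤ R := by have := norm_nonneg z; linarith
  have htr := trapezoid hU hU3 x w
  rw [← hyw] at htr
  have hgl : ‖gradient U y - gradient U x‖ ≤ L * ‖w‖ := by rw [hw]; exact grad_lip hU y x
  have hgx : ‖gradient U x‖ ≤ L * R := (grad_bound hU x).trans (by gcongr)
  have hgy : ‖gradient U y‖ ≤ L * R + L * ‖w‖ := by
    have : gradient U y = gradient U x + (gradient U y - gradient U x) := by abel
    rw [this]; exact (norm_add_le _ _).trans (by gcongr)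
  have hsq : |‖gradient U x‖ ^ 2 - ‖gradient U y‖ ^ 2| ≤ L * ‖w‖ * (2 * (L * R) + L * ‖w‖) := by
    have e : ‖gradient U x‖ ^ 2 - ‖gradient U y‖ ^ 2 =
        -((‖gradient U y‖ - ‖gradient U x‖) * (‖gradient U y‖ + ‖gradient U x‖)) := by ring
    rw [e, abs_neg, abs_mul]
    apply mul_le_mul ((abs_norm_sub_norm_le _ _).trans hgl) _ (abs_nonneg _) (by positivity)
    rw [abs_of_nonneg (by positivity)]; linarith
  have hwB : ‖w‖ ≤ B * R := hwb.trans (by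
    have : 0 ≤ B * R := by positivity
    nlinarith)
  have hD : |malaD U s x y| ≤ s ^ 3 * R ^ 3 * (Lt / 4 * B ^ 3 + 1 / 4 * (L * B * (2 * L + L * B))) := by
    have e : malaD U s x y = -(U y - U x - 1 / 2 * ⟪gradient U y + gradient U x, w⟫) +
        s ^ 2 / 4 * (‖gradient U x‖ ^ 2 - ‖gradient U y‖ ^ 2) := by
      unfold malaD; ring
    rw [e]
    refine (abs_add_le _ _).trans ?_
    rw [abs_neg, abs_mul, abs_of_nonneg (by positivity : 0 ≤ s ^ 2 / 4)]
    have h1 : Lt / 4 * ‖w‖ ^ 3 ≤ Lt / 4 * (s * B * R) ^ 3 := by gcongr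
    have h2 : s ^ 2 / 4 * |‖gradient U x‖ ^ 2 - ‖gradient U y‖ ^ 2| ≤
        s ^ 2 / 4 * (L * (s * B * R) * (2 * (L * R) + L * (B * R))) := by
      refine mul_le_mul_of_nonneg_left (hsq.trans ?_) (by positivity)
      gcongr
    have h3 : s ^ 2 / 4 * (L * (s * B * R) * (2 * (L * R) + L * (B * R))) ≤
        s ^ 3 * R ^ 3 * (1 / 4 * (L * B * (2 * L + L * B))) := by
      have : R ^ 2 ≤ R ^ 3 := pow_le_pow_right₀ hR1 (by norm_num)
      calc _ = s ^ 3 * R ^ 2 * (1 / 4 * (L * B * (2 * L + L * B))) := by ring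
        _ ≤ _ := by gcongr
    calc _ ≤ Lt / 4 * (s * B * R) ^ 3 + s ^ 3 * R ^ 3 * (1 / 4 * (L * B * (2 * L + L * B))) :=
          add_le_add (htr.trans h1) (h2.trans h3)
      _ = _ := by ring
  calc _ ≤ s ^ 3 * R ^ 3 * (Lt / 4 * B ^ 3 + 1 / 4 * (L * B * (2 * L + L * B))) * (s * B * R) ^ 2 := by
        gcongr
    _ = _ := by ring

lemma mala_rej {d : ℕ} {U : Euc d → ℝ} {m L Lt : ℝ} (hU : StrongAssumption U m L)
    (hU3 : ThirdDerivBounded U Lt) : ∃ C : ℝ, 0 ≤ C ∧ ∀ (s : ℝ), 0 < s → s ≤ 1 →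
      L2le ((gibbs U).prod (malaNoise d)) (fun p => malaT U s p.1 p.2 - malaY U s p.1 p.2.1)
        (Real.sqrt (C * s ^ 5)) := by
  have := gibbs_prob hU
  obtain ⟨C, hC0, hC⟩ := malaD_bound hU hU3
  have hmom : Integrable (fun p : Euc d × Euc d => (1 + ‖p.1‖ + ‖p.2‖) ^ 5) ((gibbs U).prod (_root_.stdGaussian d)) := by
    have h0 : MemLp (fun _ : Euc d × Euc d => (1:ℝ)) 5 ((gibbs U).prod (_root_.stdGaussian d)) := memLp_const 1
    have h1 : MemLp (fun p : Euc d × Euc d => p.1) 5 ((gibbs U).prod (_root_.stdGaussian d)) :=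
      (gibbs_memLp hU 5 (by norm_num)).comp_fst _
    have h2 : MemLp (fun p : Euc d × Euc d => p.2) 5 ((gibbs U).prod (_root_.stdGaussian d)) :=
      (gau_memLp d 5 (by simp)).comp_snd _
    have := MemLp.integrable_norm_pow (p := 5) ((h0.add h1.norm).add h2.norm) (by norm_num)
    refine this.congr (ae_of_all _ fun p => ?_)
    simp only [Pi.add_apply]
    rw [Real.norm_of_nonneg (by positivity)]
  set I := ∫ p : Euc d × Euc d, (1 + ‖p.1‖ + ‖p.2‖) ^ 5 ∂((gibbs U).prod (_root_.stdGaussian d)) with hI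
  have hI0 : 0 ≤ I := integral_nonneg fun p => by positivity
  refine ⟨C * I, by positivity, fun s hs hs1 => ?_⟩
  have hT := malaT_meas hU s
  have hY := (malaY_cont hU s).measurable
  have hYp : Measurable (fun p : Euc d × (Euc d × ℝ) => malaY U s p.1 p.2.1) :=
    hY.comp (by fun_prop : Measurable fun p : Euc d × (Euc d × ℝ) => (p.1, p.2.1))
  have hm : Measurable (fun p : Euc d × (Euc d × ℝ) => malaT U s p.1 p.2 - malaY U s p.1 p.2.1) := hT.sub hYp
  apply L2le.of_lintegral hm.aestronglyMeasurable (Real.sqrt_nonneg _)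
  rw [Real.sq_sqrt (by positivity), lintegral_prod _ (by fun_prop)]
  have hin : ∀ x z, ∫⁻ u, ‖malaT U s x (z, u) - malaY U s x z‖ₑ ^ 2 ∂(volume.restrict (Set.Icc (0:ℝ) 1)) ≤
      ENNReal.ofReal (C * s ^ 5 * (1 + ‖x‖ + ‖z‖) ^ 5) := by
    intro x z
    set a := Real.exp (malaD U s x (malaY U s x z)) with ha
    have e : ∀ u : ℝ, ‖malaT U s x (z, u) - malaY U s x z‖ₑ ^ 2 =
        Set.indicator {u | ¬ u ≤ a} (fun _ => ENNReal.ofReal (‖malaY U s x z - x‖ ^ 2)) u := by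
      intro u
      by_cases h : u ≤ a
      · simp [malaT, ← ha, h]
      · simp only [malaT, ← ha, h, Set.indicator, Set.mem_ofPred_eq, if_false, if_true, not_false_iff]
        rw [ENNReal.ofReal_pow (norm_nonneg _), ofReal_norm, enorm_sub_rev]
    simp_rw [e]
    have m2 : MeasurableSet {u : ℝ | ¬ u ≤ a} := (mset_le a).compl
    rw [lintegral_indicator_const m2, unif_gt a (Real.exp_nonneg _), ← ENNReal.ofReal_mul (by positivity)]
    apply ENNReal.ofReal_le_ofReal
    refine le_trans ?_ (hC s hs hs1 x z)
    rw [mul_comm]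
    gcongr
    rw [sub_le_iff_le_add, ← sub_le_iff_le_add']
    apply le_min
    · linarith [abs_nonneg (malaD U s x (malaY U s x z))]
    · have := Real.add_one_le_exp (malaD U s x (malaY U s x z))
      have := neg_abs_le (malaD U s x (malaY U s x z))
      linarith
  have hin2 : ∀ x, ∫⁻ r, ‖malaT U s x r - malaY U s x r.1‖ₑ ^ 2 ∂(malaNoise d) ≤
      ∫⁻ z, ENNReal.ofReal (C * s ^ 5 * (1 + ‖x‖ + ‖z‖) ^ 5) ∂(_root_.stdGaussian d) := by
    intro x
    have hmx : Measurable (fun r : Euc d × ℝ => malaT U s x r - malaY U s x r.1) :=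
      hm.comp (measurable_prodMk_left (x := x))
    rw [malaNoise, lintegral_prod _ (by fun_prop)]
    exact lintegral_mono fun z => hin x z
  refine (lintegral_mono hin2).trans ?_
  rw [← lintegral_prod (fun p : Euc d × Euc d => ENNReal.ofReal (C * s ^ 5 * (1 + ‖p.1‖ + ‖p.2‖) ^ 5)) (by fun_prop),
    ← ofReal_integral_eq_lintegral_ofReal (hmom.const_mul _) (ae_of_all _ fun p => by positivity), integral_const_mul]
  apply ENNReal.ofReal_le_ofReal
  apply le_of_eq; ring

/-! ### Bernoulli noise -/

lemma Kinv_le {K : ℕ} (hK : 1 ≤ K) : (K : ℝ≥0∞)⁻¹ ≤ 1 := by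
  rw [ENNReal.inv_le_one]; exact_mod_cast hK

lemma bern_prob {K : ℕ} (hK : 1 ≤ K) : IsProbabilityMeasure (bern (K : ℝ≥0∞)⁻¹) := by
  constructor
  simp only [bern, Measure.add_apply, Measure.smul_apply, measure_univ, smul_eq_mul, mul_one]
  exact add_tsub_cancel_of_le (Kinv_le hK)

lemma bern_ae (p : ℝ≥0∞) : ∀ᵐ h ∂(bern p), h = 0 ∨ h = 1 := by
  have hm : MeasurableSet {h : ℝ | h = 0 ∨ h = 1} := by
    have : {h : ℝ | h = 0 ∨ h = 1} = ({0, 1} : Set ℝ) := by ext; simp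
    rw [this]; exact (Set.toFinite _).measurableSet
  rw [bern, ae_add_measure_iff]
  constructor
  · apply Measure.ae_smul_measure; rw [ae_dirac_iff hm]; simp
  · apply Measure.ae_smul_measure; rw [ae_dirac_iff hm]; simp

lemma bern_mean {K : ℕ} (hK : 1 ≤ K) : ∫ h, h ∂(bern (K : ℝ≥0∞)⁻¹) = (K : ℝ)⁻¹ := by
  have h1 : (K : ℝ≥0∞)⁻¹ ≠ ∞ := ((Kinv_le hK).trans_lt ENNReal.one_lt_top).ne
  rw [bern, integral_add_measure, integral_smul_measure, integral_smul_measure, integral_dirac, integral_dirac]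
  · simp
  · exact (integrable_dirac (by simp)).smul_measure h1
  · exact (integrable_dirac (by simp)).smul_measure (ne_top_of_le_ne_top ENNReal.one_ne_top tsub_le_self)

/-- law of the Bernoulli vector -/
def piB (K : ℕ) : Measure (Fin K → ℝ) := Measure.pi fun _ : Fin K => bern (K : ℝ≥0∞)⁻¹

def piG (d K : ℕ) : Measure (Fin K → Euc d) := Measure.pi fun _ : Fin K => _root_.stdGaussian d

instance piG_prob (d K : ℕ) : IsProbabilityMeasure (piG d K) := by
  unfold piG; infer_instance

lemma piB_prob {K : ℕ} (hK : 1 ≤ K) : IsProbabilityMeasure (piB K) := by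
  have := bern_prob hK
  unfold piB; infer_instance

lemma noise_eq (d K : ℕ) : prlmcNoise d K = (piB K).prod ((piG d K).prod (_root_.stdGaussian d)) := rfl

lemma noise_prob (d : ℕ) {K : ℕ} (hK : 1 ≤ K) : IsProbabilityMeasure (prlmcNoise d K) := by
  have := piB_prob hK
  rw [noise_eq]; infer_instance

lemma piB_eval {K : ℕ} (hK : 1 ≤ K) (i : Fin K) :
    MeasurePreserving (fun h : Fin K → ℝ => h i) (piB K) (bern (K : ℝ≥0∞)⁻¹) := by
  have := bern_prob hK
  exact measurePreserving_eval (fun _ : Fin K => bern (K : ℝ≥0∞)⁻¹) i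

lemma piG_eval (d : ℕ) {K : ℕ} (i : Fin K) :
    MeasurePreserving (fun h : Fin K → Euc d => h i) (piG d K) (_root_.stdGaussian d) :=
  measurePreserving_eval (fun _ : Fin K => _root_.stdGaussian d) i

lemma piB_ae {K : ℕ} (hK : 1 ≤ K) : ∀ᵐ h ∂(piB K), ∀ i, h i = 0 ∨ h i = 1 := by
  rw [ae_all_iff]
  intro i
  exact (piB_eval hK i).quasiMeasurePreserving.ae (bern_ae _)

lemma piB_memLp {K : ℕ} (hK : 1 ≤ K) (i : Fin K) (p : ℝ≥0∞) : MemLp (fun h : Fin K → ℝ => h i) p (piB K) := by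
  have := piB_prob hK
  apply MemLp.of_bound (measurable_pi_apply i).aestronglyMeasurable 1
  filter_upwards [piB_ae hK] with h hh
  rcases hh i with e | e <;> simp [e]

lemma piB_mean {K : ℕ} (hK : 1 ≤ K) (i : Fin K) : ∫ h, h i ∂(piB K) = (K : ℝ)⁻¹ := by
  rw [← bern_mean hK, ← (piB_eval hK i).map_eq, integral_map (measurable_pi_apply i).aemeasurable (by fun_prop)]

lemma piB_mul {K : ℕ} (hK : 1 ≤ K) (i j : Fin K) : Integrable (fun h : Fin K → ℝ => h i * h j) (piB K) := by
  have := piB_prob hK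
  have := (piB_memLp hK i 2).integrable_mul (piB_memLp hK j 2)
  exact this

lemma piB_cov {K : ℕ} (hK : 1 ≤ K) (i j : Fin K) :
    ∫ h, h i * h j ∂(piB K) = if i = j then (K : ℝ)⁻¹ else (K : ℝ)⁻¹ ^ 2 := by
  have := piB_prob hK
  have := bern_prob hK
  split_ifs with hij
  · subst hij
    rw [← piB_mean hK i]
    apply integral_congr_ae
    filter_upwards [piB_ae hK] with h hh
    rcases hh i with e | e <;> simp [e]
  · have hind : iIndepFun (fun (i : Fin K) (h : Fin K → ℝ) => h i) (piB K) :=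
      iIndepFun_pi (μ := fun _ : Fin K => bern (K : ℝ≥0∞)⁻¹) (X := fun _ x => x) (fun i => by fun_prop)
    have := (hind.indepFun hij).integral_fun_mul_eq_mul_integral (measurable_pi_apply i).aestronglyMeasurable (measurable_pi_apply j).aestronglyMeasurable
    rw [this, piB_mean hK, piB_mean hK, sq]

lemma piB_sum_cov {K : ℕ} (hK : 1 ≤ K) (i : Fin K) :
    ∫ h, h i * ∑ j, h j ∂(piB K) = (K : ℝ)⁻¹ * (2 - (K : ℝ)⁻¹) := by
  have hK0 : (K : ℝ) ≠ 0 := by positivity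
  simp_rw [Finset.mul_sum]
  rw [integral_finsetSum _ (fun j _ => piB_mul hK i j)]
  simp_rw [piB_cov hK]
  have : ∀ j : Fin K, (if i = j then (K : ℝ)⁻¹ else (K : ℝ)⁻¹ ^ 2) = (K : ℝ)⁻¹ ^ 2 + if i = j then (K : ℝ)⁻¹ - (K : ℝ)⁻¹ ^ 2 else 0 := by
    intro j; split_ifs <;> ring
  simp_rw [this]
  rw [Finset.sum_add_distrib, Finset.sum_ite_eq]
  simp
  field_simp
  ring

lemma piB_sum_memLp {K : ℕ} (hK : 1 ≤ K) (p : ℝ≥0∞) : MemLp (fun h : Fin K → ℝ => ∑ i, h i) p (piB K) :=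
  memLp_finsetSum _ fun i _ => piB_memLp hK i p

lemma piB_sum_mean {K : ℕ} (hK : 1 ≤ K) : ∫ h, ∑ i, h i ∂(piB K) = 1 := by
  have := piB_prob hK
  have hK0 : (K : ℝ) ≠ 0 := by positivity
  rw [integral_finsetSum _ (fun j _ => (piB_memLp hK j 1).integrable le_rfl)]
  simp_rw [piB_mean hK]
  simp [hK0]

lemma piB_sum_sq {K : ℕ} (hK : 1 ≤ K) : ∫ h, (∑ i, h i) ^ 2 ∂(piB K) ≤ 2 := by
  have hK0 : (K : ℝ) ≠ 0 := by positivity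
  have : ∀ h : Fin K → ℝ, (∑ i, h i) ^ 2 = ∑ i, h i * ∑ j, h j := by
    intro h; rw [sq, Finset.sum_mul]
  simp_rw [this]
  rw [integral_finsetSum]
  · simp_rw [piB_sum_cov hK]
    simp only [Finset.sum_const, Finset.card_univ, Fintype.card_fin, nsmul_eq_mul]
    rw [← mul_assoc, mul_inv_cancel₀ hK0]
    have : (0:ℝ) ≤ (K : ℝ)⁻¹ := by positivity
    linarith
  · intro i _
    exact (piB_memLp hK i 2).integrable_mul (piB_sum_memLp hK 2)

section affine
variable {E : Type*} [NormedAddCommGroup E] [InnerProductSpace ℝ E]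

lemma aff_memLp {K : ℕ} (hK : 1 ≤ K) (c : Fin K → E) : MemLp (fun h : Fin K → ℝ => ∑ i, h i • c i) 2 (piB K) := by
  apply memLp_finsetSum
  intro i _
  have := piB_memLp hK i 2
  refine (this.norm.mul_const ‖c i‖).mono' ?_ (ae_of_all _ fun h => ?_)
  · exact (by fun_prop : Continuous fun h : Fin K → ℝ => h i • c i).aestronglyMeasurable
  · rw [norm_smul]

lemma aff_inner {K : ℕ} (hK : 1 ≤ K) (c : Fin K → E) (D : E) :
    ∫ h, ⟪D, ∑ i, h i • c i⟫ ∂(piB K) = (K : ℝ)⁻¹ * ∑ i, ⟪D, c i⟫ := by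
  have := piB_prob hK
  simp_rw [inner_sum, inner_smul_right]
  rw [integral_finsetSum _ (fun j _ => ((piB_memLp hK j 1).integrable le_rfl).mul_const _), Finset.mul_sum]
  refine Finset.sum_congr rfl fun i _ => ?_
  rw [integral_mul_const, piB_mean hK]

/-- norm bound `(∑ h)(∑ h ‖c‖²)` -/
lemma aff_sq {K : ℕ} (hK : 1 ≤ K) (c : Fin K → E) :
    ∫ h, ‖∑ i, h i • c i‖ ^ 2 ∂(piB K) ≤ (K : ℝ)⁻¹ * (2 - (K : ℝ)⁻¹) * ∑ i, ‖c i‖ ^ 2 := by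
  have hintgr : ∀ i : Fin K, Integrable (fun h : Fin K → ℝ => h i * (∑ j, h j) * ‖c i‖ ^ 2) (piB K) := fun i =>
    ((piB_memLp hK i 2).integrable_mul (piB_sum_memLp hK 2)).mul_const _
  have e : ∫ h, ∑ i, h i * (∑ j, h j) * ‖c i‖ ^ 2 ∂(piB K) = (K : ℝ)⁻¹ * (2 - (K : ℝ)⁻¹) * ∑ i, ‖c i‖ ^ 2 := by
    rw [integral_finsetSum _ (fun i _ => hintgr i), Finset.mul_sum]
    refine Finset.sum_congr rfl fun i _ => ?_
    rw [integral_mul_const, piB_sum_cov hK]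
  rw [← e]
  apply integral_mono_ae
  · exact MemLp.integrable_norm_pow (p := 2) (aff_memLp hK c) (by norm_num)
  · exact integrable_finsetSum _ fun i _ => hintgr i
  · filter_upwards [piB_ae hK] with h hh
    have h0 : ∀ i, 0 ≤ h i := fun i => by rcases hh i with e | e <;> simp [e]
    have h1 : ‖∑ i, h i • c i‖ ≤ ∑ i, h i * ‖c i‖ := by
      refine (norm_sum_le _ _).trans (le_of_eq ?_)
      refine Finset.sum_congr rfl fun i _ => ?_
      rw [norm_smul, Real.norm_of_nonneg (h0 i)]
    have h2 : (∑ i, h i * ‖c i‖) ^ 2 ≤ (∑ i, h i) * ∑ i, h i * ‖c i‖ ^ 2 :=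
      Finset.sum_sq_le_sum_mul_sum_of_sq_eq_mul _ (fun i _ => h0 i)
        (fun i _ => mul_nonneg (h0 i) (sq_nonneg _)) (fun i _ => by ring)
    calc _ ≤ (∑ i, h i * ‖c i‖) ^ 2 := by gcongr
      _ ≤ _ := h2
      _ = _ := by
        rw [Finset.mul_sum]
        refine Finset.sum_congr rfl fun i _ => by ring

lemma aff_sq' {K : ℕ} (hK : 1 ≤ K) (c0 : E) (c : Fin K → E) (a : ℝ) (ha : 0 ≤ a) (h0 : ‖c0‖ ≤ a)
    (hc : ∀ i, ‖c i‖ ≤ 3 * a) :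
    ∫ h, ‖c0 + ∑ i, h i • c i‖ ^ 2 ∂(piB K) ≤ 25 * a ^ 2 := by
  have := piB_prob hK
  have i1 : Integrable (fun h : Fin K → ℝ => ∑ i, h i) (piB K) := (piB_sum_memLp hK 1).integrable le_rfl
  have i2 : Integrable (fun h : Fin K → ℝ => (∑ i, h i) ^ 2) (piB K) := (piB_sum_memLp hK 2).integrable_sq
  have hle : ∫ h, ‖c0 + ∑ i, h i • c i‖ ^ 2 ∂(piB K) ≤ ∫ h, (a ^ 2 + 6 * a ^ 2 * ∑ i, h i) + 9 * a ^ 2 * (∑ i, h i) ^ 2 ∂(piB K) := by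
    apply integral_mono_ae
    · exact MemLp.integrable_norm_pow (p := 2) ((memLp_const c0).add (aff_memLp hK c)) (by norm_num)
    · exact ((integrable_const _).add (i1.const_mul _)).add (i2.const_mul _)
    · filter_upwards [piB_ae hK] with h hh
      have h0' : ∀ i, 0 ≤ h i := fun i => by rcases hh i with e | e <;> simp [e]
      have h1 : ‖∑ i, h i • c i‖ ≤ (∑ i, h i) * (3 * a) := by
        rw [Finset.sum_mul]
        refine (norm_sum_le _ _).trans (Finset.sum_le_sum fun i _ => ?_)
        rw [norm_smul, Real.norm_of_nonneg (h0' i)]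
        exact mul_le_mul_of_nonneg_left (hc i) (h0' i)
      have h2 : ‖c0 + ∑ i, h i • c i‖ ≤ a + (∑ i, h i) * (3 * a) := (norm_add_le _ _).trans (add_le_add h0 h1)
      calc _ ≤ (a + (∑ i, h i) * (3 * a)) ^ 2 := by gcongr
        _ = _ := by ring
  refine hle.trans ?_
  have i3 : Integrable (fun h : Fin K → ℝ => a ^ 2 + 6 * a ^ 2 * ∑ i, h i) (piB K) := (integrable_const _).add (i1.const_mul _)
  rw [integral_add i3 (i2.const_mul _),
    integral_add (integrable_const _) (i1.const_mul _), integral_const_mul, integral_const_mul, piB_sum_mean hK]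
  have := piB_sum_sq hK
  simp
  nlinarith [sq_nonneg a]

lemma affA {K : ℕ} (hK : 1 ≤ K) (c0 : E) (c : Fin K → E) (η : ℝ) :
    MemLp (fun h : Fin K → ℝ => η • (c0 + ∑ i, h i • c i)) 2 (piB K) := by
  have := piB_prob hK
  exact ((memLp_const c0).add (aff_memLp hK c)).const_smul η

lemma affB {K : ℕ} (hK : 1 ≤ K) (D c0 : E) (c : Fin K → E) (η : ℝ) :
    MemLp (fun h : Fin K → ℝ => D - η • (c0 + ∑ i, h i • c i)) 2 (piB K) := by
  have := piB_prob hK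
  exact (memLp_const D).sub (affA hK c0 c η)

lemma aff_expand {K : ℕ} (hK : 1 ≤ K) (D c0 : E) (c : Fin K → E) (η : ℝ) :
    ∫ h, ‖D - η • (c0 + ∑ i, h i • c i)‖ ^ 2 ∂(piB K) =
      ‖D‖ ^ 2 - 2 * (η * (⟪D, c0⟫ + (K : ℝ)⁻¹ * ∑ i, ⟪D, c i⟫)) + η ^ 2 * ∫ h, ‖c0 + ∑ i, h i • c i‖ ^ 2 ∂(piB K) := by
  have := piB_prob hK
  simp only [norm_sub_sq_real, norm_smul, mul_pow, real_inner_smul_right, inner_add_right]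
  have i1 : Integrable (fun h : Fin K → ℝ => ‖c0 + ∑ i, h i • c i‖ ^ 2) (piB K) :=
    MemLp.integrable_norm_pow (p := 2) ((memLp_const c0).add (aff_memLp hK c)) (by norm_num)
  have i2 : Integrable (fun h : Fin K → ℝ => ⟪D, ∑ i, h i • c i⟫) (piB K) :=
    ((aff_memLp hK c).integrable (by norm_num)).const_inner _
  have i3 : Integrable (fun h : Fin K → ℝ => ⟪D, c0⟫ + ⟪D, ∑ i, h i • c i⟫) (piB K) :=
    (integrable_const _).add i2
  have i4 : Integrable (fun h : Fin K → ℝ => ‖D‖ ^ 2 - 2 * (η * (⟪D, c0⟫ + ⟪D, ∑ i, h i • c i⟫))) (piB K) :=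
    (integrable_const _).sub ((i3.const_mul _).const_mul _)
  rw [integral_add i4 (i1.const_mul _), integral_sub (integrable_const _) ((i3.const_mul _).const_mul _), integral_const_mul, integral_const_mul,
    integral_const_mul, integral_add (integrable_const _) i2, aff_inner hK]
  simp only [integral_const, probReal_univ, one_smul, Real.norm_eq_abs, sq_abs]

end affine

/-- The PRLMC step as a function of the bundled noise. -/
def pS {d : ℕ} (U : Euc d → ℝ) (η : ℝ) (K : ℕ) (x : Euc d)
    (r : (Fin K → ℝ) × (Fin K → Euc d) × Euc d) : Euc d := prlmcStep U η K x r.1 r.2.1 r.2.2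

/-- Midpoint correction. -/
def pE {d : ℕ} (U : Euc d → ℝ) (η : ℝ) (K : ℕ) (x : Euc d)
    (r : (Fin K → ℝ) × (Fin K → Euc d) × Euc d) : Euc d :=
  η • ∑ i : Fin K, r.1 i • (gradient U (prlmcMid U η K x r.2.1 i) - gradient U x)

def pcc {d : ℕ} (U : Euc d → ℝ) (η : ℝ) (K : ℕ) (x y : Euc d) (g : Fin K → Euc d) (i : Fin K) : Euc d :=
  (gradient U (prlmcMid U η K x g i) - gradient U (prlmcMid U η K y g i)) - (gradient U x - gradient U y)

section
variable {d K : ℕ} {U : Euc d → ℝ} {m L : ℝ} {η : ℝ}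

lemma pS_eq (x : Euc d) (r : (Fin K → ℝ) × (Fin K → Euc d) × Euc d) :
    pS U η K x r = x - η • gradient U x - pE U η K x r + Real.sqrt (2 * η) • r.2.2 := by
  unfold pS prlmcStep pE
  congr 1
  rw [sub_eq_add_neg (x - η • gradient U x), ← smul_neg, ← Finset.sum_neg_distrib]
  congr 3
  funext i
  rw [← smul_neg, neg_sub]

lemma pMid_cont (hU : StrongAssumption U m L) (i : Fin K) :
    Continuous (fun p : Euc d × (Fin K → Euc d) => prlmcMid U η K p.1 p.2 i) := by
  have := grad_cont hU
  unfold prlmcMid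
  fun_prop

lemma pE_cont (hU : StrongAssumption U m L) :
    Continuous (fun p : Euc d × ((Fin K → ℝ) × (Fin K → Euc d) × Euc d) => pE U η K p.1 p.2) := by
  have h1 := grad_cont hU
  unfold pE
  refine Continuous.const_smul (continuous_finsetSum _ fun i _ => ?_) η
  refine Continuous.smul ((continuous_apply i).comp continuous_snd.fst) (Continuous.sub ?_ (h1.comp continuous_fst))
  have := (pMid_cont (η := η) hU i).comp (Continuous.prodMk continuous_fst (continuous_snd.snd.fst) :
    Continuous (fun p : Euc d × ((Fin K → ℝ) × (Fin K → Euc d) × Euc d) => (p.1, p.2.2.1)))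
  exact h1.comp this

lemma pS_cont (hU : StrongAssumption U m L) :
    Continuous (fun p : Euc d × ((Fin K → ℝ) × (Fin K → Euc d) × Euc d) => pS U η K p.1 p.2) := by
  have h1 := grad_cont hU
  have h2 := pE_cont (K := K) (η := η) hU
  simp_rw [pS_eq]
  fun_prop

lemma pS_diff (x y : Euc d) (r : (Fin K → ℝ) × (Fin K → Euc d) × Euc d) :
    pS U η K x r - pS U η K y r = (x - y) - η • ((gradient U x - gradient U y) + ∑ i, r.1 i • pcc U η K x y r.2.1 i) := by
  rw [pS_eq, pS_eq]
  have : pE U η K x r - pE U η K y r = η • ∑ i, r.1 i • pcc U η K x y r.2.1 i := by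
    unfold pE pcc
    rw [← smul_sub, ← Finset.sum_sub_distrib]
    congr 2; funext i
    rw [← smul_sub]; congr 1; abel
  rw [smul_add, ← this, smul_sub]; abel

lemma noise_lint (hK : 1 ≤ K) {f : (Fin K → ℝ) × (Fin K → Euc d) × Euc d → Euc d} (hf : Measurable f)
    (c : (Fin K → Euc d) → ℝ) (hc : Measurable c)
    (h1 : ∀ g z, MemLp (fun h => f (h, g, z)) 2 (piB K))
    (h2 : ∀ g z, ∫ h, ‖f (h, g, z)‖ ^ 2 ∂(piB K) ≤ c g) :
    ∫⁻ r, ‖f r‖ₑ ^ 2 ∂(prlmcNoise d K) ≤ ∫⁻ g, ENNReal.ofReal (c g) ∂(piG d K) := by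
  have := piB_prob hK
  rw [noise_eq, lintegral_prod_symm' _ (by fun_prop)]
  have h3 : ∀ p : (Fin K → Euc d) × Euc d, ∫⁻ h, ‖f (h, p)‖ₑ ^ 2 ∂(piB K) ≤ ENNReal.ofReal (c p.1) := by
    rintro ⟨g, z⟩
    have h4 : ∫⁻ h, ‖f (h, g, z)‖ₑ ^ 2 ∂(piB K) = ENNReal.ofReal (∫ h, ‖f (h, g, z)‖ ^ 2 ∂(piB K)) := by
      rw [ofReal_integral_eq_lintegral_ofReal ((h1 g z).integrable_norm_pow (p := 2) (by norm_num)) (ae_of_all _ fun _ => by positivity)]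
      apply lintegral_congr; intro h
      rw [ENNReal.ofReal_pow (norm_nonneg _), ofReal_norm]
    rw [h4]
    exact ENNReal.ofReal_le_ofReal (h2 g z)
  refine (lintegral_mono h3).trans ?_
  rw [lintegral_prod _ (by fun_prop)]
  simp

lemma s_le (hη : 0 ≤ η) (i : Fin K) : 0 ≤ (i : ℝ) * η / (K : ℝ) ∧ (i : ℝ) * η / (K : ℝ) ≤ η := by
  have hi : (i : ℝ) ≤ K := by exact_mod_cast i.2.le
  refine ⟨by positivity, ?_⟩
  have hK : (0 : ℝ) < K := by
    have := i.pos
    exact_mod_cast this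
  rw [div_le_iff₀ hK]
  nlinarith

lemma mid_sub (x y : Euc d) (g : Fin K → Euc d) (i : Fin K) :
    prlmcMid U η K x g i - prlmcMid U η K y g i = (x - y) - ((i : ℝ) * η / (K : ℝ)) • (gradient U x - gradient U y) := by
  unfold prlmcMid; rw [smul_sub]; abel

lemma mid_sub_norm (hU : StrongAssumption U m L) (hη : 0 ≤ η) (hL : η * L ≤ 1) (x y : Euc d) (g : Fin K → Euc d) (i : Fin K) :
    ‖prlmcMid U η K x g i - prlmcMid U η K y g i‖ ≤ 2 * ‖x - y‖ := by
  rw [mid_sub]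
  obtain ⟨h0, h1⟩ := s_le (K := K) hη i
  refine (norm_sub_le _ _).trans ?_
  rw [norm_smul, Real.norm_of_nonneg h0]
  have h2 := grad_lip hU x y
  have : (i : ℝ) * η / (K : ℝ) * ‖gradient U x - gradient U y‖ ≤ η * (L * ‖x - y‖) :=
    mul_le_mul h1 h2 (norm_nonneg _) hη
  have : η * L * ‖x - y‖ ≤ 1 * ‖x - y‖ := by gcongr
  linarith

lemma pcc_norm (hU : StrongAssumption U m L) (hη : 0 ≤ η) (hL : η * L ≤ 1) (x y : Euc d) (g : Fin K → Euc d) (i : Fin K) :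
    ‖pcc U η K x y g i‖ ≤ 3 * (L * ‖x - y‖) := by
  unfold pcc
  have hL0 : 0 ≤ L := hU.2.1.le.trans hU.2.2.1
  refine (norm_sub_le _ _).trans ?_
  have h1 := grad_lip hU (prlmcMid U η K x g i) (prlmcMid U η K y g i)
  have h2 := grad_lip hU x y
  have h3 := mul_le_mul_of_nonneg_left (mid_sub_norm hU hη hL x y g i) hL0
  linarith

lemma mid_inner (hU : StrongAssumption U m L) (hη : 0 ≤ η) (hL : η * L ≤ 1) (x y : Euc d) (g : Fin K → Euc d) (i : Fin K) :
    (m - 4 * η * L ^ 2) * ‖x - y‖ ^ 2 ≤ ⟪x - y, gradient U (prlmcMid U η K x g i) - gradient U (prlmcMid U η K y g i)⟫ := by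
  have hL0 : 0 ≤ L := hU.2.1.le.trans hU.2.2.1
  obtain ⟨h0, h1⟩ := s_le (K := K) hη i
  have hm := grad_mono hU (prlmcMid U η K x g i) (prlmcMid U η K y g i)
  have hms := mid_sub (U := U) (η := η) x y g i
  have hl1 := grad_lip hU (prlmcMid U η K x g i) (prlmcMid U η K y g i)
  have hl2 := mid_sub_norm hU hη hL x y g i
  have hl3 := grad_lip hU x y
  set s := (i : ℝ) * η / (K : ℝ)
  set D := x - y
  set Δ := gradient U x - gradient U y
  set Δ' := gradient U (prlmcMid U η K x g i) - gradient U (prlmcMid U η K y g i)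
  set D' := prlmcMid U η K x g i - prlmcMid U η K y g i
  have hD : D = D' + s • Δ := by rw [hms]; abel
  have e1 : ⟪D, Δ'⟫ = ⟪D', Δ'⟫ + s * ⟪Δ, Δ'⟫ := by
    conv_lhs => rw [hD]
    rw [inner_add_left, real_inner_smul_left]
  have e2 : ‖D'‖ ^ 2 ≥ ‖D‖ ^ 2 - 2 * s * ⟪D, Δ⟫ := by
    rw [hms, norm_sub_sq_real, real_inner_smul_right]
    nlinarith [sq_nonneg ‖s • Δ‖]
  have e3 : ⟪D, Δ⟫ ≤ L * ‖D‖ ^ 2 := by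
    refine (real_inner_le_norm _ _).trans ?_
    nlinarith [norm_nonneg D]
  have e4 : -(2 * L ^ 2 * ‖D‖ ^ 2) ≤ ⟪Δ, Δ'⟫ := by
    have := abs_le.1 (abs_real_inner_le_norm Δ Δ')
    have h5 : ‖Δ'‖ ≤ 2 * L * ‖D‖ := by nlinarith
    have : ‖Δ‖ * ‖Δ'‖ ≤ (L * ‖D‖) * (2 * L * ‖D‖) := mul_le_mul hl3 h5 (norm_nonneg _) (by positivity)
    nlinarith
  have hmL := hU.2.2.1
  have hm0 := hU.2.1
  have e5 : s * -(2 * L ^ 2 * ‖D‖ ^ 2) ≤ s * ⟪Δ, Δ'⟫ := mul_le_mul_of_nonneg_left e4 h0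
  have e6 : s * (2 * L ^ 2 * ‖D‖ ^ 2) ≤ η * (2 * L ^ 2 * ‖D‖ ^ 2) := by gcongr
  have e7 : s * ⟪D, Δ⟫ ≤ η * (L * ‖D‖ ^ 2) := by
    calc _ ≤ s * (L * ‖D‖ ^ 2) := by gcongr
      _ ≤ _ := by gcongr
  have e8 : m * (‖D‖ ^ 2 - 2 * (η * (L * ‖D‖ ^ 2))) ≤ m * ‖D'‖ ^ 2 := by gcongr; linarith
  have e9 : m * (2 * (η * (L * ‖D‖ ^ 2))) ≤ L * (2 * (η * (L * ‖D‖ ^ 2))) := by gcongr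
  rw [e1]
  nlinarith

lemma noise_N2 (hK : 1 ≤ K) (hU : StrongAssumption U m L) (hη : 0 ≤ η) (hL : η * L ≤ 1) (x y : Euc d) :
    ∫⁻ r, ‖(x - y) - (pS U η K x r - pS U η K y r)‖ₑ ^ 2 ∂(prlmcNoise d K) ≤ ENNReal.ofReal (25 * η ^ 2 * L ^ 2 * ‖x - y‖ ^ 2) := by
  have hL0 : 0 ≤ L := hU.2.1.le.trans hU.2.2.1
  have := piB_prob hK
  have hc := pS_cont (K := K) (η := η) hU
  refine (noise_lint hK (by fun_prop) (fun _ => 25 * η ^ 2 * L ^ 2 * ‖x - y‖ ^ 2) measurable_const ?_ ?_).trans ?_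
  · intro g z
    simp only [pS_diff, sub_sub_cancel]
    exact affA hK _ _ _
  · intro g z
    simp only [pS_diff, sub_sub_cancel, norm_smul, mul_pow]
    rw [integral_const_mul, Real.norm_of_nonneg hη]
    have := aff_sq' hK (gradient U x - gradient U y) (pcc U η K x y g) (L * ‖x - y‖) (by positivity) (grad_lip hU x y) (pcc_norm hU hη hL x y g)
    nlinarith [sq_nonneg η]
  · simp

lemma noise_N1 (hK : 1 ≤ K) (hU : StrongAssumption U m L) (hη : 0 ≤ η) (hL : η * L ≤ 1) (x y : Euc d) :
    ∫⁻ r, ‖pS U η K x r - pS U η K y r‖ₑ ^ 2 ∂(prlmcNoise d K) ≤ ENNReal.ofReal ((1 - 2 * m * η + 33 * η ^ 2 * L ^ 2) * ‖x - y‖ ^ 2) := by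
  have hL0 : 0 ≤ L := hU.2.1.le.trans hU.2.2.1
  have := piB_prob hK
  have hc := pS_cont (K := K) (η := η) hU
  refine (noise_lint hK (by fun_prop) (fun _ => (1 - 2 * m * η + 33 * η ^ 2 * L ^ 2) * ‖x - y‖ ^ 2) measurable_const ?_ ?_).trans ?_
  · intro g z
    simp only [pS_diff]
    exact affB hK _ _ _ _
  · intro g z
    simp only [pS_diff]
    rw [aff_expand hK]
    have a1 := aff_sq' hK (gradient U x - gradient U y) (pcc U η K x y g) (L * ‖x - y‖) (by positivity) (grad_lip hU x y) (pcc_norm hU hη hL x y g)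
    have hK0 : (0 : ℝ) < K := by positivity
    have a3 : ⟪x - y, gradient U x - gradient U y⟫ + (K : ℝ)⁻¹ * ∑ i, ⟪x - y, pcc U η K x y g i⟫ =
        (K : ℝ)⁻¹ * ∑ i, ⟪x - y, gradient U (prlmcMid U η K x g i) - gradient U (prlmcMid U η K y g i)⟫ := by
      unfold pcc
      simp_rw [inner_sub_right (x - y) (_ - _) (_ - _)]
      rw [Finset.sum_sub_distrib, Finset.sum_const]
      simp only [Finset.card_univ, Fintype.card_fin, nsmul_eq_mul]
      field_simp
      ring
    have a4 : (m - 4 * η * L ^ 2) * ‖x - y‖ ^ 2 ≤ (K : ℝ)⁻¹ * ∑ i, ⟪x - y, gradient U (prlmcMid U η K x g i) - gradient U (prlmcMid U η K y g i)⟫ := by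
      rw [inv_mul_eq_div, le_div_iff₀ hK0]
      have := Finset.card_nsmul_le_sum (Finset.univ : Finset (Fin K)) _ _ (fun i _ => mid_inner hU hη hL x y g i)
      simpa [mul_comm] using this
    rw [a3]
    nlinarith [sq_nonneg η, mul_le_mul_of_nonneg_left a4 hη, mul_le_mul_of_nonneg_left a1 (sq_nonneg η)]
  · simp

end

section
variable {d K : ℕ} {U : Euc d → ℝ} {m L Lt : ℝ} {η : ℝ}

lemma Lt_nonneg (hU3 : ThirdDerivBounded U Lt) : 0 ≤ Lt := (norm_nonneg _).trans (hU3.2 0)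

lemma sum_s (hK : 1 ≤ K) : (K : ℝ)⁻¹ * ∑ i : Fin K, (i : ℝ) * η / (K : ℝ) = η * (1 - (K : ℝ)⁻¹) / 2 := by
  have hK0 : (K : ℝ) ≠ 0 := by positivity
  have h : ∀ n : ℕ, ∑ i ∈ Finset.range n, (i : ℝ) = n * (n - 1) / 2 := by
    intro n
    induction n with
    | zero => simp
    | succ n ih => rw [Finset.sum_range_succ, ih]; push_cast; ring
  rw [← Finset.sum_div, ← Finset.sum_mul, Fin.sum_univ_eq_sum_range (fun i => (i : ℝ)), h]
  field_simp

lemma gau_quad (d : ℕ) (v : Euc d) (c : ℝ) :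
    ∫ z, ‖v + c • z‖ ^ 2 ∂(_root_.stdGaussian d) = ‖v‖ ^ 2 + c ^ 2 * d := by
  have h1 : MemLp (fun z : Euc d => z) 2 (_root_.stdGaussian d) := gau_memLp d 2 (by simp)
  have i1 : Integrable (fun z : Euc d => ‖z‖ ^ 2) (_root_.stdGaussian d) :=
    MemLp.integrable_norm_pow (p := 2) h1 (by norm_num)
  have i2 : Integrable (fun z : Euc d => ⟪v, z⟫) (_root_.stdGaussian d) :=
    (h1.integrable (by norm_num)).const_inner _
  simp only [norm_add_sq_real, norm_smul, mul_pow, real_inner_smul_right]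
  have i3 : Integrable (fun z : Euc d => ‖v‖ ^ 2 + 2 * (c * ⟪v, z⟫)) (_root_.stdGaussian d) :=
    (integrable_const _).add ((i2.const_mul _).const_mul _)
  rw [integral_add i3 (i1.const_mul _), integral_add (integrable_const _) ((i2.const_mul _).const_mul _), integral_const_mul,
    integral_const_mul, integral_const_mul, gau_inner, gau_norm_sq]
  simp

lemma gau_aff_memLp (d : ℕ) (v : Euc d) (c : ℝ) : MemLp (fun z => v + c • z) 2 (_root_.stdGaussian d) :=
  (memLp_const v).add ((gau_memLp d 2 (by simp)).const_smul c)

lemma mid_sub_self (x : Euc d) (g : Fin K → Euc d) (i : Fin K) :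
    prlmcMid U η K x g i - x = (-(((i : ℝ) * η / (K : ℝ)) • gradient U x)) + Real.sqrt (2 * (i : ℝ) * η / (K : ℝ)) • g i := by
  unfold prlmcMid; abel

lemma mid_memLp (x : Euc d) (i : Fin K) : MemLp (fun g => prlmcMid U η K x g i - x) 2 (piG d K) := by
  simp_rw [mid_sub_self]
  exact (gau_aff_memLp d _ _).comp_measurePreserving (piG_eval d i)

lemma mid_second (hU : StrongAssumption U m L) (hη : 0 ≤ η) (x : Euc d) (i : Fin K) :
    ∫ g, ‖prlmcMid U η K x g i - x‖ ^ 2 ∂(piG d K) ≤ η ^ 2 * L ^ 2 * ‖x‖ ^ 2 + 2 * ((i : ℝ) * η / (K : ℝ)) * d := by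
  simp_rw [mid_sub_self]
  have := (piG_eval d i).map_eq
  have e := gau_quad d (-(((i : ℝ) * η / (K : ℝ)) • gradient U x)) (Real.sqrt (2 * (i : ℝ) * η / (K : ℝ)))
  rw [← this, integral_map (measurable_pi_apply i).aemeasurable (by fun_prop)] at e
  rw [e]
  obtain ⟨h0, h1⟩ := s_le (K := K) hη i
  have hL0 : 0 ≤ L := hU.2.1.le.trans hU.2.2.1
  rw [norm_neg, norm_smul, Real.norm_of_nonneg h0, Real.sq_sqrt (by positivity)]
  have h2 := grad_bound hU x
  have h3 : (i : ℝ) * η / (K : ℝ) * ‖gradient U x‖ ≤ η * (L * ‖x‖) := mul_le_mul h1 h2 (norm_nonneg _) hη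
  have h4 : ((i : ℝ) * η / (K : ℝ) * ‖gradient U x‖) ^ 2 ≤ (η * (L * ‖x‖)) ^ 2 := by gcongr
  have h5 : 2 * (i : ℝ) * η / (K : ℝ) * d = 2 * ((i : ℝ) * η / (K : ℝ)) * d := by ring
  rw [h5]
  nlinarith

lemma noise_N3 (hK : 1 ≤ K) (hU : StrongAssumption U m L) (hη : 0 ≤ η) (x : Euc d) :
    ∫⁻ r, ‖pE U η K x r‖ₑ ^ 2 ∂(prlmcNoise d K) ≤
      ENNReal.ofReal (η ^ 2 * (2 - (K : ℝ)⁻¹) * L ^ 2 * (η * d * (1 - (K : ℝ)⁻¹) + η ^ 2 * L ^ 2 * ‖x‖ ^ 2)) := by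
  have hL0 : 0 ≤ L := hU.2.1.le.trans hU.2.2.1
  have := piB_prob hK
  have hc := pE_cont (K := K) (η := η) hU
  have hK1 : (K : ℝ)⁻¹ ≤ 1 := inv_le_one_of_one_le₀ (by exact_mod_cast hK)
  have hK0 : (0 : ℝ) < K := by positivity
  have hmc : ∀ i : Fin K, Continuous (fun g => prlmcMid U η K x g i) := fun i =>
    (pMid_cont (η := η) hU i).comp (Continuous.prodMk continuous_const continuous_id)
  have hcm : Continuous (fun g : Fin K → Euc d => η ^ 2 * ((K : ℝ)⁻¹ * (2 - (K : ℝ)⁻¹) * ∑ i, L ^ 2 * ‖prlmcMid U η K x g i - x‖ ^ 2)) := by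
    fun_prop
  refine (noise_lint hK (by fun_prop) _ hcm.measurable ?_ ?_).trans ?_
  · intro g z
    exact (aff_memLp hK (fun i => gradient U (prlmcMid U η K x g i) - gradient U x)).const_smul η
  · intro g z
    simp only [pE, norm_smul, mul_pow]
    rw [integral_const_mul, Real.norm_of_nonneg hη]
    refine mul_le_mul_of_nonneg_left ?_ (sq_nonneg η)
    refine (aff_sq hK (fun i => gradient U (prlmcMid U η K x g i) - gradient U x)).trans ?_
    refine mul_le_mul_of_nonneg_left (Finset.sum_le_sum fun i _ => ?_) (by nlinarith [inv_pos.2 hK0])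
    rw [← mul_pow]
    exact pow_le_pow_left₀ (norm_nonneg _) (grad_lip hU _ _) 2
  · have hintgr : ∀ i : Fin K, Integrable (fun g => L ^ 2 * ‖prlmcMid U η K x g i - x‖ ^ 2) (piG d K) := fun i =>
      (MemLp.integrable_norm_pow (p := 2) (mid_memLp x i) (by norm_num)).const_mul _
    rw [← ofReal_integral_eq_lintegral_ofReal (((integrable_finsetSum _ fun i _ => hintgr i).const_mul _).const_mul _)
      (ae_of_all _ fun g => by
        have : 0 ≤ 2 - (K : ℝ)⁻¹ := by linarith
        simp only [Pi.zero_apply]; positivity)]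
    apply ENNReal.ofReal_le_ofReal
    rw [integral_const_mul, integral_const_mul, integral_finsetSum _ fun i _ => hintgr i]
    simp_rw [integral_const_mul]
    have hs : ∑ i : Fin K, L ^ 2 * ∫ g, ‖prlmcMid U η K x g i - x‖ ^ 2 ∂(piG d K) ≤
        ∑ i : Fin K, L ^ 2 * (η ^ 2 * L ^ 2 * ‖x‖ ^ 2 + 2 * ((i : ℝ) * η / (K : ℝ)) * d) :=
      Finset.sum_le_sum fun i _ => mul_le_mul_of_nonneg_left (mid_second hU hη x i) (sq_nonneg L)
    have hs2 : (K : ℝ)⁻¹ * ∑ i : Fin K, L ^ 2 * (η ^ 2 * L ^ 2 * ‖x‖ ^ 2 + 2 * ((i : ℝ) * η / (K : ℝ)) * d) =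
        L ^ 2 * (η * d * (1 - (K : ℝ)⁻¹) + η ^ 2 * L ^ 2 * ‖x‖ ^ 2) := by
      rw [← Finset.mul_sum, Finset.sum_add_distrib, Finset.sum_const, ← Finset.sum_mul, ← Finset.mul_sum _ _ (2 : ℝ)]
      have := sum_s (η := η) hK
      simp only [Finset.card_univ, Fintype.card_fin, nsmul_eq_mul]
      calc _ = L ^ 2 * ((K : ℝ)⁻¹ * K * (η ^ 2 * L ^ 2 * ‖x‖ ^ 2) + 2 * ((K : ℝ)⁻¹ * ∑ i : Fin K, (i : ℝ) * η / (K : ℝ)) * d) := by ring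
        _ = _ := by rw [this, inv_mul_cancel₀ hK0.ne']; ring
    calc _ ≤ η ^ 2 * ((K : ℝ)⁻¹ * (2 - (K : ℝ)⁻¹) * ∑ i : Fin K, L ^ 2 * (η ^ 2 * L ^ 2 * ‖x‖ ^ 2 + 2 * ((i : ℝ) * η / (K : ℝ)) * d)) := by
          refine mul_le_mul_of_nonneg_left (mul_le_mul_of_nonneg_left hs ?_) (sq_nonneg η)
          nlinarith [inv_pos.2 hK0]
      _ = η ^ 2 * (2 - (K : ℝ)⁻¹) * ((K : ℝ)⁻¹ * ∑ i : Fin K, L ^ 2 * (η ^ 2 * L ^ 2 * ‖x‖ ^ 2 + 2 * ((i : ℝ) * η / (K : ℝ)) * d)) := by ring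
      _ = _ := by rw [hs2]; ring
      _ ≤ _ := le_rfl

lemma mid_taylor (hU : StrongAssumption U m L) (hU3 : ThirdDerivBounded U Lt) (hη : 0 ≤ η) (x v : Euc d) (i : Fin K) :
    |∫ g, ⟪v, gradient U (prlmcMid U η K x g i) - gradient U x⟫ ∂(piG d K)| ≤
      ‖v‖ * (((i : ℝ) * η / (K : ℝ)) * (L ^ 2 * ‖x‖ + d * Lt)) := by
  have hL0 : 0 ≤ L := hU.2.1.le.trans hU.2.2.1
  have hg := grad_cont hU
  obtain ⟨h0, h1⟩ := s_le (K := K) hη i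
  set s := (i : ℝ) * η / (K : ℝ) with hs
  set x' := x - s • gradient U x with hx'
  set c := Real.sqrt (2 * (i : ℝ) * η / (K : ℝ)) with hc
  have hc2 : c ^ 2 = 2 * s := by rw [hc, Real.sq_sqrt (by positivity), hs]; ring
  have e : ∫ g, ⟪v, gradient U (prlmcMid U η K x g i) - gradient U x⟫ ∂(piG d K) =
      ∫ z, ⟪v, gradient U (x' + c • z) - gradient U x⟫ ∂(_root_.stdGaussian d) := by
    rw [← (piG_eval d i).map_eq, integral_map (measurable_pi_apply i).aemeasurable (Continuous.aestronglyMeasurable (by fun_prop))]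
    rfl
  have hmem : MemLp (fun z => gradient U (x' + c • z) - gradient U x') 2 (_root_.stdGaussian d) := by
    refine ((gau_memLp d 2 (by simp)).norm.const_mul (L * |c|)).mono' (Continuous.aestronglyMeasurable (by fun_prop)) (ae_of_all _ fun z => ?_)
    refine (grad_lip hU _ _).trans ?_
    rw [add_sub_cancel_left, norm_smul, Real.norm_eq_abs, mul_assoc]
  have i1 : Integrable (fun z => ⟪v, gradient U (x' + c • z) - gradient U x'⟫) (_root_.stdGaussian d) :=
    (hmem.integrable (by norm_num)).const_inner v
  have e2 : ∫ z, ⟪v, gradient U (x' + c • z) - gradient U x⟫ ∂(_root_.stdGaussian d) =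
      ∫ z, ⟪v, gradient U (x' + c • z) - gradient U x'⟫ ∂(_root_.stdGaussian d) + ⟪v, gradient U x' - gradient U x⟫ := by
    have : ∀ z : Euc d, ⟪v, gradient U (x' + c • z) - gradient U x⟫ = ⟪v, gradient U (x' + c • z) - gradient U x'⟫ + ⟪v, gradient U x' - gradient U x⟫ := by
      intro z; rw [← inner_add_right, sub_add_sub_cancel]
    simp_rw [this]
    rw [integral_add i1 (integrable_const _)]
    simp
  rw [e, e2]
  have t1 := gau_taylor hU hU3 x' v c
  have t2 : |⟪v, gradient U x' - gradient U x⟫| ≤ ‖v‖ * (s * (L ^ 2 * ‖x‖)) := by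
    refine (abs_real_inner_le_norm _ _).trans (mul_le_mul_of_nonneg_left ?_ (norm_nonneg _))
    refine (grad_lip hU _ _).trans ?_
    rw [hx', sub_sub_cancel_left, norm_neg, norm_smul, Real.norm_of_nonneg h0]
    have := grad_bound hU x
    calc L * (s * ‖gradient U x‖) ≤ L * (s * (L * ‖x‖)) := by gcongr
      _ = _ := by ring
  refine (abs_add_le _ _).trans ((add_le_add t1 t2).trans (le_of_eq ?_))
  rw [hc2]; ring

lemma noise_N4 (hK : 1 ≤ K) (hU : StrongAssumption U m L) (hU3 : ThirdDerivBounded U Lt) (hη : 0 ≤ η) (x v : Euc d) :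
    |∫ r, ⟪v, pE U η K x r⟫ ∂(prlmcNoise d K)| ≤ ‖v‖ * (η ^ 2 / 2 * (L ^ 2 * ‖x‖ + d * Lt)) := by
  have hL0 : 0 ≤ L := hU.2.1.le.trans hU.2.2.1
  have := piB_prob hK
  have hLt := Lt_nonneg hU3
  have hg := grad_cont hU
  have hK1 : (K : ℝ)⁻¹ ≤ 1 := inv_le_one_of_one_le₀ (by exact_mod_cast hK)
  have hK0 : (0 : ℝ) < K := by positivity
  have hmc : ∀ i : Fin K, Continuous (fun g => prlmcMid U η K x g i) := fun i =>
    (pMid_cont (η := η) hU i).comp (Continuous.prodMk continuous_const continuous_id)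
  have hmem : ∀ i : Fin K, MemLp (fun g => gradient U (prlmcMid U η K x g i) - gradient U x) 2 (piG d K) := by
    intro i
    have hmi := hmc i
    refine ((mid_memLp (U := U) (η := η) x i).norm.const_mul L).mono' (Continuous.aestronglyMeasurable (by fun_prop)) (ae_of_all _ fun z => ?_)
    exact grad_lip hU _ _
  have i1 : ∀ i : Fin K, Integrable (fun g => ⟪v, gradient U (prlmcMid U η K x g i) - gradient U x⟫) (piG d K) := fun i =>
    ((hmem i).integrable (by norm_num)).const_inner v
  have i2 : ∀ i : Fin K, Integrable (fun p : (Fin K → Euc d) × Euc d => ⟪v, gradient U (prlmcMid U η K x p.1 i) - gradient U x⟫)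
      ((piG d K).prod (_root_.stdGaussian d)) := fun i => (i1 i).comp_fst _
  have i3 : ∀ i : Fin K, Integrable (fun r : (Fin K → ℝ) × (Fin K → Euc d) × Euc d =>
      r.1 i * ⟪v, gradient U (prlmcMid U η K x r.2.1 i) - gradient U x⟫) (prlmcNoise d K) := fun i =>
    Integrable.mul_prod ((piB_memLp hK i 1).integrable le_rfl) (i2 i)
  have e : ∫ r, ⟪v, pE U η K x r⟫ ∂(prlmcNoise d K) =
      η * ∑ i : Fin K, (K : ℝ)⁻¹ * ∫ g, ⟪v, gradient U (prlmcMid U η K x g i) - gradient U x⟫ ∂(piG d K) := by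
    simp only [pE, real_inner_smul_right, inner_sum]
    rw [integral_const_mul, integral_finsetSum _ fun i _ => i3 i]
    congr 1
    apply Finset.sum_congr rfl
    intro i _
    rw [noise_eq]
    refine (integral_prod_mul (fun h : Fin K → ℝ => h i) (fun p : (Fin K → Euc d) × Euc d => ⟪v, gradient U (prlmcMid U η K x p.1 i) - gradient U x⟫)).trans ?_
    rw [piB_mean hK]
    congr 1
    exact (integral_fun_fst (fun g => ⟪v, gradient U (prlmcMid U η K x g i) - gradient U x⟫)).trans (by simp)
  rw [e, abs_mul, abs_of_nonneg hη]
  have : |∑ i : Fin K, (K : ℝ)⁻¹ * ∫ g, ⟪v, gradient U (prlmcMid U η K x g i) - gradient U x⟫ ∂(piG d K)| ≤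
      ‖v‖ * (L ^ 2 * ‖x‖ + d * Lt) * (η * (1 - (K : ℝ)⁻¹) / 2) := by
    rw [← sum_s hK, ← mul_assoc, mul_comm _ (K : ℝ)⁻¹, ← Finset.mul_sum, abs_mul, abs_of_nonneg (inv_nonneg.2 hK0.le), mul_assoc]
    refine mul_le_mul_of_nonneg_left ?_ (inv_nonneg.2 hK0.le)
    refine (Finset.abs_sum_le_sum_abs _ _).trans ?_
    rw [Finset.mul_sum]
    refine Finset.sum_le_sum fun i _ => (mid_taylor hU hU3 hη x v i).trans (le_of_eq (by ring))
  have h2 : ‖v‖ * (L ^ 2 * ‖x‖ + d * Lt) * (η * (1 - (K : ℝ)⁻¹) / 2) ≤ ‖v‖ * (L ^ 2 * ‖x‖ + d * Lt) * (η / 2) := by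
    refine mul_le_mul_of_nonneg_left ?_ (by positivity)
    nlinarith [inv_pos.2 hK0]
  calc _ ≤ η * (‖v‖ * (L ^ 2 * ‖x‖ + d * Lt) * (η / 2)) := mul_le_mul_of_nonneg_left (this.trans h2) hη
    _ = _ := by ring

/-! ### The kernel as a pushforward -/

lemma kernel_meas (hK : 1 ≤ K) (hU : StrongAssumption U m L) : Measurable (prlmcKernel U η K : Euc d → Measure (Euc d)) := by
  have := noise_prob d hK
  refine Measure.measurable_of_measurable_coe _ fun s hs => ?_
  have hc := (pS_cont (K := K) (η := η) hU).measurable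
  have : ∀ x, prlmcKernel U η K x s = prlmcNoise d K (Prod.mk x ⁻¹' ((fun p : Euc d × ((Fin K → ℝ) × (Fin K → Euc d) × Euc d) => pS U η K p.1 p.2) ⁻¹' s)) := by
    intro x
    exact Measure.map_apply (hc.comp measurable_prodMk_left) hs
  simp_rw [this]
  exact measurable_measure_prodMk_left (hc hs)

lemma bind_eq (hK : 1 ≤ K) (hU : StrongAssumption U m L) (μ : Measure (Euc d)) [SFinite μ] :
    μ.bind (prlmcKernel U η K) = (μ.prod (prlmcNoise d K)).map (fun p => pS U η K p.1 p.2) := by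
  have := noise_prob d hK
  have hc := (pS_cont (K := K) (η := η) hU).measurable
  ext s hs
  rw [Measure.bind_apply hs (kernel_meas hK hU).aemeasurable, Measure.map_apply hc hs, Measure.prod_apply (hc hs)]
  apply lintegral_congr; intro x
  exact Measure.map_apply (hc.comp measurable_prodMk_left) hs

end

/-! ### Existence and uniqueness of the stationary law of a contractive random map -/

section stat
variable {d : ℕ} {Ω : Type*} [MeasurableSpace Ω] {N : Measure Ω} [IsProbabilityMeasure N]
  {S : Euc d → Ω → Euc d} {ρ A : ℝ}

def BLf {d : ℕ} (f : Euc d → ℝ) (B l : ℝ) : Prop :=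
  0 ≤ l ∧ (∀ x, |f x| ≤ B) ∧ ∀ x y, |f x - f y| ≤ l * ‖x - y‖

lemma BLf.lip {f : Euc d → ℝ} {B l : ℝ} (h : BLf f B l) : LipschitzWith l.toNNReal f :=
  LipschitzWith.of_dist_le_mul fun x y => by
    rw [Real.dist_eq, dist_eq_norm, Real.coe_toNNReal _ h.1]; exact h.2.2 x y

lemma BLf.cont {f : Euc d → ℝ} {B l : ℝ} (h : BLf f B l) : Continuous f := h.lip.continuous

lemma BLf.integrable {f : Euc d → ℝ} {B l : ℝ} (h : BLf f B l) (μ : Measure (Euc d)) [IsProbabilityMeasure μ] :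
    Integrable f μ :=
  Integrable.of_bound h.cont.aestronglyMeasurable B (ae_of_all _ fun x => h.2.1 x)

def opT (N : Measure Ω) (S : Euc d → Ω → Euc d) (f : Euc d → ℝ) (x : Euc d) : ℝ := ∫ r, f (S x r) ∂N

lemma S_meas (hS : Measurable (fun p : Euc d × Ω => S p.1 p.2)) (x : Euc d) : Measurable (S x) :=
  hS.comp measurable_prodMk_left

lemma L2_integral_norm {f : Ω → Euc d} {a : ℝ} (h : L2le N f a) : ∫ r, ‖f r‖ ∂N ≤ a := by
  have h1 : L2le N (fun r => ‖f r‖) (1 * a) := L2le.dom zero_le_one h.1.norm h (fun x => by simp)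
  have h2 : L2le N (fun _ : Ω => (1 : ℝ)) 1 := L2le.of_integral (memLp_const 1) zero_le_one (by simp)
  have := h2.inner_le h1
  simp only [one_mul] at this
  refine (le_abs_self _).trans (le_trans (le_of_eq ?_) this)
  congr 1
  apply integral_congr_ae
  exact ae_of_all _ fun r => by simp

lemma S_lip (hS : Measurable (fun p : Euc d × Ω => S p.1 p.2)) (hρ : 0 ≤ ρ)
    (h1 : ∀ x y, ∫⁻ r, ‖S x r - S y r‖ₑ ^ 2 ∂N ≤ ENNReal.ofReal (ρ ^ 2 * ‖x - y‖ ^ 2)) (x y : Euc d) :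
    L2le N (fun r => S x r - S y r) (ρ * ‖x - y‖) := by
  apply L2le.of_lintegral ((S_meas hS x).sub (S_meas hS y)).aestronglyMeasurable (by positivity)
  rw [mul_pow]; exact h1 x y

lemma opT_BL (hS : Measurable (fun p : Euc d × Ω => S p.1 p.2)) (hρ : 0 ≤ ρ)
    (h1 : ∀ x y, ∫⁻ r, ‖S x r - S y r‖ₑ ^ 2 ∂N ≤ ENNReal.ofReal (ρ ^ 2 * ‖x - y‖ ^ 2)) {f : Euc d → ℝ} {B l : ℝ} (hf : BLf f B l) :
    BLf (opT N S f) B (ρ * l) := by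
  have hi : ∀ x, Integrable (fun r => f (S x r)) N := fun x =>
    Integrable.of_bound (hf.cont.measurable.comp (S_meas hS x)).aestronglyMeasurable B (ae_of_all _ fun r => hf.2.1 _)
  refine ⟨mul_nonneg hρ hf.1, fun x => ?_, fun x y => ?_⟩
  · have := norm_integral_le_of_norm_le_const (μ := N) (f := fun r => f (S x r)) (C := B) (ae_of_all _ fun r => hf.2.1 _)
    simpa [opT] using this
  · have hl := S_lip hS hρ h1 x y
    unfold opT
    rw [← integral_sub (hi x) (hi y)]
    have i1 : Integrable (fun r => ‖S x r - S y r‖) N := (hl.memLp.integrable (by norm_num)).norm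
    refine (norm_integral_le_of_norm_le (f := fun r => f (S x r) - f (S y r)) (i1.const_mul l) (ae_of_all _ fun r => hf.2.2 (S x r) (S y r))).trans ?_
    rw [integral_const_mul]
    nlinarith [L2_integral_norm hl, hf.1, mul_le_mul_of_nonneg_left (L2_integral_norm hl) hf.1]

lemma opT_iter_BL (hS : Measurable (fun p : Euc d × Ω => S p.1 p.2)) (hρ : 0 ≤ ρ)
    (h1 : ∀ x y, ∫⁻ r, ‖S x r - S y r‖ₑ ^ 2 ∂N ≤ ENNReal.ofReal (ρ ^ 2 * ‖x - y‖ ^ 2)) {f : Euc d → ℝ} {B l : ℝ} (hf : BLf f B l) (n : ℕ) :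
    BLf ((opT N S)^[n] f) B (ρ ^ n * l) := by
  induction n with
  | zero => simpa using hf
  | succ n ih =>
    rw [Function.iterate_succ_apply', pow_succ', mul_assoc]
    exact opT_BL hS hρ h1 ih

/-- Push a measure one step forward. -/
def pushQ (N : Measure Ω) (S : Euc d → Ω → Euc d) (μ : Measure (Euc d)) : Measure (Euc d) :=
  (μ.prod N).map (fun p => S p.1 p.2)

lemma pushQ_prob (hS : Measurable (fun p : Euc d × Ω => S p.1 p.2)) (μ : Measure (Euc d)) [IsProbabilityMeasure μ] :
    IsProbabilityMeasure (pushQ N S μ) := Measure.isProbabilityMeasure_map hS.aemeasurable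

lemma pushQ_integral (hS : Measurable (fun p : Euc d × Ω => S p.1 p.2)) (μ : Measure (Euc d)) [IsProbabilityMeasure μ]
    {f : Euc d → ℝ} {B l : ℝ} (hf : BLf f B l) : ∫ x, f x ∂(pushQ N S μ) = ∫ x, opT N S f x ∂μ := by
  unfold pushQ
  rw [integral_map hS.aemeasurable hf.cont.aestronglyMeasurable, integral_prod]
  · rfl
  · exact Integrable.of_bound (hf.cont.measurable.comp hS).aestronglyMeasurable B (ae_of_all _ fun r => hf.2.1 _)

lemma meas_ext {μ ν : Measure (Euc d)} [IsProbabilityMeasure μ] [IsProbabilityMeasure ν]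
    (h : ∀ f B l, BLf f B l → ∫ x, f x ∂μ = ∫ x, f x ∂ν) : μ = ν := by
  let μ' : ProbabilityMeasure (Euc d) := ⟨μ, inferInstance⟩
  let ν' : ProbabilityMeasure (Euc d) := ⟨ν, inferInstance⟩
  have : Tendsto (fun _ : ℕ => μ') atTop (𝓝 ν') := by
    rw [tendsto_iff_forall_lipschitz_integral_tendsto]
    rintro f ⟨C, hC⟩ ⟨l, hl⟩
    have hf : BLf f (|f 0| + C) l := by
      refine ⟨l.2, fun x => ?_, fun x y => ?_⟩
      · have := hC x 0
        rw [Real.dist_eq] at this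
        have h2 := abs_sub_abs_le_abs_sub (f x) (f 0)
        linarith
      · have := hl.dist_le_mul x y
        rwa [Real.dist_eq, dist_eq_norm] at this
    have e := h f _ _ hf
    change Tendsto (fun _ : ℕ => ∫ x, f x ∂μ) atTop (𝓝 (∫ x, f x ∂ν))
    rw [e]; exact tendsto_const_nhds
  have h2 : μ' = ν' := tendsto_nhds_unique tendsto_const_nhds this
  exact congrArg (fun p : ProbabilityMeasure (Euc d) => (p : Measure (Euc d))) h2

lemma stat_integral (hS : Measurable (fun p : Euc d × Ω => S p.1 p.2)) (hρ : 0 ≤ ρ)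
    (h1 : ∀ x y, ∫⁻ r, ‖S x r - S y r‖ₑ ^ 2 ∂N ≤ ENNReal.ofReal (ρ ^ 2 * ‖x - y‖ ^ 2))
    {μ : Measure (Euc d)} [IsProbabilityMeasure μ] (hμ : pushQ N S μ = μ) {f : Euc d → ℝ} {B l : ℝ} (hf : BLf f B l) (n : ℕ) :
    ∫ x, ((opT N S)^[n] f) x ∂μ = ∫ x, f x ∂μ := by
  induction n with
  | zero => rfl
  | succ n ih =>
    rw [Function.iterate_succ_apply', ← ih]
    conv_rhs => rw [← hμ]
    rw [pushQ_integral hS μ (opT_iter_BL hS hρ h1 hf n)]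

lemma stat_tendsto (hS : Measurable (fun p : Euc d × Ω => S p.1 p.2)) (hρ : 0 ≤ ρ) (hρ1 : ρ < 1)
    (h1 : ∀ x y, ∫⁻ r, ‖S x r - S y r‖ₑ ^ 2 ∂N ≤ ENNReal.ofReal (ρ ^ 2 * ‖x - y‖ ^ 2))
    {μ : Measure (Euc d)} [IsProbabilityMeasure μ] (hμ : pushQ N S μ = μ) {f : Euc d → ℝ} {B l : ℝ} (hf : BLf f B l) :
    Tendsto (fun n => ((opT N S)^[n] f) 0) atTop (𝓝 (∫ x, f x ∂μ)) := by
  have hB : 0 ≤ B := (abs_nonneg _).trans (hf.2.1 0)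
  have key : Tendsto (fun n => ∫ x, ((opT N S)^[n] f) x - ((opT N S)^[n] f) 0 ∂μ) atTop (𝓝 (∫ _, (0 : ℝ) ∂μ)) := by
    apply tendsto_integral_of_dominated_convergence (fun _ => 2 * B)
    · intro n
      exact ((opT_iter_BL hS hρ h1 hf n).cont.sub continuous_const).aestronglyMeasurable
    · exact integrable_const _
    · intro n
      refine ae_of_all _ fun x => ?_
      have h2 := (opT_iter_BL hS hρ h1 hf n).2.1
      refine (norm_sub_le _ _).trans ?_
      rw [two_mul]
      exact add_le_add (h2 x) (h2 0)
    · refine ae_of_all _ fun x => ?_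
      apply squeeze_zero_norm (fun n => (opT_iter_BL hS hρ h1 hf n).2.2 x 0)
      have := ((tendsto_pow_atTop_nhds_zero_of_lt_one hρ hρ1).mul_const l).mul_const ‖x - 0‖
      simpa using this
  have e : ∀ n, ((opT N S)^[n] f) 0 = ∫ x, f x ∂μ - ∫ x, ((opT N S)^[n] f) x - ((opT N S)^[n] f) 0 ∂μ := by
    intro n
    rw [integral_sub ((opT_iter_BL hS hρ h1 hf n).integrable μ) (integrable_const _), stat_integral hS hρ h1 hμ hf]
    simp
  refine Tendsto.congr (fun n => (e n).symm) ?_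
  have := (tendsto_const_nhds (x := ∫ x, f x ∂μ)).sub key
  simpa using this

lemma stat_unique (hS : Measurable (fun p : Euc d × Ω => S p.1 p.2)) (hρ : 0 ≤ ρ) (hρ1 : ρ < 1)
    (h1 : ∀ x y, ∫⁻ r, ‖S x r - S y r‖ₑ ^ 2 ∂N ≤ ENNReal.ofReal (ρ ^ 2 * ‖x - y‖ ^ 2))
    {μ ν : Measure (Euc d)} [IsProbabilityMeasure μ] [IsProbabilityMeasure ν] (hμ : pushQ N S μ = μ) (hν : pushQ N S ν = ν) : μ = ν :=
  meas_ext fun _ _ _ hf => tendsto_nhds_unique (stat_tendsto hS hρ hρ1 h1 hμ hf) (stat_tendsto hS hρ hρ1 h1 hν hf)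

lemma opT_cauchy (hS : Measurable (fun p : Euc d × Ω => S p.1 p.2)) (hρ : 0 ≤ ρ) (hρ1 : ρ < 1)
    (h1 : ∀ x y, ∫⁻ r, ‖S x r - S y r‖ₑ ^ 2 ∂N ≤ ENNReal.ofReal (ρ ^ 2 * ‖x - y‖ ^ 2)) (hA : L2le N (S 0) A)
    {f : Euc d → ℝ} {B l : ℝ} (hf : BLf f B l) : ∃ a, Tendsto (fun n => ((opT N S)^[n] f) 0) atTop (𝓝 a) := by
  apply cauchySeq_tendsto_of_complete
  apply cauchySeq_of_le_geometric ρ (l * A) hρ1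
  intro n
  rw [dist_comm, Real.dist_eq, Function.iterate_succ_apply']
  have hb := opT_iter_BL hS hρ h1 hf n
  set g := (opT N S)^[n] f
  have e : opT N S g 0 - g 0 = ∫ r, g (S 0 r) - g 0 ∂N := by
    rw [integral_sub _ (integrable_const _)]
    · simp [opT]
    · exact Integrable.of_bound (hb.cont.measurable.comp (S_meas hS 0)).aestronglyMeasurable B (ae_of_all _ fun r => hb.2.1 _)
  rw [e]
  have i1 : Integrable (fun r => ‖S 0 r‖) N := (hA.memLp.integrable (by norm_num)).norm
  refine (norm_integral_le_of_norm_le (f := fun r => g (S 0 r) - g 0) (i1.const_mul (ρ ^ n * l)) (ae_of_all _ fun r => ?_)).trans ?_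
  · have := hb.2.2 (S 0 r) 0
    simpa using this
  · rw [integral_const_mul]
    have := mul_le_mul_of_nonneg_left (L2_integral_norm hA) hb.1
    linarith

lemma pushQ_L2 (hS : Measurable (fun p : Euc d × Ω => S p.1 p.2)) (hρ : 0 ≤ ρ) (hρ1 : ρ < 1)
    (h1 : ∀ x y, ∫⁻ r, ‖S x r - S y r‖ₑ ^ 2 ∂N ≤ ENNReal.ofReal (ρ ^ 2 * ‖x - y‖ ^ 2)) (hA : L2le N (S 0) A)
    {μ : Measure (Euc d)} [IsProbabilityMeasure μ] (hμ : L2le μ (fun x => x) (A / (1 - ρ))) :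
    L2le (pushQ N S μ) (fun x => x) (A / (1 - ρ)) := by
  have h0 : 0 < 1 - ρ := by linarith
  apply L2le.of_comp hS aestronglyMeasurable_id
  have hS0 : Measurable (fun p : Euc d × Ω => S 0 p.2) := (S_meas hS 0).comp measurable_snd
  have k1 : L2le (μ.prod N) (fun p => S p.1 p.2 - S 0 p.2) (ρ * (A / (1 - ρ))) := by
    apply L2le.of_lintegral (hS.sub hS0).aestronglyMeasurable (mul_nonneg hρ (div_nonneg hA.nonneg h0.le))
    rw [lintegral_prod _ (by fun_prop)]
    calc _ ≤ ∫⁻ x, ENNReal.ofReal (ρ ^ 2 * ‖x - 0‖ ^ 2) ∂μ := lintegral_mono fun x => h1 x 0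
      _ = ∫⁻ x, ENNReal.ofReal (ρ ^ 2) * ‖x‖ₑ ^ 2 ∂μ := by
        apply lintegral_congr; intro x
        rw [ENNReal.ofReal_mul (by positivity), sub_zero, ENNReal.ofReal_pow (norm_nonneg _), ofReal_norm]
      _ = ENNReal.ofReal (ρ ^ 2) * ∫⁻ x, ‖x‖ₑ ^ 2 ∂μ := lintegral_const_mul _ (by fun_prop)
      _ ≤ ENNReal.ofReal (ρ ^ 2) * ENNReal.ofReal ((A / (1 - ρ)) ^ 2) := by gcongr; exact hμ.lintegral_le
      _ = _ := by rw [← ENNReal.ofReal_mul (by positivity), mul_pow]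
  have k2 : L2le (μ.prod N) (fun p => S 0 p.2) A := by
    have e : (μ.prod N).map Prod.snd = N := by simp
    apply L2le.comp (f := S 0) measurable_snd
    rw [e]; exact hA
  have := k1.add k2
  simp only [sub_add_cancel] at this
  have e : A / (1 - ρ) = ρ * (A / (1 - ρ)) + A := by
    field_simp
    ring
  rw [e]; exact this

theorem stat_exists (hS : Measurable (fun p : Euc d × Ω => S p.1 p.2)) (hρ : 0 ≤ ρ) (hρ1 : ρ < 1)
    (h1 : ∀ x y, ∫⁻ r, ‖S x r - S y r‖ₑ ^ 2 ∂N ≤ ENNReal.ofReal (ρ ^ 2 * ‖x - y‖ ^ 2)) (hA : L2le N (S 0) A) :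
    ∃ μ : Measure (Euc d), IsProbabilityMeasure μ ∧ pushQ N S μ = μ ∧ L2le μ (fun x => x) (A / (1 - ρ)) := by
  have h0 : 0 < 1 - ρ := by linarith
  set R := A / (1 - ρ) with hR
  have hR0 : 0 ≤ R := div_nonneg hA.nonneg h0.le
  let μs : ℕ → Measure (Euc d) := fun n => (pushQ N S)^[n] (Measure.dirac 0)
  have hsucc : ∀ n, μs (n + 1) = pushQ N S (μs n) := fun n => Function.iterate_succ_apply' _ _ _
  have hp : ∀ n, IsProbabilityMeasure (μs n) ∧ L2le (μs n) (fun x => x) R := by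
    intro n
    induction n with
    | zero =>
      refine ⟨Measure.dirac.isProbabilityMeasure, ?_⟩
      apply L2le.of_lintegral aestronglyMeasurable_id hR0
      change ∫⁻ x, ‖x‖ₑ ^ 2 ∂(Measure.dirac (0 : Euc d)) ≤ _
      rw [lintegral_dirac]; simp
    | succ n ih =>
      have := ih.1
      rw [hsucc]
      exact ⟨pushQ_prob hS _, pushQ_L2 hS hρ hρ1 h1 hA ih.2⟩
  have hintgr : ∀ n, ∀ {f : Euc d → ℝ} {B l : ℝ}, BLf f B l → ∫ x, f x ∂(μs n) = ((opT N S)^[n] f) 0 := by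
    intro n
    induction n with
    | zero => intro f B l hf; exact integral_dirac f 0
    | succ n ih =>
      intro f B l hf
      have := (hp n).1
      rw [hsucc, pushQ_integral hS _ hf, ih (opT_BL hS hρ h1 hf)]
      rfl
  let P : ℕ → ProbabilityMeasure (Euc d) := fun n => ⟨μs n, (hp n).1⟩
  let u : ℕ → ℝ≥0 := fun n => ((R ^ 2).toNNReal) / (n + 1)
  have hu : Tendsto u atTop (𝓝 0) := by
    have := (tendsto_one_div_add_atTop_nhds_zero_nat (𝕜 := ℝ≥0)).const_mul ((R ^ 2).toNNReal)
    simpa [u, div_eq_mul_inv] using this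
  have hcomp := isCompact_setOfPred_probabilityMeasure_mass_eq_compl_isCompact_le (E := Euc d) (u := u)
    (K := fun n => Metric.closedBall 0 (n + 1 : ℝ)) hu (fun n => isCompact_closedBall _ _) (Or.inl inferInstance)
  have hmem : ∀ n, P n ∈ {μ : ProbabilityMeasure (Euc d) | ∀ k : ℕ, μ (Metric.closedBall 0 (k + 1 : ℝ))ᶜ ≤ u k} := by
    intro n k
    rw [← ENNReal.coe_le_coe, ProbabilityMeasure.ennreal_coeFn_eq_coeFn_toMeasure]
    change μs n (Metric.closedBall 0 (k + 1 : ℝ))ᶜ ≤ _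
    have hk : (0 : ℝ) < k + 1 := by positivity
    have hM := mul_meas_ge_le_lintegral₀ (μ := μs n) (f := fun x : Euc d => ‖x‖ₑ ^ 2) (by fun_prop) ((k + 1 : ℝ≥0∞))
    have hsub : (Metric.closedBall (0 : Euc d) (k + 1 : ℝ))ᶜ ⊆ {x | (k + 1 : ℝ≥0∞) ≤ ‖x‖ₑ ^ 2} := by
      intro x hx
      simp only [Set.mem_compl_iff, mem_closedBall_zero_iff, not_le] at hx
      show (k + 1 : ℝ≥0∞) ≤ ‖x‖ₑ ^ 2
      rw [← ofReal_norm, ← ENNReal.ofReal_pow (norm_nonneg _)]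
      have : (k + 1 : ℝ≥0∞) = ENNReal.ofReal (k + 1) := by
        rw [ENNReal.ofReal_add (by positivity) zero_le_one]; simp
      rw [this]
      apply ENNReal.ofReal_le_ofReal
      have : (1 : ℝ) ≤ k + 1 := by linarith [Nat.cast_nonneg (α := ℝ) k]
      nlinarith
    have hle := (hM.trans (hp n).2.lintegral_le)
    have h3 : (k + 1 : ℝ≥0∞) * μs n (Metric.closedBall 0 (k + 1 : ℝ))ᶜ ≤ ENNReal.ofReal (R ^ 2) :=
      (mul_le_mul_right (measure_mono hsub) _).trans hle
    have e : ((u k : ℝ≥0) : ℝ≥0∞) = ENNReal.ofReal (R ^ 2) / (k + 1) := by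
      simp only [u]
      rw [ENNReal.coe_div (by positivity)]; simp [ENNReal.ofReal]
    rw [e, ENNReal.le_div_iff_mul_le (by simp) (by simp), mul_comm]
    exact h3
  obtain ⟨μ, -, hμ⟩ := hcomp.ultrafilter_le_nhds ((hyperfilter ℕ).map P) (by
    rw [le_principal_iff]; exact Filter.mem_map.2 (Filter.univ_mem' hmem))
  have hμ' : Tendsto P (hyperfilter ℕ : Filter ℕ) (𝓝 μ) := hμ
  rw [ProbabilityMeasure.tendsto_iff_forall_integral_tendsto] at hμ'
  have hlim : ∀ {f : Euc d → ℝ} {B l : ℝ}, BLf f B l → Tendsto (fun n => ((opT N S)^[n] f) 0) atTop (𝓝 (∫ x, f x ∂(μ : Measure (Euc d)))) := by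
    intro f B l hf
    obtain ⟨a, ha⟩ := opT_cauchy hS hρ hρ1 h1 hA hf
    have h2 := hμ' (BoundedContinuousFunction.ofNormedAddCommGroup f hf.cont B hf.2.1)
    have h3 : Tendsto (fun n => ((opT N S)^[n] f) 0) (hyperfilter ℕ : Filter ℕ) (𝓝 (∫ x, f x ∂(μ : Measure (Euc d)))) := by
      refine h2.congr fun n => ?_
      exact hintgr n hf
    rw [tendsto_nhds_unique h3 (ha.mono_left Nat.hyperfilter_le_atTop)]
    exact ha
  have := pushQ_prob hS (N := N) (μ : Measure (Euc d))
  refine ⟨μ, inferInstance, ?_, ?_⟩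
  · apply meas_ext
    intro f B l hf
    rw [pushQ_integral hS _ hf]
    have h2 := hlim hf
    have h3 := hlim (opT_BL hS hρ h1 hf)
    refine tendsto_nhds_unique h3 ?_
    exact (tendsto_add_atTop_iff_nat 1).2 h2
  · apply L2le.of_lintegral aestronglyMeasurable_id hR0
    have hk : ∀ k : ℕ, ∫⁻ x, ENNReal.ofReal (min (‖x‖ ^ 2) k) ∂(μ : Measure (Euc d)) ≤ ENNReal.ofReal (R ^ 2) := by
      intro k
      have hc : Continuous (fun x : Euc d => min (‖x‖ ^ 2) (k : ℝ)) := by fun_prop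
      have hnn : ∀ x : Euc d, 0 ≤ min (‖x‖ ^ 2) (k : ℝ) := fun x => le_min (by positivity) (by positivity)
      have hbd : ∀ x : Euc d, ‖min (‖x‖ ^ 2) (k : ℝ)‖ ≤ k := fun x => by
        rw [Real.norm_of_nonneg (hnn x)]; exact min_le_right _ _
      have hi : ∀ (ν : Measure (Euc d)) [IsProbabilityMeasure ν], Integrable (fun x : Euc d => min (‖x‖ ^ 2) (k : ℝ)) ν := fun ν _ =>
        Integrable.of_bound hc.aestronglyMeasurable k (ae_of_all _ hbd)
      rw [← ofReal_integral_eq_lintegral_ofReal (hi _) (ae_of_all _ hnn)]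
      apply ENNReal.ofReal_le_ofReal
      have h2 := hμ' (BoundedContinuousFunction.ofNormedAddCommGroup _ hc k hbd)
      refine le_of_tendsto h2 (Eventually.of_forall fun n => ?_)
      have := (hp n).1
      refine le_trans ?_ (hp n).2.integral_le
      exact integral_mono (hi (μs n)) (hp n).2.integrable_sq (fun x => min_le_left _ _)
    have hmono := lintegral_iSup (μ := (μ : Measure (Euc d))) (f := fun (k : ℕ) (x : Euc d) => ENNReal.ofReal (min (‖x‖ ^ 2) k))
      (fun k => by fun_prop) (fun i j hij x => ENNReal.ofReal_le_ofReal (min_le_min le_rfl (by exact_mod_cast hij)))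
    have e : ∀ x : Euc d, ‖x‖ₑ ^ 2 ≤ ⨆ k : ℕ, ENNReal.ofReal (min (‖x‖ ^ 2) k) := by
      intro x
      obtain ⟨k, hk⟩ := exists_nat_ge (‖x‖ ^ 2)
      refine le_iSup_of_le k ?_
      rw [min_eq_left hk, ENNReal.ofReal_pow (norm_nonneg _), ofReal_norm]
    refine (lintegral_mono e).trans ?_
    rw [hmono]
    exact iSup_le hk

end stat

/-! ### Helpers for the coupling -/

section help
variable {Ω R E : Type*} [MeasurableSpace Ω] [MeasurableSpace R]
  [NormedAddCommGroup E] [InnerProductSpace ℝ E]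
  {P : Measure Ω} {N : Measure R} [IsProbabilityMeasure P] [IsProbabilityMeasure N]

lemma L2le.lift_fst {f : Ω → E} {a : ℝ} (h : L2le P f a) : L2le (P.prod N) (fun q => f q.1) a := by
  have e : (P.prod N).map Prod.fst = P := (measurePreserving_fst (μ := P) (ν := N)).map_eq
  exact L2le.comp (ν := P.prod N) (T := Prod.fst) measurable_fst (by rw [e]; exact h)

lemma L2le.lift_snd {f : R → E} {a : ℝ} (h : L2le N f a) : L2le (P.prod N) (fun q => f q.2) a := by
  have e : (P.prod N).map Prod.snd = N := (measurePreserving_snd (μ := P) (ν := N)).map_eq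
  exact L2le.comp (ν := P.prod N) (T := Prod.snd) measurable_snd (by rw [e]; exact h)

lemma L2le.const (c : ℝ) (hc : 0 ≤ c) : L2le P (fun _ => c) c := by
  refine L2le.of_lintegral aestronglyMeasurable_const hc ?_
  simp only [lintegral_const, measure_univ, mul_one]
  rw [ENNReal.ofReal_pow hc, ← ofReal_norm, Real.norm_of_nonneg hc]

lemma L2le.norm {f : Ω → E} {a : ℝ} (h : L2le P f a) : L2le P (fun ω => ‖f ω‖) a := by
  have := L2le.dom (k := 1) zero_le_one h.1.norm h (fun x => by simp)
  simpa using this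

lemma int_norm_mul {D X : Ω → E} {W G α β : ℝ} (hD : L2le P D W) (hX : L2le P X G)
    (hα : 0 ≤ α) (hβ : 0 ≤ β) :
    Integrable (fun ω => ‖D ω‖ * (α * ‖X ω‖ + β)) P ∧
      ∫ ω, ‖D ω‖ * (α * ‖X ω‖ + β) ∂P ≤ W * (α * G + β) := by
  have h1 : L2le P (fun ω => α * ‖X ω‖ + β) (α * G + β) := by
    have := (hX.norm.smul α).add (L2le.const (P := P) β hβ)
    rw [abs_of_nonneg hα] at this
    exact this
  have h2 := hD.norm
  have i := L2le.inner_integrable h1 h2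
  have l := L2le.inner_le h1 h2
  have e : ∀ ω, ⟪α * ‖X ω‖ + β, ‖D ω‖⟫ = ‖D ω‖ * (α * ‖X ω‖ + β) := fun ω => by
    simp [inner]
  simp only [e] at i l
  exact ⟨i, by rw [mul_comm W]; exact (le_abs_self _).trans l⟩

lemma cond_bound {F : Ω × R → ℝ} {D X : Ω → E} {W G α β : ℝ} (hF : Integrable F (P.prod N))
    (hD : L2le P D W) (hX : L2le P X G) (hα : 0 ≤ α) (hβ : 0 ≤ β)
    (h : ∀ ω, |∫ r, F (ω, r) ∂N| ≤ ‖D ω‖ * (α * ‖X ω‖ + β)) :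
    |∫ q, F q ∂(P.prod N)| ≤ W * (α * G + β) := by
  rw [integral_prod F hF]
  obtain ⟨i, l⟩ := int_norm_mul hD hX hα hβ
  rw [← Real.norm_eq_abs]
  exact (norm_integral_le_of_norm_le (f := fun ω => ∫ r, F (ω, r) ∂N) i
    (ae_of_all _ fun ω => by rw [Real.norm_eq_abs]; exact h ω)).trans l

end help

lemma gau_L2 (d : ℕ) : L2le (_root_.stdGaussian d) (fun z => z) (Real.sqrt d) :=
  L2le.of_integral (gau_memLp d 2 (by simp)) (Real.sqrt_nonneg _) (by
    rw [gau_norm_sq, Real.sq_sqrt (Nat.cast_nonneg d)])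

lemma malaNoise_fst (d : ℕ) : (malaNoise d).map Prod.fst = _root_.stdGaussian d :=
  (measurePreserving_fst (μ := _root_.stdGaussian d) (ν := volume.restrict (Set.Icc (0:ℝ) 1))).map_eq

section mala
variable {d : ℕ} {U : Euc d → ℝ} {m L Lt : ℝ}

lemma gau_grad_int (hU : StrongAssumption U m L) (x v : Euc d) (c : ℝ) :
    Integrable (fun z => ⟪v, gradient U (x + c • z) - gradient U x⟫) (_root_.stdGaussian d) := by
  have h1 : Integrable (fun z : Euc d => z) (_root_.stdGaussian d) :=
    (gau_memLp d 1 (by simp)).integrable le_rfl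
  have hc := grad_cont hU
  refine (h1.norm.const_mul (‖v‖ * (L * |c|))).mono' ?_ (ae_of_all _ fun z => ?_)
  · exact Continuous.aestronglyMeasurable (by fun_prop)
  · refine (norm_inner_le_norm _ _).trans ?_
    have := grad_lip hU (x + c • z) x
    rw [add_sub_cancel_left, norm_smul, Real.norm_eq_abs] at this
    calc _ ≤ ‖v‖ * (L * (|c| * ‖z‖)) := by gcongr
      _ = _ := by ring

lemma mala_drift (hU : StrongAssumption U m L) (hU3 : ThirdDerivBounded U Lt) (t : ℝ) (x v : Euc d) :
    |∫ r, ⟪v, gradient U (malaY U t x r.1) - gradient U x⟫ ∂(malaNoise d)| ≤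
      ‖v‖ * (t ^ 2 * L ^ 2 * ‖x‖ + t ^ 2 * (d * Lt)) := by
  have hc := grad_cont hU
  have hY := malaY_cont hU t
  have hY' : Continuous (fun z => malaY U t x z) := hY.comp (by fun_prop : Continuous fun z => (x, z))
  have e1 : ∫ r, ⟪v, gradient U (malaY U t x r.1) - gradient U x⟫ ∂(malaNoise d) =
      ∫ z, ⟪v, gradient U (malaY U t x z) - gradient U x⟫ ∂(_root_.stdGaussian d) := by
    rw [← malaNoise_fst, integral_map measurable_fst.aemeasurable]
    refine Continuous.aestronglyMeasurable ?_
    exact continuous_const.inner ((hc.comp hY').sub continuous_const)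
  rw [e1]
  set y := x - (t ^ 2) • gradient U x with hy
  have i := gau_grad_int hU y v (Real.sqrt 2 * t)
  have e2 : ∀ z, ⟪v, gradient U (malaY U t x z) - gradient U x⟫ =
      ⟪v, gradient U (y + (Real.sqrt 2 * t) • z) - gradient U y⟫ + ⟪v, gradient U y - gradient U x⟫ := by
    intro z
    rw [← inner_add_right]; congr 1
    simp only [malaY, ← hy]; abel
  simp only [e2]
  rw [integral_add i (integrable_const _), integral_const]
  simp only [probReal_univ, one_smul]
  have b1 := gau_taylor hU hU3 y v (Real.sqrt 2 * t)
  have b2 : |⟪v, gradient U y - gradient U x⟫| ≤ ‖v‖ * (L * (t ^ 2 * (L * ‖x‖))) := by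
    refine (abs_real_inner_le_norm _ _).trans ?_
    have hL : 0 ≤ L := hU.2.1.le.trans hU.2.2.1
    have h1 := grad_lip hU y x
    have h2 : ‖y - x‖ = t ^ 2 * ‖gradient U x‖ := by
      rw [hy, sub_sub_cancel_left, norm_neg, norm_smul, Real.norm_of_nonneg (sq_nonneg t)]
    rw [h2] at h1
    have := grad_bound hU x
    refine mul_le_mul_of_nonneg_left (h1.trans ?_) (norm_nonneg v)
    gcongr
  refine (abs_add_le _ _).trans ((add_le_add b1 b2).trans (le_of_eq ?_))
  rw [mul_pow, Real.sq_sqrt (by norm_num)]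
  ring

end mala

/-! ### The fine-step coupling: invariants -/

/-- displacement bound after `i` fine steps -/
def tauS (d : ℕ) (t δ G : ℝ) (i : ℕ) : ℝ := i * δ + t ^ 2 * (i * G) + (Real.sqrt 2 * t) * (Real.sqrt i * Real.sqrt d)

structure MInv {d : ℕ} (U : Euc d → ℝ) (L Lt t δ G0 W : ℝ) (Γ : Measure (Euc d × Euc d)) (j : ℕ)
    {Ω : Type} [MeasurableSpace Ω] (P : Measure Ω) (D : Ω → Euc d × Euc d) (x s a : Ω → Euc d) : Prop where
  prob : IsProbabilityMeasure P
  mD : Measurable D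
  mx : Measurable x
  ms : Measurable s
  ma : Measurable a
  lx : P.map x = gibbs U
  ls : P.map (fun ω => (D ω, s ω)) = Γ.prod ((_root_.stdGaussian d).map (fun z => Real.sqrt j • z))
  i4 : L2le P (fun ω => x ω - (D ω).1 + (t ^ 2) • a ω - (Real.sqrt 2 * t) • s ω) (j * δ)
  i5 : L2le P a (j * (L * G0))
  i6 : L2le P (fun ω => a ω - (j : ℝ) • gradient U (D ω).1) (L * ∑ i ∈ Finset.range j, tauS d t δ (L * G0) i)
  i7 : |∫ ω, ⟪(D ω).1 - (D ω).2, gradient U (x ω) - gradient U (D ω).1⟫ ∂P| ≤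
    j * ((t ^ 2 * (L ^ 2 * G0 + d * Lt) + L * δ) * W)
  i8 : |∫ ω, ⟪(D ω).1 - (D ω).2, a ω - (j : ℝ) • gradient U (D ω).1⟫ ∂P| ≤
    (∑ i ∈ Finset.range j, (i : ℝ)) * ((t ^ 2 * (L ^ 2 * G0 + d * Lt) + L * δ) * W)

section mi
variable {d : ℕ} {U : Euc d → ℝ} {m L Lt t δ G0 W : ℝ} {Γ : Measure (Euc d × Euc d)} {j : ℕ}
  {Ω : Type} [MeasurableSpace Ω] {P : Measure Ω} {D : Ω → Euc d × Euc d} {x s a : Ω → Euc d}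

lemma gauj_prob (d j : ℕ) : IsProbabilityMeasure ((_root_.stdGaussian d).map (fun z => Real.sqrt j • z)) :=
  Measure.isProbabilityMeasure_map (by fun_prop)

lemma MInv.lD (h : MInv U L Lt t δ G0 W Γ j P D x s a) [IsProbabilityMeasure Γ] : P.map D = Γ := by
  have := gauj_prob d j
  have e := congrArg (fun M => Measure.map Prod.fst M) h.ls
  rw [Measure.map_map measurable_fst (h.mD.prodMk h.ms), (measurePreserving_fst).map_eq] at e
  exact e

lemma MInv.lsg (h : MInv U L Lt t δ G0 W Γ j P D x s a) [IsProbabilityMeasure Γ] :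
    P.map s = (_root_.stdGaussian d).map (fun z => Real.sqrt j • z) := by
  have := gauj_prob d j
  have e := congrArg (fun M => Measure.map Prod.snd M) h.ls
  rw [Measure.map_map measurable_snd (h.mD.prodMk h.ms), (measurePreserving_snd).map_eq] at e
  exact e

lemma MInv.s_L2 (h : MInv U L Lt t δ G0 W Γ j P D x s a) [IsProbabilityMeasure Γ] :
    L2le P s (Real.sqrt j * Real.sqrt d) := by
  have e := h.lsg
  have h1 : L2le ((_root_.stdGaussian d).map (fun z => Real.sqrt j • z)) (fun z => z) (Real.sqrt j * Real.sqrt d) := by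
    refine L2le.of_comp (by fun_prop) aestronglyMeasurable_id ?_
    have := (gau_L2 d).smul (Real.sqrt j)
    rwa [abs_of_nonneg (Real.sqrt_nonneg _)] at this
  rw [← e] at h1
  exact L2le.comp (T := s) (f := fun z => z) h.ms h1

lemma MInv.D_L2 (h : MInv U L Lt t δ G0 W Γ j P D x s a) [IsProbabilityMeasure Γ]
    (hΓ : L2le Γ (fun p => p.1 - p.2) W) : L2le P (fun ω => (D ω).1 - (D ω).2) W := by
  have e := h.lD
  rw [← e] at hΓ
  exact L2le.comp (T := D) (f := fun p : Euc d × Euc d => p.1 - p.2) h.mD hΓ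

lemma MInv.x_L2 (h : MInv U L Lt t δ G0 W Γ j P D x s a) 
    (hG : L2le (gibbs U) (fun x => x) G0) : L2le P x G0 := by
  rw [← h.lx] at hG
  exact L2le.comp (T := x) (f := fun z => z) h.mx hG

lemma MInv.disp (h : MInv U L Lt t δ G0 W Γ j P D x s a) [IsProbabilityMeasure Γ] (ht : 0 ≤ t) :
    L2le P (fun ω => x ω - (D ω).1) (tauS d t δ (L * G0) j) := by
  have h1 := (h.i4.sub (h.i5.smul (t ^ 2))).add (h.s_L2.smul (Real.sqrt 2 * t))
  rw [abs_of_nonneg (by positivity), abs_of_nonneg (by positivity)] at h1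
  have e : (fun ω => x ω - (D ω).1) = (fun ω => x ω - (D ω).1 + (t ^ 2) • a ω - (Real.sqrt 2 * t) • s ω - (t ^ 2) • a ω
      + (Real.sqrt 2 * t) • s ω) := by
    funext ω; abel
  rw [e]
  exact h1

lemma MInv.gx (h : MInv U L Lt t δ G0 W Γ j P D x s a) (hU : StrongAssumption U m L)
    (hG : L2le (gibbs U) (fun x => x) G0) : L2le P (fun ω => gradient U (x ω)) (L * G0) :=
  L2le.dom (hU.2.1.le.trans hU.2.2.1) ((grad_cont hU).measurable.comp h.mx).aestronglyMeasurable (h.x_L2 hG)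
    (fun _ => grad_bound hU _)

lemma MInv.gdisp (h : MInv U L Lt t δ G0 W Γ j P D x s a) [IsProbabilityMeasure Γ] (hU : StrongAssumption U m L)
    (ht : 0 ≤ t) : L2le P (fun ω => gradient U (x ω) - gradient U (D ω).1) (L * tauS d t δ (L * G0) j) :=
  L2le.dom (hU.2.1.le.trans hU.2.2.1) (((grad_cont hU).measurable.comp h.mx).sub
    ((grad_cont hU).measurable.comp h.mD.fst)).aestronglyMeasurable (h.disp ht) (fun _ => grad_lip hU _ _)

lemma MInv.zero [IsProbabilityMeasure Γ] (hΓ1 : Γ.map Prod.fst = gibbs U) :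
    MInv U L Lt t δ G0 W Γ 0 Γ (fun p => p) (fun p => p.1) (fun _ => 0) (fun _ => 0) where
  prob := inferInstance
  mD := measurable_id
  mx := measurable_fst
  ms := measurable_const
  ma := measurable_const
  lx := hΓ1
  ls := by
    have := gauj_prob d 0
    simp only [Nat.cast_zero, Real.sqrt_zero, zero_smul, Measure.map_const, measure_univ, one_smul]
    rw [Measure.prod_dirac]
  i4 := by
    have : (fun p : Euc d × Euc d => p.1 - p.1 + (t ^ 2) • (0 : Euc d) - (Real.sqrt 2 * t) • (0 : Euc d)) = fun _ => 0 := by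
      funext p; simp
    rw [this]
    exact ⟨aestronglyMeasurable_const, by simp, by simp⟩
  i5 := ⟨aestronglyMeasurable_const, by simp, by simp⟩
  i6 := by
    have : (fun p : Euc d × Euc d => (0 : Euc d) - ((0 : ℕ) : ℝ) • gradient U p.1) = fun _ => 0 := by
      funext p; simp
    rw [this]
    exact ⟨aestronglyMeasurable_const, by simp, by simp⟩
  i7 := by simp
  i8 := by simp

lemma step_ls {A R : Type*} [MeasurableSpace A] [MeasurableSpace R] (d : ℕ) (P : Measure A) [IsProbabilityMeasure P]
    (N : Measure R) [IsProbabilityMeasure N] {B : Type*} [MeasurableSpace B] (Γ : Measure B) [IsProbabilityMeasure Γ]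
    (g g' : Measure (Euc d)) [IsProbabilityMeasure g] [IsProbabilityMeasure g'] (D : A → B) (hD : Measurable D)
    (s : A → Euc d) (hs : Measurable s) (z : R → Euc d) (hz : Measurable z)
    (h : P.map (fun ω => (D ω, s ω)) = Γ.prod g) (hN : N.map z = g') :
    (P.prod N).map (fun q => (D q.1, s q.1 + z q.2)) = Γ.prod ((g.prod g').map (fun p => p.1 + p.2)) := by
  have hDs : Measurable (fun ω => (D ω, s ω)) := hD.prodMk hs
  have e1 : (P.prod N).map (Prod.map (fun ω => (D ω, s ω)) z) = (Γ.prod g).prod g' := by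
    rw [← Measure.map_prod_map _ _ hDs hz, h, hN]
  have e2 := (measurePreserving_prodAssoc Γ g g').map_eq
  have hadd : Measurable (fun p : Euc d × Euc d => p.1 + p.2) := measurable_fst.add measurable_snd
  have e3 : Γ.prod ((g.prod g').map (fun p => p.1 + p.2)) =
      (Γ.prod (g.prod g')).map (Prod.map id (fun p : Euc d × Euc d => p.1 + p.2)) := by
    rw [← Measure.map_prod_map _ _ measurable_id hadd, Measure.map_id]
  rw [e3, ← e2, ← e1, Measure.map_map (MeasurableEquiv.measurable _) (hDs.prodMap hz),
    Measure.map_map (measurable_id.prodMap hadd) ((MeasurableEquiv.measurable _).comp (hDs.prodMap hz))]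
  rfl

end mi

/-! ### The fine-step coupling: induction -/

section mi
variable {d : ℕ} {U : Euc d → ℝ} {m L Lt t δ G0 W : ℝ} {Γ : Measure (Euc d × Euc d)} {j : ℕ}
  {Ω : Type} [MeasurableSpace Ω] {P : Measure Ω} {D : Ω → Euc d × Euc d} {x s a : Ω → Euc d}

lemma MInv.lxr (h : MInv U L Lt t δ G0 W Γ j P D x s a) :
    (P.prod (malaNoise d)).map (fun q => (x q.1, q.2)) = (gibbs U).prod (malaNoise d) := by
  have := h.prob
  have hx := h.mx
  have e := Measure.map_prod_map P (malaNoise d) hx measurable_id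
  rw [h.lx, Measure.map_id] at e
  rw [e]; rfl

lemma MInv.rej (h : MInv U L Lt t δ G0 W Γ j P D x s a)
    (hR : L2le ((gibbs U).prod (malaNoise d)) (fun p => malaT U t p.1 p.2 - malaY U t p.1 p.2.1) δ) :
    L2le (P.prod (malaNoise d)) (fun q => malaT U t (x q.1) q.2 - malaY U t (x q.1) q.2.1) δ := by
  rw [← h.lxr] at hR
  exact L2le.comp (T := fun q : Ω × (Euc d × ℝ) => (x q.1, q.2))
    (f := fun p : Euc d × (Euc d × ℝ) => malaT U t p.1 p.2 - malaY U t p.1 p.2.1)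
    ((h.mx.comp measurable_fst).prodMk measurable_snd) hR

lemma MInv.step_i4 (h : MInv U L Lt t δ G0 W Γ j P D x s a)
    (hR : L2le ((gibbs U).prod (malaNoise d)) (fun p => malaT U t p.1 p.2 - malaY U t p.1 p.2.1) δ) :
    L2le (P.prod (malaNoise d)) (fun q => malaT U t (x q.1) q.2 - (D q.1).1 + (t ^ 2) • (a q.1 + gradient U (x q.1))
      - (Real.sqrt 2 * t) • (s q.1 + q.2.1)) ((j + 1 : ℕ) * δ) := by
  have := h.prob
  have h1 := (h.i4.lift_fst (N := malaNoise d)).add (h.rej hR)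
  have e : (fun q : Ω × (Euc d × ℝ) => malaT U t (x q.1) q.2 - (D q.1).1 + (t ^ 2) • (a q.1 + gradient U (x q.1))
      - (Real.sqrt 2 * t) • (s q.1 + q.2.1)) = fun q =>
      (x q.1 - (D q.1).1 + (t ^ 2) • a q.1 - (Real.sqrt 2 * t) • s q.1) +
        (malaT U t (x q.1) q.2 - malaY U t (x q.1) q.2.1) := by
    funext q
    simp only [malaY, smul_add]; abel
  rw [e]
  have e2 : ((j + 1 : ℕ) : ℝ) * δ = j * δ + δ := by push_cast; ring
  rw [e2]; exact h1

lemma MInv.step_i6 (h : MInv U L Lt t δ G0 W Γ j P D x s a) [IsProbabilityMeasure Γ] (hU : StrongAssumption U m L)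
    (ht : 0 ≤ t) :
    L2le P (fun ω => a ω + gradient U (x ω) - ((j + 1 : ℕ) : ℝ) • gradient U (D ω).1)
      (L * ∑ i ∈ Finset.range (j + 1), tauS d t δ (L * G0) i) := by
  have h1 := h.i6.add (h.gdisp hU ht)
  have e : (fun ω => a ω + gradient U (x ω) - ((j + 1 : ℕ) : ℝ) • gradient U (D ω).1) = fun ω =>
      (a ω - (j : ℝ) • gradient U (D ω).1) + (gradient U (x ω) - gradient U (D ω).1) := by
    funext ω
    push_cast
    rw [add_smul, one_smul]; abel
  rw [e, Finset.sum_range_succ, mul_add]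
  exact h1

lemma MInv.step_i8 (h : MInv U L Lt t δ G0 W Γ j P D x s a) [IsProbabilityMeasure Γ] (hU : StrongAssumption U m L)
    (ht : 0 ≤ t) (hΓ : L2le Γ (fun p => p.1 - p.2) W) :
    |∫ ω, ⟪(D ω).1 - (D ω).2, a ω + gradient U (x ω) - ((j + 1 : ℕ) : ℝ) • gradient U (D ω).1⟫ ∂P| ≤
    (∑ i ∈ Finset.range (j + 1), (i : ℝ)) * ((t ^ 2 * (L ^ 2 * G0 + d * Lt) + L * δ) * W) := by
  have hD := h.D_L2 hΓ
  have i1 := L2le.inner_integrable hD h.i6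
  have i2 := L2le.inner_integrable hD (h.gdisp hU ht)
  have e : ∀ ω, ⟪(D ω).1 - (D ω).2, a ω + gradient U (x ω) - ((j + 1 : ℕ) : ℝ) • gradient U (D ω).1⟫ =
      ⟪(D ω).1 - (D ω).2, a ω - (j : ℝ) • gradient U (D ω).1⟫ +
      ⟪(D ω).1 - (D ω).2, gradient U (x ω) - gradient U (D ω).1⟫ := by
    intro ω
    rw [← inner_add_right]; congr 1
    push_cast
    rw [add_smul, one_smul]; abel
  simp only [e]
  rw [integral_add i1 i2, Finset.sum_range_succ, add_mul]
  exact (abs_add_le _ _).trans (add_le_add h.i8 h.i7)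

set_option maxHeartbeats 400000 in
lemma MInv.step_i7 (h : MInv U L Lt t δ G0 W Γ j P D x s a) [IsProbabilityMeasure Γ] (hU : StrongAssumption U m L)
    (hU3 : ThirdDerivBounded U Lt)
    (ht : 0 ≤ t) (hΓ : L2le Γ (fun p => p.1 - p.2) W) (hG : L2le (gibbs U) (fun x => x) G0)
    (hR : L2le ((gibbs U).prod (malaNoise d)) (fun p => malaT U t p.1 p.2 - malaY U t p.1 p.2.1) δ) :
    |∫ q, ⟪(D q.1).1 - (D q.1).2, gradient U (malaT U t (x q.1) q.2) - gradient U (D q.1).1⟫ ∂(P.prod (malaNoise d))| ≤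
    ((j + 1 : ℕ) : ℝ) * ((t ^ 2 * (L ^ 2 * G0 + d * Lt) + L * δ) * W) := by
  have := h.prob
  have hL : 0 ≤ L := hU.2.1.le.trans hU.2.2.1
  have hLt := Lt_nonneg hU3
  have hD := h.D_L2 hΓ
  have hDQ := hD.lift_fst (N := malaNoise d)
  have gm := (grad_cont hU).measurable
  have hxq : Measurable (fun q : Ω × (Euc d × ℝ) => x q.1) := h.mx.comp measurable_fst
  have mT : Measurable (fun q : Ω × (Euc d × ℝ) => malaT U t (x q.1) q.2) :=
    (malaT_meas hU t).comp (hxq.prodMk measurable_snd)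
  have mY : Measurable (fun q : Ω × (Euc d × ℝ) => malaY U t (x q.1) q.2.1) :=
    (malaY_cont hU t).measurable.comp (hxq.prodMk measurable_snd.fst)
  have g1 : L2le (P.prod (malaNoise d)) (fun q => gradient U (malaT U t (x q.1) q.2) - gradient U (malaY U t (x q.1) q.2.1)) (L * δ) :=
    L2le.dom hL ((gm.comp mT).sub (gm.comp mY)).aestronglyMeasurable (h.rej hR) (fun _ => grad_lip hU _ _)
  have hz : L2le (malaNoise d) (fun r => r.1) (Real.sqrt d) := by
    have := gau_L2 d
    rw [← malaNoise_fst] at this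
    exact L2le.comp (T := Prod.fst) (f := fun z : Euc d => z) measurable_fst this
  have hYx : L2le (P.prod (malaNoise d)) (fun q => malaY U t (x q.1) q.2.1 - x q.1)
      (|Real.sqrt 2 * t| * Real.sqrt d + |t ^ 2| * (L * G0)) := by
    have h1 := ((hz.lift_snd (P := P)).smul (Real.sqrt 2 * t)).sub (((h.gx hU hG).lift_fst (N := malaNoise d)).smul (t ^ 2))
    have e : (fun q : Ω × (Euc d × ℝ) => malaY U t (x q.1) q.2.1 - x q.1) =
        fun q => (Real.sqrt 2 * t) • q.2.1 - (t ^ 2) • gradient U (x q.1) := by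
      funext q; simp only [malaY]; abel
    rw [e]; exact h1
  have g2 : L2le (P.prod (malaNoise d)) (fun q => gradient U (malaY U t (x q.1) q.2.1) - gradient U (x q.1)) 
      (L * (|Real.sqrt 2 * t| * Real.sqrt d + |t ^ 2| * (L * G0))) :=
    L2le.dom hL ((gm.comp mY).sub (gm.comp hxq)).aestronglyMeasurable hYx (fun _ => grad_lip hU _ _)
  have g3 := (h.gdisp hU ht).lift_fst (N := malaNoise d)
  have i1 := L2le.inner_integrable hDQ g1
  have i2 := L2le.inner_integrable hDQ g2
  have i3 := L2le.inner_integrable hDQ g3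
  have e : ∀ q : Ω × (Euc d × ℝ), ⟪(D q.1).1 - (D q.1).2, gradient U (malaT U t (x q.1) q.2) - gradient U (D q.1).1⟫ =
      ⟪(D q.1).1 - (D q.1).2, gradient U (malaT U t (x q.1) q.2) - gradient U (malaY U t (x q.1) q.2.1)⟫ +
      ⟪(D q.1).1 - (D q.1).2, gradient U (malaY U t (x q.1) q.2.1) - gradient U (x q.1)⟫ +
      ⟪(D q.1).1 - (D q.1).2, gradient U (x q.1) - gradient U (D q.1).1⟫ := by
    intro q
    rw [← inner_add_right, ← inner_add_right]; congr 1
    abel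
  have i12 : Integrable (fun q : Ω × (Euc d × ℝ) =>
      ⟪(D q.1).1 - (D q.1).2, gradient U (malaT U t (x q.1) q.2) - gradient U (malaY U t (x q.1) q.2.1)⟫ +
      ⟪(D q.1).1 - (D q.1).2, gradient U (malaY U t (x q.1) q.2.1) - gradient U (x q.1)⟫) (P.prod (malaNoise d)) := i1.add i2
  simp only [e]
  rw [integral_add i12 i3, integral_add i1 i2]
  have b1 := L2le.inner_le hDQ g1
  have b2 : |∫ q, ⟪(D q.1).1 - (D q.1).2, gradient U (malaY U t (x q.1) q.2.1) - gradient U (x q.1)⟫ ∂(P.prod (malaNoise d))|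
      ≤ W * (t ^ 2 * L ^ 2 * G0 + t ^ 2 * (d * Lt)) :=
    cond_bound i2 hD (h.x_L2 hG) (by positivity) (by positivity) (fun ω => mala_drift hU hU3 t (x ω) ((D ω).1 - (D ω).2))
  have b3 : |∫ q, ⟪(D q.1).1 - (D q.1).2, gradient U (x q.1) - gradient U (D q.1).1⟫ ∂(P.prod (malaNoise d))| ≤
      j * ((t ^ 2 * (L ^ 2 * G0 + d * Lt) + L * δ) * W) := by
    have := integral_fun_fst (μ := P) (ν := malaNoise d)
      (fun ω => ⟪(D ω).1 - (D ω).2, gradient U (x ω) - gradient U (D ω).1⟫)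
    rw [this, probReal_univ, one_smul]
    exact h.i7
  refine (abs_add_three _ _ _).trans ((add_le_add (add_le_add b1 b2) b3).trans (le_of_eq ?_))
  push_cast; ring

lemma MInv.step (h : MInv U L Lt t δ G0 W Γ j P D x s a) [IsProbabilityMeasure Γ] (hU : StrongAssumption U m L)
    (hU3 : ThirdDerivBounded U Lt)
    (ht : 0 < t) (hΓ : L2le Γ (fun p => p.1 - p.2) W) (hG : L2le (gibbs U) (fun x => x) G0)
    (hR : L2le ((gibbs U).prod (malaNoise d)) (fun p => malaT U t p.1 p.2 - malaY U t p.1 p.2.1) δ) :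
    MInv U L Lt t δ G0 W Γ (j + 1) (P.prod (malaNoise d)) (fun q => D q.1) (fun q => malaT U t (x q.1) q.2)
      (fun q => s q.1 + q.2.1) (fun q => a q.1 + gradient U (x q.1)) := by
  have := h.prob
  have gm := (grad_cont hU).measurable
  have hxq : Measurable (fun q : Ω × (Euc d × ℝ) => x q.1) := h.mx.comp measurable_fst
  have mT : Measurable (fun q : Ω × (Euc d × ℝ) => malaT U t (x q.1) q.2) :=
    (malaT_meas hU t).comp (hxq.prodMk measurable_snd)
  refine ⟨inferInstance, h.mD.comp measurable_fst, mT, (h.ms.comp measurable_fst).add measurable_snd.fst,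
    (h.ma.comp measurable_fst).add (gm.comp hxq), ?_, ?_, h.step_i4 hR, ?_, ?_, ?_, ?_⟩
  · have e := mala_inv hU ht
    rw [← h.lxr, Measure.map_map (malaT_meas hU t) (hxq.prodMk measurable_snd)] at e
    exact e
  · have := gauj_prob d j
    rw [step_ls d P (malaNoise d) Γ _ (_root_.stdGaussian d) D h.mD s h.ms Prod.fst measurable_fst h.ls (malaNoise_fst d), gau_conv]
  · have h1 := (h.i5.add (h.gx hU hG)).lift_fst (N := malaNoise d)
    have e : ((j + 1 : ℕ) : ℝ) * (L * G0) = j * (L * G0) + L * G0 := by push_cast; ring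
    rw [e]; exact h1
  · exact (h.step_i6 hU ht.le).lift_fst
  · exact h.step_i7 hU hU3 ht.le hΓ hG hR
  · have := integral_fun_fst (μ := P) (ν := malaNoise d)
      (fun ω => ⟪(D ω).1 - (D ω).2, a ω + gradient U (x ω) - ((j + 1 : ℕ) : ℝ) • gradient U (D ω).1⟫)
    rw [this, probReal_univ, one_smul]
    exact h.step_i8 hU ht.le hΓ

end mi

lemma minv_exists {d : ℕ} {U : Euc d → ℝ} {m L Lt t δ G0 W : ℝ} {Γ : Measure (Euc d × Euc d)}
    [IsProbabilityMeasure Γ] (hΓ1 : Γ.map Prod.fst = gibbs U) (hU : StrongAssumption U m L)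
    (hU3 : ThirdDerivBounded U Lt)
    (ht : 0 < t) (hΓ : L2le Γ (fun p => p.1 - p.2) W) (hG : L2le (gibbs U) (fun x => x) G0)
    (hR : L2le ((gibbs U).prod (malaNoise d)) (fun p => malaT U t p.1 p.2 - malaY U t p.1 p.2.1) δ) (j : ℕ) :
    ∃ (Ω : Type) (_ : MeasurableSpace Ω) (P : Measure Ω) (D : Ω → Euc d × Euc d) (x s a : Ω → Euc d),
      MInv U L Lt t δ G0 W Γ j P D x s a := by
  induction j with
  | zero => exact ⟨_, _, _, _, _, _, _, MInv.zero hΓ1⟩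
  | succ j ih =>
    obtain ⟨Ω, _, P, D, x, s, a, h⟩ := ih
    exact ⟨_, _, _, _, _, _, _, h.step hU hU3 ht hΓ hG hR⟩

/-! ### One large step of the coupling -/

lemma cond_L2 {Ω R E : Type*} [MeasurableSpace Ω] [MeasurableSpace R]
    [NormedAddCommGroup E] [InnerProductSpace ℝ E]
    {P : Measure Ω} {N : Measure R} [IsProbabilityMeasure P] [IsProbabilityMeasure N]
    {f : Ω × R → E} {X : Ω → E} {G α β : ℝ} (hf : AEStronglyMeasurable f (P.prod N)) (hX : L2le P X G) (hα : 0 ≤ α) (hβ : 0 ≤ β)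
    (h : ∀ ω, ∫⁻ r, ‖f (ω, r)‖ₑ ^ 2 ∂N ≤ ENNReal.ofReal (α * ‖X ω‖ ^ 2 + β)) :
    L2le (P.prod N) f (Real.sqrt (α * G ^ 2 + β)) := by
  refine L2le.of_lintegral hf (Real.sqrt_nonneg _) ?_
  rw [lintegral_prod _ (hf.enorm.pow_const 2), Real.sq_sqrt (by positivity)]
  refine (lintegral_mono h).trans ?_
  have i : Integrable (fun ω => α * ‖X ω‖ ^ 2 + β) P := (hX.integrable_sq.const_mul α).add (integrable_const _)
  rw [← ofReal_integral_eq_lintegral_ofReal i (ae_of_all _ fun ω => by positivity)]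
  refine ENNReal.ofReal_le_ofReal ?_
  rw [integral_add (hX.integrable_sq.const_mul α) (integrable_const _), integral_const_mul, integral_const]
  simp only [probReal_univ, one_smul]
  have := hX.integral_le
  gcongr

lemma rearr {Ω A B C F : Type*} [MeasurableSpace Ω] [MeasurableSpace A] [MeasurableSpace B] [MeasurableSpace C]
    [MeasurableSpace F] (P : Measure Ω) [IsProbabilityMeasure P] (Γ : Measure A) [IsProbabilityMeasure Γ]
    (β : Measure B) [IsProbabilityMeasure β] (γ : Measure C) [IsProbabilityMeasure γ] (g : Measure F)
    [IsProbabilityMeasure g] (D : Ω → A) (hD : Measurable D) (s : Ω → F) (hs : Measurable s)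
    (h : P.map (fun ω => (D ω, s ω)) = Γ.prod g) :
    (P.prod (β.prod γ)).map (fun q => (D q.1, (q.2.1, (q.2.2, s q.1)))) = Γ.prod (β.prod (γ.prod g)) := by
  have h1 : MeasurePreserving (fun ω => (D ω, s ω)) P (Γ.prod g) := ⟨hD.prodMk hs, h⟩
  have h2 := h1.prod (MeasurePreserving.id (β.prod γ))
  have h3 := (measurePreserving_prodAssoc Γ g (β.prod γ)).comp h2
  have h4 := ((MeasurePreserving.id Γ).prod (Measure.measurePreserving_swap (μ := g) (ν := β.prod γ))).comp h3
  have h5 := ((MeasurePreserving.id Γ).prod (measurePreserving_prodAssoc β γ g)).comp h4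
  exact h5.map_eq

lemma mcomp {A B R E : Type*} [MeasurableSpace A] [MeasurableSpace B] [MeasurableSpace R] [MeasurableSpace E]
    {f : A → R → E} (h : Measurable (fun p : A × R => f p.1 p.2)) {g : B → A} (hg : Measurable g) :
    Measurable (fun p : B × R => f (g p.1) p.2) := h.comp ((hg.comp measurable_fst).prodMk measurable_snd)

section mstep
variable {d K : ℕ} {U : Euc d → ℝ} {m L Lt η t δ G0 W : ℝ} {Γ : Measure (Euc d × Euc d)}

lemma lam_E (hK : 1 ≤ K) (hU : StrongAssumption U m L) (hη : 0 ≤ η) [IsProbabilityMeasure Γ]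
    (hG : L2le Γ (fun p => p.1) G0) :
    L2le (Γ.prod (prlmcNoise d K)) (fun p => pE U η K p.1.1 p.2)
      (Real.sqrt (η ^ 2 * (2 - (K : ℝ)⁻¹) * L ^ 2 * (η * d * (1 - (K : ℝ)⁻¹) + η ^ 2 * L ^ 2 * G0 ^ 2))) := by
  have := noise_prob d hK
  have hK1 : (K : ℝ)⁻¹ ≤ 1 := inv_le_one_of_one_le₀ (by exact_mod_cast hK)
  have h2 : 0 ≤ 2 - (K : ℝ)⁻¹ := by linarith
  have h1 : 0 ≤ 1 - (K : ℝ)⁻¹ := by linarith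
  have hc := pE_cont (K := K) (η := η) hU
  have hm : Measurable (fun p : (Euc d × Euc d) × ((Fin K → ℝ) × (Fin K → Euc d) × Euc d) => pE U η K p.1.1 p.2) :=
    mcomp (f := fun x r => pE U η K x r) hc.measurable measurable_fst
  have hN : ∀ p : Euc d × Euc d, ∫⁻ r, ‖pE U η K p.1 r‖ₑ ^ 2 ∂(prlmcNoise d K) ≤ ENNReal.ofReal
      (η ^ 2 * (2 - (K : ℝ)⁻¹) * L ^ 2 * (η ^ 2 * L ^ 2) * ‖p.1‖ ^ 2 +
        η ^ 2 * (2 - (K : ℝ)⁻¹) * L ^ 2 * (η * d * (1 - (K : ℝ)⁻¹))) := fun p =>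
    (noise_N3 hK hU hη p.1).trans (ENNReal.ofReal_le_ofReal (le_of_eq (by ring)))
  have := cond_L2 (P := Γ) (N := prlmcNoise d K) (f := fun p : (Euc d × Euc d) × ((Fin K → ℝ) × (Fin K → Euc d) × Euc d) => pE U η K p.1.1 p.2)
    (X := fun p : Euc d × Euc d => p.1) (α := η ^ 2 * (2 - (K : ℝ)⁻¹) * L ^ 2 * (η ^ 2 * L ^ 2))
    (β := η ^ 2 * (2 - (K : ℝ)⁻¹) * L ^ 2 * (η * d * (1 - (K : ℝ)⁻¹))) hm.aestronglyMeasurable hG (by positivity) (by positivity)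
    hN
  refine this.mono (le_of_eq ?_)
  congr 1; ring

lemma lam_P (hK : 1 ≤ K) (hU : StrongAssumption U m L) (hη : 0 ≤ η) (hL : η * L ≤ 1) [IsProbabilityMeasure Γ]
    (hρ : 0 ≤ 1 - 2 * m * η + 33 * η ^ 2 * L ^ 2) (hD : L2le Γ (fun p => p.1 - p.2) W) :
    L2le (Γ.prod (prlmcNoise d K)) (fun p => pS U η K p.1.1 p.2 - pS U η K p.1.2 p.2)
      (Real.sqrt ((1 - 2 * m * η + 33 * η ^ 2 * L ^ 2) * W ^ 2)) := by
  have := noise_prob d hK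
  have hc := pS_cont (K := K) (η := η) hU
  have hm1 : Measurable (fun p : (Euc d × Euc d) × ((Fin K → ℝ) × (Fin K → Euc d) × Euc d) => pS U η K p.1.1 p.2) :=
    mcomp (f := fun x r => pS U η K x r) hc.measurable measurable_fst
  have hm2 : Measurable (fun p : (Euc d × Euc d) × ((Fin K → ℝ) × (Fin K → Euc d) × Euc d) => pS U η K p.1.2 p.2) :=
    mcomp (f := fun x r => pS U η K x r) hc.measurable measurable_snd
  have hN : ∀ p : Euc d × Euc d, ∫⁻ r, ‖pS U η K p.1 r - pS U η K p.2 r‖ₑ ^ 2 ∂(prlmcNoise d K) ≤ ENNReal.ofReal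
      ((1 - 2 * m * η + 33 * η ^ 2 * L ^ 2) * ‖p.1 - p.2‖ ^ 2 + 0) := fun p =>
    (noise_N1 hK hU hη hL p.1 p.2).trans (ENNReal.ofReal_le_ofReal (le_of_eq (by ring)))
  have := cond_L2 (P := Γ) (N := prlmcNoise d K) (f := fun p : (Euc d × Euc d) × ((Fin K → ℝ) × (Fin K → Euc d) × Euc d) => pS U η K p.1.1 p.2 - pS U η K p.1.2 p.2)
    (X := fun p : Euc d × Euc d => p.1 - p.2) (α := 1 - 2 * m * η + 33 * η ^ 2 * L ^ 2) (β := 0)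
    (hm1.sub hm2).aestronglyMeasurable hD hρ le_rfl hN
  rwa [add_zero] at this

lemma lam_DP (hK : 1 ≤ K) (hU : StrongAssumption U m L) (hη : 0 ≤ η) (hL : η * L ≤ 1) [IsProbabilityMeasure Γ]
    (hD : L2le Γ (fun p => p.1 - p.2) W) :
    L2le (Γ.prod (prlmcNoise d K)) (fun p => (p.1.1 - p.1.2) - (pS U η K p.1.1 p.2 - pS U η K p.1.2 p.2))
      (5 * η * L * W) := by
  have := noise_prob d hK
  have hL0 : 0 ≤ L := hU.2.1.le.trans hU.2.2.1
  have hW := hD.nonneg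
  have hc := pS_cont (K := K) (η := η) hU
  have hm1 : Measurable (fun p : (Euc d × Euc d) × ((Fin K → ℝ) × (Fin K → Euc d) × Euc d) => pS U η K p.1.1 p.2) :=
    mcomp (f := fun x r => pS U η K x r) hc.measurable measurable_fst
  have hm2 : Measurable (fun p : (Euc d × Euc d) × ((Fin K → ℝ) × (Fin K → Euc d) × Euc d) => pS U η K p.1.2 p.2) :=
    mcomp (f := fun x r => pS U η K x r) hc.measurable measurable_snd
  have hN : ∀ p : Euc d × Euc d, ∫⁻ r, ‖(p.1 - p.2) - (pS U η K p.1 r - pS U η K p.2 r)‖ₑ ^ 2 ∂(prlmcNoise d K) ≤ ENNReal.ofReal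
      (25 * η ^ 2 * L ^ 2 * ‖p.1 - p.2‖ ^ 2 + 0) := fun p =>
    (noise_N2 hK hU hη hL p.1 p.2).trans (ENNReal.ofReal_le_ofReal (le_of_eq (by ring)))
  have hm3 : Measurable (fun p : (Euc d × Euc d) × ((Fin K → ℝ) × (Fin K → Euc d) × Euc d) => (p.1.1 - p.1.2) - (pS U η K p.1.1 p.2 - pS U η K p.1.2 p.2)) :=
    (measurable_fst.fst.sub measurable_fst.snd).sub (hm1.sub hm2)
  have := cond_L2 (P := Γ) (N := prlmcNoise d K) (f := fun p : (Euc d × Euc d) × ((Fin K → ℝ) × (Fin K → Euc d) × Euc d) => (p.1.1 - p.1.2) - (pS U η K p.1.1 p.2 - pS U η K p.1.2 p.2))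
    (X := fun p : Euc d × Euc d => p.1 - p.2) (α := 25 * η ^ 2 * L ^ 2) (β := 0)
    hm3.aestronglyMeasurable hD (by positivity) le_rfl hN
  refine this.mono (le_of_eq ?_)
  rw [show 25 * η ^ 2 * L ^ 2 * W ^ 2 + 0 = (5 * η * L * W) ^ 2 by ring, Real.sqrt_sq (by positivity)]

lemma lam_DE (hK : 1 ≤ K) (hU : StrongAssumption U m L) (hU3 : ThirdDerivBounded U Lt) (hη : 0 ≤ η) [IsProbabilityMeasure Γ]
    (hD : L2le Γ (fun p => p.1 - p.2) W) (hG : L2le Γ (fun p => p.1) G0) :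
    |∫ p, ⟪p.1.1 - p.1.2, pE U η K p.1.1 p.2⟫ ∂(Γ.prod (prlmcNoise d K))| ≤ W * (η ^ 2 / 2 * (L ^ 2 * G0 + d * Lt)) := by
  have := noise_prob d hK
  have hLt := Lt_nonneg hU3
  have i := L2le.inner_integrable (hD.lift_fst (N := prlmcNoise d K)) (lam_E hK hU hη hG)
  have hN : ∀ p : Euc d × Euc d, |∫ r, ⟪p.1 - p.2, pE U η K p.1 r⟫ ∂(prlmcNoise d K)| ≤
      ‖p.1 - p.2‖ * (η ^ 2 / 2 * L ^ 2 * ‖p.1‖ + η ^ 2 / 2 * (d * Lt)) := fun p =>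
    (noise_N4 hK hU hU3 hη p.1 (p.1 - p.2)).trans (le_of_eq (by ring))
  have := cond_bound (P := Γ) (N := prlmcNoise d K) (F := fun p : (Euc d × Euc d) × ((Fin K → ℝ) × (Fin K → Euc d) × Euc d) => ⟪p.1.1 - p.1.2, pE U η K p.1.1 p.2⟫)
    (D := fun p : Euc d × Euc d => p.1 - p.2) (X := fun p : Euc d × Euc d => p.1)
    (α := η ^ 2 / 2 * L ^ 2) (β := η ^ 2 / 2 * (d * Lt)) i hD hG (by positivity) (by positivity) hN
  refine this.trans (le_of_eq (by ring))

lemma sum_id_le (N : ℕ) : ∑ i ∈ Finset.range N, (i : ℝ) ≤ N ^ 2 / 2 := by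
  induction N with
  | zero => simp
  | succ n ih => rw [Finset.sum_range_succ]; push_cast; nlinarith

lemma sum_sqrt_le (N : ℕ) : Real.sqrt 2 * ∑ i ∈ Finset.range N, Real.sqrt i ≤ N * Real.sqrt N := by
  have h1 : (∑ i ∈ Finset.range N, Real.sqrt i) ^ 2 ≤ N * ∑ i ∈ Finset.range N, (i : ℝ) := by
    have := sq_sum_le_card_mul_sum_sq (s := Finset.range N) (f := fun i : ℕ => Real.sqrt i)
    simpa [Real.sq_sqrt] using this
  have h2 := sum_id_le N
  refine (pow_le_pow_iff_left₀ (by positivity) (by positivity) two_ne_zero).1 ?_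
  rw [mul_pow, mul_pow, Real.sq_sqrt (by norm_num), Real.sq_sqrt (by positivity)]
  have : (N : ℝ) * ∑ i ∈ Finset.range N, (i : ℝ) ≤ N * (N ^ 2 / 2) := by gcongr
  nlinarith

lemma tau_sum_le (hL : 0 ≤ L) (ht : 0 ≤ t) (hδ : 0 ≤ δ) (hG : 0 ≤ G0) (N : ℕ) (hη : t ^ 2 * N = η) :
    t ^ 2 * (L * ∑ i ∈ Finset.range N, tauS d t δ (L * G0) i) ≤
      L * Real.sqrt d * (η * Real.sqrt η) + η ^ 2 * L ^ 2 * G0 / 2 + N * δ * (η * L / 2) := by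
  have e : ∑ i ∈ Finset.range N, tauS d t δ (L * G0) i =
      (∑ i ∈ Finset.range N, (i : ℝ)) * (δ + t ^ 2 * (L * G0)) +
        (Real.sqrt 2 * ∑ i ∈ Finset.range N, Real.sqrt i) * (t * Real.sqrt d) := by
    simp only [tauS, Finset.sum_mul, Finset.mul_sum, ← Finset.sum_add_distrib]
    exact Finset.sum_congr rfl fun i _ => by ring
  have h1 := sum_id_le N
  have h2 := sum_sqrt_le N
  have hs : Real.sqrt η = t * Real.sqrt N := by
    rw [← hη, Real.sqrt_mul (sq_nonneg t), Real.sqrt_sq ht]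
  rw [e]
  calc _ ≤ t ^ 2 * (L * ((N ^ 2 / 2) * (δ + t ^ 2 * (L * G0)) + (N * Real.sqrt N) * (t * Real.sqrt d))) := by gcongr
    _ = _ := by rw [hs, ← hη]; ring

end mstep

lemma final_alg {Ω E : Type*} [MeasurableSpace Ω] [NormedAddCommGroup E] [InnerProductSpace ℝ E]
    {Q : Measure Ω} {D V A F R : Ω → E} {W ρ p a B r c α1 α2 : ℝ}
    (hD : L2le Q D W) (hρ : 0 ≤ ρ) (hV : L2le Q V (Real.sqrt ρ)) (hDV : L2le Q (fun ω => D ω - V ω) p)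
    (hA : L2le Q A a) (hB : 0 ≤ B) (hF : L2le Q F (Real.sqrt B)) (hR : L2le Q R r) (hc : 0 ≤ c)
    (h1 : |∫ ω, ⟪D ω, A ω⟫ ∂Q| ≤ α1) (h2 : |∫ ω, ⟪D ω, F ω⟫ ∂Q| ≤ α2) :
    ∫⁻ ω, ‖V ω + (F ω - c • A ω + R ω)‖ₑ ^ 2 ∂Q ≤
      ENNReal.ofReal (ρ + 2 * (c * α1 + α2 + W * r) + 4 * p ^ 2 + 5 / 4 * (2 * (c * a + r) ^ 2 + 2 * B)) := by
  have hcA : L2le Q (fun ω => c • A ω) (c * a) := by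
    have := hA.smul c; rwa [abs_of_nonneg hc] at this
  have he : L2le Q (fun ω => F ω - c • A ω + R ω) (Real.sqrt B + c * a + r) := (hF.sub hcA).add hR
  have hS : L2le Q (fun ω => V ω + (F ω - c • A ω + R ω)) (Real.sqrt ρ + (Real.sqrt B + c * a + r)) := hV.add he
  rw [L2le.lint_int hS.memLp]
  refine ENNReal.ofReal_le_ofReal ?_
  have e : ∀ ω, ‖V ω + (F ω - c • A ω + R ω)‖ ^ 2 = ‖V ω‖ ^ 2 + 2 * (⟪D ω, F ω⟫ - c * ⟪D ω, A ω⟫ + ⟪D ω, R ω⟫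
      - ⟪D ω - V ω, F ω - c • A ω + R ω⟫) + ‖F ω - c • A ω + R ω‖ ^ 2 := by
    intro ω
    rw [norm_add_sq_real, inner_sub_left (D ω) (V ω), inner_add_right (D ω), inner_sub_right (D ω), inner_smul_right]
    ring
  have iV := hV.integrable_sq
  have ie := he.integrable_sq
  have iF := L2le.inner_integrable hD hF
  have iA := L2le.inner_integrable hD hA
  have iR := L2le.inner_integrable hD hR
  have iX := L2le.inner_integrable hDV he
  have i1 : Integrable (fun ω => ⟪D ω, F ω⟫ - c * ⟪D ω, A ω⟫) Q := iF.sub (iA.const_mul c)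
  have i2 : Integrable (fun ω => ⟪D ω, F ω⟫ - c * ⟪D ω, A ω⟫ + ⟪D ω, R ω⟫) Q := i1.add iR
  have i3 : Integrable (fun ω => ⟪D ω, F ω⟫ - c * ⟪D ω, A ω⟫ + ⟪D ω, R ω⟫
      - ⟪D ω - V ω, F ω - c • A ω + R ω⟫) Q := i2.sub iX
  have i4 : Integrable (fun ω => ‖V ω‖ ^ 2 + 2 * (⟪D ω, F ω⟫ - c * ⟪D ω, A ω⟫ + ⟪D ω, R ω⟫
      - ⟪D ω - V ω, F ω - c • A ω + R ω⟫)) Q := iV.add (i3.const_mul 2)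
  simp only [e]
  rw [integral_add i4 ie, integral_add iV (i3.const_mul 2), integral_const_mul, integral_sub i2 iX, integral_add i1 iR,
    integral_sub iF (iA.const_mul c), integral_const_mul]
  have bV := hV.integral_le
  rw [Real.sq_sqrt hρ] at bV
  have be := he.integral_le
  have bR := (abs_le.1 (L2le.inner_le hD hR)).2
  have bX := (abs_le.1 (L2le.inner_le hDV he)).1
  have b1 := (abs_le.1 h1).1
  have b2 := (abs_le.1 h2).2
  have b1' : -(c * ∫ ω, ⟪D ω, A ω⟫ ∂Q) ≤ c * α1 := by nlinarith
  set s := Real.sqrt B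
  have hs : s ^ 2 = B := Real.sq_sqrt hB
  set k := c * a + r
  have ek : s + c * a + r = s + k := by simp only [k]; ring
  rw [ek] at be bX
  nlinarith [sq_nonneg (s - k), sq_nonneg (2 * p - (s + k) / 2)]

section cs
variable {d K : ℕ} {U : Euc d → ℝ} {m L Lt η t δ G0 W : ℝ} {Γ : Measure (Euc d × Euc d)} {ν : Measure (Euc d)}
  {Ω : Type} [MeasurableSpace Ω] {P : Measure Ω} {D : Ω → Euc d × Euc d} {x s a : Ω → Euc d} {N : ℕ}

lemma MInv.law (h : MInv U L Lt t δ G0 W Γ N P D x s a) [IsProbabilityMeasure Γ] (hK : 1 ≤ K) (hN : 1 ≤ N) :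
    (P.prod ((piB K).prod (piG d K))).map (fun q => (D q.1, (q.2.1, (q.2.2, (Real.sqrt N)⁻¹ • s q.1)))) =
      Γ.prod (prlmcNoise d K) := by
  have := piB_prob hK
  have := h.prob
  have := gauj_prob d N
  have hs : Measurable (fun ω => (Real.sqrt N)⁻¹ • s ω) := (measurable_const_smul (Real.sqrt N)⁻¹).comp h.ms
  rw [noise_eq]
  refine rearr P Γ (piB K) (piG d K) (_root_.stdGaussian d) D h.mD (fun ω => (Real.sqrt N)⁻¹ • s ω) hs ?_
  have hN0 : Real.sqrt N ≠ 0 := by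
    have : (0 : ℝ) < N := by exact_mod_cast hN
    positivity
  have hsm : Measurable (fun z : Euc d => (Real.sqrt N)⁻¹ • z) := measurable_const_smul _
  have hsm2 : Measurable (fun z : Euc d => (Real.sqrt N) • z) := measurable_const_smul _
  have e := congrArg (fun M => Measure.map (Prod.map id (fun z : Euc d => (Real.sqrt N)⁻¹ • z)) M) h.ls
  beta_reduce at e
  rw [← Measure.map_prod_map _ _ measurable_id hsm, Measure.map_id, Measure.map_map hsm hsm2,
    Measure.map_map (measurable_id.prodMap hsm) (h.mD.prodMk h.ms)] at e
  have e2 : (fun z : Euc d => (Real.sqrt N)⁻¹ • z) ∘ (fun z => Real.sqrt N • z) = id := by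
    funext z; simp [smul_smul, hN0]
  rw [e2, Measure.map_id] at e
  exact e

lemma minv_alg (D : Ω → Euc d × Euc d) (x s a : Ω → Euc d) (ht : 0 ≤ t) (hN : 1 ≤ N) (hη : t ^ 2 * N = η)
    (ω : Ω) (u : Fin K → ℝ) (g : Fin K → Euc d) :
    x ω - pS U η K (D ω).2 (u, (g, (Real.sqrt N)⁻¹ • s ω)) =
      (pS U η K (D ω).1 (u, (g, (Real.sqrt N)⁻¹ • s ω)) - pS U η K (D ω).2 (u, (g, (Real.sqrt N)⁻¹ • s ω))) +
      (pE U η K (D ω).1 (u, (g, (Real.sqrt N)⁻¹ • s ω)) - (t ^ 2) • (a ω - (N : ℝ) • gradient U (D ω).1)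
        + (x ω - (D ω).1 + (t ^ 2) • a ω - (Real.sqrt 2 * t) • s ω)) := by
  have hN0 : Real.sqrt N ≠ 0 := by
    have : (0 : ℝ) < N := by exact_mod_cast hN
    positivity
  have e1 : Real.sqrt (2 * η) • (Real.sqrt N)⁻¹ • s ω = (Real.sqrt 2 * t) • s ω := by
    rw [smul_smul]; congr 1
    rw [← hη, Real.sqrt_mul (by norm_num), Real.sqrt_mul (by positivity), Real.sqrt_sq ht]
    field_simp
  have e2 : (t ^ 2) • (N : ℝ) • gradient U (D ω).1 = η • gradient U (D ω).1 := by rw [smul_smul, hη]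
  rw [pS_eq (D ω).1]
  simp only [e1, smul_sub, e2]
  abel

lemma coupling_step (hK : 1 ≤ K) (hU : StrongAssumption U m L) (hU3 : ThirdDerivBounded U Lt)
    (hηL : η * L ≤ 1) (hρ : 0 ≤ 1 - 2 * m * η + 33 * η ^ 2 * L ^ 2) [IsProbabilityMeasure Γ]
    (hΓ1 : Γ.map Prod.fst = gibbs U) (hΓ2 : Γ.map Prod.snd = ν)
    (hν : pushQ (prlmcNoise d K) (pS U η K) ν = ν)
    (ht : 0 < t) (hN : 1 ≤ N) (hη : t ^ 2 * N = η) (hΓ : L2le Γ (fun p => p.1 - p.2) W)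
    (hG : L2le (gibbs U) (fun x => x) G0)
    (hR : L2le ((gibbs U).prod (malaNoise d)) (fun p => malaT U t p.1 p.2 - malaY U t p.1 p.2.1) δ) :
    ∃ Γ' : Measure (Euc d × Euc d), Γ'.map Prod.fst = gibbs U ∧ Γ'.map Prod.snd = ν ∧
      ∫⁻ p, ‖p.1 - p.2‖ₑ ^ 2 ∂Γ' ≤ ENNReal.ofReal ((1 - 2 * m * η + 33 * η ^ 2 * L ^ 2) * W ^ 2
        + 2 * (W * (η ^ 2 * (L ^ 2 * G0 + d * Lt) + N * δ * (η * L / 2 + 1))) + 4 * (5 * η * L * W) ^ 2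
        + 5 / 4 * (2 * (L * Real.sqrt d * (η * Real.sqrt η) + η ^ 2 * L ^ 2 * G0 / 2 + N * δ * (η * L / 2 + 1)) ^ 2
          + 2 * (η ^ 2 * (2 - (K : ℝ)⁻¹) * L ^ 2 * (η * d * (1 - (K : ℝ)⁻¹) + η ^ 2 * L ^ 2 * G0 ^ 2)))) := by
  obtain ⟨Ω, _, P, D, x, s, a, h⟩ := minv_exists hΓ1 hU hU3 ht hΓ hG hR N
  have := piB_prob hK
  have := h.prob
  have := noise_prob d hK
  have hL0 : 0 ≤ L := hU.2.1.le.trans hU.2.2.1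
  have hLt := Lt_nonneg hU3
  have hη0 : 0 ≤ η := by rw [← hη]; positivity
  have hW := hΓ.nonneg
  have hG0 := hG.nonneg
  have hδ := hR.nonneg
  have hG' : L2le Γ (fun p => p.1) G0 := by
    rw [← hΓ1] at hG
    exact L2le.comp (T := Prod.fst) (f := fun z : Euc d => z) measurable_fst hG
  have hlaw := h.law hK hN
  have hms : Measurable (fun ω => (Real.sqrt N)⁻¹ • s ω) := (measurable_const_smul (Real.sqrt N)⁻¹).comp h.ms
  set Q := P.prod ((piB K).prod (piG d K)) with hQ
  set Ψ : Ω × ((Fin K → ℝ) × (Fin K → Euc d)) → (Euc d × Euc d) × ((Fin K → ℝ) × (Fin K → Euc d) × Euc d) :=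
    fun q => (D q.1, (q.2.1, (q.2.2, (Real.sqrt N)⁻¹ • s q.1))) with hΨ
  have mΨ : Measurable Ψ := (h.mD.comp measurable_fst).prodMk
    (measurable_snd.fst.prodMk (measurable_snd.snd.prodMk (hms.comp measurable_fst)))
  have lE := lam_E hK hU hη0 hG'
  have lP := lam_P hK hU hη0 hηL hρ hΓ
  have lDP := lam_DP hK hU hη0 hηL hΓ
  have lDE := lam_DE hK hU hU3 hη0 hΓ hG'
  have mE : AEStronglyMeasurable (fun p : (Euc d × Euc d) × ((Fin K → ℝ) × (Fin K → Euc d) × Euc d) =>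
      ⟪p.1.1 - p.1.2, pE U η K p.1.1 p.2⟫) (Γ.prod (prlmcNoise d K)) :=
    (L2le.inner_integrable (hΓ.lift_fst (N := prlmcNoise d K)) lE).1
  rw [← hlaw] at lE lP lDP lDE mE
  rw [integral_map mΨ.aemeasurable mE] at lDE
  have qE := L2le.comp (T := Ψ) (f := fun p : (Euc d × Euc d) × ((Fin K → ℝ) × (Fin K → Euc d) × Euc d) =>
    pE U η K p.1.1 p.2) mΨ lE
  have qP := L2le.comp (T := Ψ) (f := fun p : (Euc d × Euc d) × ((Fin K → ℝ) × (Fin K → Euc d) × Euc d) =>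
    pS U η K p.1.1 p.2 - pS U η K p.1.2 p.2) mΨ lP
  have qDP := L2le.comp (T := Ψ) (f := fun p : (Euc d × Euc d) × ((Fin K → ℝ) × (Fin K → Euc d) × Euc d) =>
    (p.1.1 - p.1.2) - (pS U η K p.1.1 p.2 - pS U η K p.1.2 p.2)) mΨ lDP
  have qD := (h.D_L2 hΓ).lift_fst (N := (piB K).prod (piG d K))
  have qA := h.i6.lift_fst (N := (piB K).prod (piG d K))
  have qR := h.i4.lift_fst (N := (piB K).prod (piG d K))
  have qDA : |∫ q, ⟪(D q.1).1 - (D q.1).2, a q.1 - (N : ℝ) • gradient U (D q.1).1⟫ ∂Q| ≤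
      (N ^ 2 / 2) * ((t ^ 2 * (L ^ 2 * G0 + d * Lt) + L * δ) * W) := by
    have e := integral_fun_fst (μ := P) (ν := (piB K).prod (piG d K))
      (fun ω => ⟪(D ω).1 - (D ω).2, a ω - (N : ℝ) • gradient U (D ω).1⟫)
    rw [hQ, e, probReal_univ, one_smul]
    refine h.i8.trans ?_
    have := sum_id_le N
    gcongr
  have hK1 : (K : ℝ)⁻¹ ≤ 1 := inv_le_one_of_one_le₀ (by exact_mod_cast hK)
  have hk2 : 0 ≤ 2 - (K : ℝ)⁻¹ := by linarith
  have hk1 : 0 ≤ 1 - (K : ℝ)⁻¹ := by linarith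
  have fin := final_alg (Q := Q) (D := fun q => (D q.1).1 - (D q.1).2)
    (V := fun q => pS U η K (Ψ q).1.1 (Ψ q).2 - pS U η K (Ψ q).1.2 (Ψ q).2)
    (A := fun q => a q.1 - (N : ℝ) • gradient U (D q.1).1)
    (F := fun q => pE U η K (Ψ q).1.1 (Ψ q).2)
    (R := fun q => x q.1 - (D q.1).1 + (t ^ 2) • a q.1 - (Real.sqrt 2 * t) • s q.1) (c := t ^ 2)
    qD (mul_nonneg hρ (sq_nonneg W)) qP qDP qA (by positivity) qE qR (by positivity) qDA lDE
  have mY : Measurable (fun q => pS U η K (Ψ q).1.2 (Ψ q).2) :=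
    (mcomp (f := fun x r => pS U η K x r) (g := Prod.snd (α := Euc d) (β := Euc d))
      (pS_cont (K := K) (η := η) hU).measurable measurable_snd).comp mΨ
  have mX : Measurable (fun q : Ω × ((Fin K → ℝ) × (Fin K → Euc d)) => x q.1) := h.mx.comp measurable_fst
  refine ⟨Q.map (fun q => (x q.1, pS U η K (Ψ q).1.2 (Ψ q).2)), ?_, ?_, ?_⟩
  · rw [Measure.map_map measurable_fst (mX.prodMk mY)]
    have e1 : Q.map Prod.fst = P := (measurePreserving_fst).map_eq
    have e2 := h.lx
    rw [← e1, Measure.map_map h.mx measurable_fst] at e2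
    exact e2
  · rw [Measure.map_map measurable_snd (mX.prodMk mY)]
    have hmS := (pS_cont (K := K) (η := η) hU).measurable
    have e1 : (Γ.prod (prlmcNoise d K)).map (Prod.map Prod.snd id) = ν.prod (prlmcNoise d K) := by
      rw [← Measure.map_prod_map _ _ measurable_snd measurable_id, hΓ2, Measure.map_id]
    have e2 : (ν.prod (prlmcNoise d K)).map (fun p => pS U η K p.1 p.2) = ν := hν
    rw [← e1, ← hlaw, Measure.map_map (measurable_snd.prodMap measurable_id) mΨ,
      Measure.map_map hmS ((measurable_snd.prodMap measurable_id).comp mΨ)] at e2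
    exact e2
  · have hmeas : Measurable (fun p : Euc d × Euc d => ‖p.1 - p.2‖ₑ ^ 2) :=
      ((measurable_fst.sub measurable_snd).enorm).pow_const 2
    rw [lintegral_map hmeas (mX.prodMk mY)]
    have e : ∀ q : Ω × ((Fin K → ℝ) × (Fin K → Euc d)), x q.1 - pS U η K (Ψ q).1.2 (Ψ q).2 =
        (pS U η K (Ψ q).1.1 (Ψ q).2 - pS U η K (Ψ q).1.2 (Ψ q).2) +
        (pE U η K (Ψ q).1.1 (Ψ q).2 - (t ^ 2) • (a q.1 - (N : ℝ) • gradient U (D q.1).1)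
        + (x q.1 - (D q.1).1 + (t ^ 2) • a q.1 - (Real.sqrt 2 * t) • s q.1)) := fun q =>
      minv_alg D x s a ht.le hN hη q.1 q.2.1 q.2.2
    simp only [e]
    refine fin.trans (ENNReal.ofReal_le_ofReal ?_)
    have hτ := tau_sum_le (d := d) hL0 ht.le hδ hG0 N hη
    have hτ0 : 0 ≤ t ^ 2 * (L * ∑ i ∈ Finset.range N, tauS d t δ (L * G0) i) :=
      mul_nonneg (sq_nonneg t) qA.nonneg
    have hsq : (t ^ 2 * (L * ∑ i ∈ Finset.range N, tauS d t δ (L * G0) i) + N * δ) ^ 2 ≤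
        (L * Real.sqrt d * (η * Real.sqrt η) + η ^ 2 * L ^ 2 * G0 / 2 + N * δ * (η * L / 2 + 1)) ^ 2 := by
      apply pow_le_pow_left₀ (by positivity)
      linarith
    have ecross : t ^ 2 * (N ^ 2 / 2 * ((t ^ 2 * (L ^ 2 * G0 + d * Lt) + L * δ) * W)) +
        W * (η ^ 2 / 2 * (L ^ 2 * G0 + d * Lt)) + W * (N * δ) =
        W * (η ^ 2 * (L ^ 2 * G0 + d * Lt) + N * δ * (η * L / 2 + 1)) := by
      rw [← hη]; ring
    rw [ecross]
    linarith

end cs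

/-! ### Passing to the infimum -/

lemma W2_le_of_coupling {d : ℕ} {μ ν : Measure (Euc d)} {Γ : Measure (Euc d × Euc d)} (h1 : Γ.map Prod.fst = μ)
    (h2 : Γ.map Prod.snd = ν) : W2 μ ν ^ 2 ≤ ∫⁻ p, ‖p.1 - p.2‖ₑ ^ 2 ∂Γ := by
  have h : W2 μ ν ≤ (∫⁻ p, ‖p.1 - p.2‖ₑ ^ 2 ∂Γ) ^ (1 / 2 : ℝ) := iInf₂_le Γ ⟨h1, h2⟩
  refine (pow_le_pow_left' h 2).trans (le_of_eq ?_)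
  rw [← ENNReal.rpow_natCast, ← ENNReal.rpow_mul]
  norm_num

lemma exists_coupling {d : ℕ} {μ ν : Measure (Euc d)} [IsProbabilityMeasure μ] {W' : ℝ} (hW : 0 ≤ W')
    (h : W2 μ ν < ENNReal.ofReal W') :
    ∃ Γ : Measure (Euc d × Euc d), IsProbabilityMeasure Γ ∧ Γ.map Prod.fst = μ ∧ Γ.map Prod.snd = ν ∧
      L2le Γ (fun p => p.1 - p.2) W' := by
  unfold W2 at h
  obtain ⟨Γ, h⟩ := iInf_lt_iff.1 h
  obtain ⟨⟨h1, h2⟩, h⟩ := iInf_lt_iff.1 h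
  have hp : IsProbabilityMeasure Γ := by
    constructor
    have := congrArg (fun M => M Set.univ) h1
    beta_reduce at this
    rw [Measure.map_apply measurable_fst MeasurableSet.univ, Set.preimage_univ] at this
    rw [this]; exact measure_univ
  refine ⟨Γ, hp, h1, h2, ?_⟩
  refine L2le.of_lintegral (measurable_fst.sub measurable_snd).aestronglyMeasurable hW ?_
  have h' : (∫⁻ p, ‖p.1 - p.2‖ₑ ^ 2 ∂Γ) ^ (1 / 2 : ℝ) ≤ ENNReal.ofReal W' := h.le
  have := pow_le_pow_left' h' 2
  rw [← ENNReal.rpow_natCast, ← ENNReal.rpow_mul] at this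
  norm_num at this
  rw [ENNReal.ofReal_pow hW]
  exact this

lemma W2_lt_top {d : ℕ} {μ ν : Measure (Euc d)} [IsProbabilityMeasure μ] [IsProbabilityMeasure ν] {A B : ℝ}
    (hμ : L2le μ (fun x => x) A) (hν : L2le ν (fun x => x) B) : W2 μ ν < ∞ := by
  have h1 : (μ.prod ν).map Prod.fst = μ := (measurePreserving_fst).map_eq
  have h2 : (μ.prod ν).map Prod.snd = ν := (measurePreserving_snd).map_eq
  have h := W2_le_of_coupling h1 h2
  have hL : L2le (μ.prod ν) (fun p => p.1 - p.2) (A + B) := (hμ.lift_fst (N := ν)).sub (hν.lift_snd (P := μ))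
  have h3 := (h.trans hL.lintegral_le).trans_lt ENNReal.ofReal_lt_top
  by_contra hc
  rw [not_lt, top_le_iff] at hc
  rw [hc] at h3
  simp at h3

lemma W2_rec {d K : ℕ} {U : Euc d → ℝ} {m L Lt η G0 A : ℝ} {ν : Measure (Euc d)} [IsProbabilityMeasure ν]
    (hK : 1 ≤ K) (hU : StrongAssumption U m L) (hU3 : ThirdDerivBounded U Lt) (hη : 0 < η) (hη1 : η ≤ 1)
    (hηL : η * L ≤ 1) (hρ : 0 ≤ 1 - 2 * m * η + 33 * η ^ 2 * L ^ 2)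
    (hν : pushQ (prlmcNoise d K) (pS U η K) ν = ν) (hνA : L2le ν (fun x => x) A)
    (hG : L2le (gibbs U) (fun x => x) G0) :
    ∃ W : ℝ, 0 ≤ W ∧ W2 (gibbs U) ν = ENNReal.ofReal W ∧
      W ^ 2 ≤ (1 - 2 * m * η + 33 * η ^ 2 * L ^ 2) * W ^ 2
        + 2 * (W * (η ^ 2 * (L ^ 2 * G0 + d * Lt))) + 4 * (5 * η * L * W) ^ 2
        + 5 / 4 * (2 * (L * Real.sqrt d * (η * Real.sqrt η) + η ^ 2 * L ^ 2 * G0 / 2) ^ 2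
          + 2 * (η ^ 2 * (2 - (K : ℝ)⁻¹) * L ^ 2 * (η * d * (1 - (K : ℝ)⁻¹) + η ^ 2 * L ^ 2 * G0 ^ 2))) := by
  have := gibbs_prob hU
  have hfin := W2_lt_top hG hνA
  have hL0 : 0 ≤ L := hU.2.1.le.trans hU.2.2.1
  have hLt := Lt_nonneg hU3
  have hG0 := hG.nonneg
  obtain ⟨C, hC, hrej⟩ := mala_rej hU hU3
  set W := (W2 (gibbs U) ν).toReal with hWdef
  have hW0 : 0 ≤ W := ENNReal.toReal_nonneg
  have hWe : W2 (gibbs U) ν = ENNReal.ofReal W := (ENNReal.ofReal_toReal hfin.ne).symm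
  refine ⟨W, hW0, hWe, ?_⟩
  have hK1 : (K : ℝ)⁻¹ ≤ 1 := inv_le_one_of_one_le₀ (by exact_mod_cast hK)
  have hk2 : 0 ≤ 2 - (K : ℝ)⁻¹ := by linarith
  have hk1 : 0 ≤ 1 - (K : ℝ)⁻¹ := by linarith
  set F : ℝ → ℝ → ℝ := fun V ε => (1 - 2 * m * η + 33 * η ^ 2 * L ^ 2) * V ^ 2
        + 2 * (V * (η ^ 2 * (L ^ 2 * G0 + d * Lt) + ε * (η * L / 2 + 1))) + 4 * (5 * η * L * V) ^ 2
        + 5 / 4 * (2 * (L * Real.sqrt d * (η * Real.sqrt η) + η ^ 2 * L ^ 2 * G0 / 2 + ε * (η * L / 2 + 1)) ^ 2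
          + 2 * (η ^ 2 * (2 - (K : ℝ)⁻¹) * L ^ 2 * (η * d * (1 - (K : ℝ)⁻¹) + η ^ 2 * L ^ 2 * G0 ^ 2))) with hF
  have key : ∀ V, W < V → ∀ n : ℕ, W ^ 2 ≤ F V (η * Real.sqrt (C * Real.sqrt (η / (n + 1 : ℕ)))) := by
    intro V hV n
    have hV0 : 0 ≤ V := hW0.trans hV.le
    obtain ⟨Γ, hp, h1, h2, hΓ⟩ := exists_coupling hV0 (by
      rw [hWe]; exact (ENNReal.ofReal_lt_ofReal_iff (hW0.trans_lt hV)).2 hV : W2 (gibbs U) ν < ENNReal.ofReal V)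
    set t := Real.sqrt (η / (n + 1 : ℕ)) with ht
    have hn : (0 : ℝ) < (n + 1 : ℕ) := by positivity
    have htp : 0 < t := Real.sqrt_pos.2 (by positivity)
    have ht2 : t ^ 2 = η / (n + 1 : ℕ) := Real.sq_sqrt (by positivity)
    have ht1 : t ≤ 1 := by
      rw [ht]
      refine Real.sqrt_le_iff.2 ⟨zero_le_one, ?_⟩
      rw [one_pow, div_le_one hn]
      have : (1 : ℝ) ≤ (n + 1 : ℕ) := by push_cast; linarith [Nat.cast_nonneg (α := ℝ) n]
      linarith
    have htη : t ^ 2 * (n + 1 : ℕ) = η := by rw [ht2]; field_simp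
    obtain ⟨Γ', g1, g2, g3⟩ := coupling_step hK hU hU3 hηL hρ h1 h2 hν htp (Nat.le_add_left 1 n) htη hΓ hG (hrej t htp ht1)
    have e : ((n + 1 : ℕ) : ℝ) * Real.sqrt (C * t ^ 5) = η * Real.sqrt (C * t) := by
      rw [← htη, show C * t ^ 5 = (t ^ 2) ^ 2 * (C * t) by ring, Real.sqrt_mul (by positivity), Real.sqrt_sq (by positivity)]
      ring
    have g4 := (W2_le_of_coupling g1 g2).trans g3
    rw [e, hWe, ← ENNReal.ofReal_pow hW0, ENNReal.ofReal_le_ofReal_iff (by positivity)] at g4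
    exact g4
  have hFc : Continuous (fun p : ℝ × ℝ => F p.1 p.2) := by
    simp only [hF]; fun_prop
  have hlim : Tendsto (fun n : ℕ => η * Real.sqrt (C * Real.sqrt (η / (n + 1 : ℕ)))) atTop (𝓝 0) := by
    have h0 : Tendsto (fun n : ℕ => η / ((n + 1 : ℕ) : ℝ)) atTop (𝓝 0) :=
      (tendsto_const_div_atTop_nhds_zero_nat η).comp (tendsto_add_atTop_nat 1)
    have hc : Continuous (fun y : ℝ => η * Real.sqrt (C * Real.sqrt y)) := by fun_prop
    have := (hc.tendsto 0).comp h0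
    simpa [Function.comp_def] using this
  have key2 : ∀ V, W < V → W ^ 2 ≤ F V 0 := by
    intro V hV
    have hc : Continuous (fun ε => F V ε) := hFc.comp (by fun_prop : Continuous fun ε : ℝ => (V, ε))
    exact ge_of_tendsto' ((hc.tendsto 0).comp hlim) (key V hV)
  have hc : Continuous (fun V => F V 0) := hFc.comp (by fun_prop : Continuous fun V : ℝ => (V, (0 : ℝ)))
  have key3 : W ^ 2 ≤ F W 0 :=
    ge_of_tendsto ((hc.tendsto W).mono_left nhdsWithin_le_nhds : Tendsto _ (𝓝[>] W) _)
      (eventually_nhdsWithin_of_forall fun V hV => key2 V hV)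
  simpa [hF] using key3

/-! ### Final arithmetic -/

lemma arith_bd {m L Lt η G0 W D s r q : ℝ} (hm : 0 < m) (hη : 0 < η) (hD : 0 ≤ D)
    (hs : s ^ 2 = D) (hr : r ^ 2 = η) (hG : G0 ^ 2 = D / m) (hq0 : 0 ≤ q) (hq1 : q ≤ 1)
    (he : η * L ^ 2 / m ≤ 1 / 1000)
    (h : W ^ 2 ≤ (1 - 2 * m * η + 33 * η ^ 2 * L ^ 2) * W ^ 2
        + 2 * (W * (η ^ 2 * (L ^ 2 * G0 + D * Lt))) + 4 * (5 * η * L * W) ^ 2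
        + 5 / 4 * (2 * (L * s * (η * r) + η ^ 2 * L ^ 2 * G0 / 2) ^ 2
          + 2 * (η ^ 2 * (2 - q) * L ^ 2 * (η * D * (1 - q) + η ^ 2 * L ^ 2 * G0 ^ 2)))) :
    W ^ 2 ≤ (η ^ 2 * D * L ^ 2 / m) * (10 - 4 * q) + 3 * (η ^ 2 * D ^ 2 * Lt ^ 2 / m ^ 2)
      + 9 / 2 * (η ^ 2 * D * L ^ 4 / m ^ 3) := by
  set e := η * L ^ 2 / m with hedef
  set c := η ^ 2 * D * L ^ 2 / m with hc
  set P := η ^ 2 * D * L ^ 4 / m ^ 3 with hP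
  set Q := η ^ 2 * D ^ 2 * Lt ^ 2 / m ^ 2 with hQ
  have he0 : 0 ≤ e := by positivity
  have hc0 : 0 ≤ c := by positivity
  have hP0 : 0 ≤ P := by positivity
  have hQ0 : 0 ≤ Q := by positivity
  have hX : (L * s * (η * r) + η ^ 2 * L ^ 2 * G0 / 2) ^ 2 ≤ m * η * (11 / 10 * c + 11 / 4 * (c * e)) := by
    have e1 : m * η * (11 / 10 * c + 11 / 4 * (c * e)) = 11 / 10 * (L * s * (η * r)) ^ 2 + 11 * (η ^ 2 * L ^ 2 * G0 / 2) ^ 2 := by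
      have : 11 / 10 * (L * s * (η * r)) ^ 2 + 11 * (η ^ 2 * L ^ 2 * G0 / 2) ^ 2
        = 11 / 10 * (L ^ 2 * s ^ 2 * (η ^ 2 * r ^ 2)) + 11 / 4 * (η ^ 4 * L ^ 4 * G0 ^ 2) := by ring
      rw [this, hs, hr, hG, hc, hedef]
      field_simp
    rw [e1]
    nlinarith [sq_nonneg (L * s * (η * r) - 10 * (η ^ 2 * L ^ 2 * G0 / 2))]
  have hB : η ^ 2 * (2 - q) * L ^ 2 * (η * D * (1 - q) + η ^ 2 * L ^ 2 * G0 ^ 2)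
      ≤ m * η * (c * (2 - 2 * q) + 2 * (c * e)) := by
    have e1 : η ^ 2 * (2 - q) * L ^ 2 * (η * D * (1 - q) + η ^ 2 * L ^ 2 * G0 ^ 2)
      = m * η * ((2 - q) * (c * (1 - q) + c * e)) := by
      rw [hG, hc, hedef]; field_simp
    rw [e1]
    refine mul_le_mul_of_nonneg_left ?_ (by positivity)
    have : 0 ≤ c * (1 - q) + c * e := by
      have := mul_nonneg hc0 (sub_nonneg.2 hq1); positivity
    nlinarith
  have hY : 2 * (W * (η ^ 2 * (L ^ 2 * G0 + D * Lt))) ≤ m * η * W ^ 2 + m * η * (2 * P + 2 * Q) := by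
    have e1 : m * η * (2 * P + 2 * Q) = η ^ 3 / m * (2 * (L ^ 2 * G0) ^ 2 + 2 * (D * Lt) ^ 2) := by
      have : (L ^ 2 * G0) ^ 2 = L ^ 4 * G0 ^ 2 := by ring
      rw [this, hG, hP, hQ]; field_simp
    rw [e1]
    set b := L ^ 2 * G0 + D * Lt with hb
    have h1 : b ^ 2 ≤ 2 * (L ^ 2 * G0) ^ 2 + 2 * (D * Lt) ^ 2 := by
      rw [hb]; nlinarith [sq_nonneg (L ^ 2 * G0 - D * Lt)]
    have h2 : 2 * (W * (η ^ 2 * b)) ≤ m * η * W ^ 2 + η ^ 3 / m * b ^ 2 := by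
      have : m * η * W ^ 2 + η ^ 3 / m * b ^ 2 - 2 * (W * (η ^ 2 * b)) = η / m * (m * W - η * b) ^ 2 := by
        field_simp; ring
      have h3 : 0 ≤ η / m * (m * W - η * b) ^ 2 := by positivity
      linarith
    have h3 := mul_le_mul_of_nonneg_left h1 (by positivity : 0 ≤ η ^ 3 / m)
    linarith
  have hL2 : η ^ 2 * L ^ 2 = m * η * e := by rw [hedef]; field_simp
  have hmain : m * η * ((1 - 133 * e) * W ^ 2) ≤ m * η * (2 * P + 2 * Q + 5 / 2 * (11 / 10 * c + c * (2 - 2 * q) + 19 / 4 * (c * e))) := by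
    have e2 : (5 * η * L * W) ^ 2 = 25 * (η ^ 2 * L ^ 2) * W ^ 2 := by ring
    clear_value e c P Q
    generalize (L * s * (η * r) + η ^ 2 * L ^ 2 * G0 / 2) ^ 2 = X at *
    generalize η ^ 2 * (2 - q) * L ^ 2 * (η * D * (1 - q) + η ^ 2 * L ^ 2 * G0 ^ 2) = B at *
    generalize 2 * (W * (η ^ 2 * (L ^ 2 * G0 + D * Lt))) = Y at *
    rw [e2, mul_assoc 33, hL2] at h
    linarith
  have hmain2 := le_of_mul_le_mul_left hmain (by positivity)
  have hce : c * e ≤ c * (1 / 1000) := mul_le_mul_of_nonneg_left he hc0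
  have hWe : W ^ 2 * e ≤ W ^ 2 * (1 / 1000) := mul_le_mul_of_nonneg_left he (sq_nonneg W)
  have hcq : c * q ≤ c := mul_le_of_le_one_right hc0 hq1
  have hcq0 : 0 ≤ c * q := mul_nonneg hc0 hq0
  clear_value e c P Q
  linarith

lemma arith_tgt {m L Lt η D q k : ℝ} (hm : 0 < m) (hmL : m ≤ L) (hη : 0 < η) (hD : 0 ≤ D)
    (hq0 : 0 ≤ q) (hq1 : q ≤ 1) (hk : 1 / (2 * m) ≤ k) :
    (η ^ 2 * D * L ^ 2 / m) * (10 - 4 * q) + 3 * (η ^ 2 * D ^ 2 * Lt ^ 2 / m ^ 2)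
      + 9 / 2 * (η ^ 2 * D * L ^ 4 / m ^ 3) ≤
    2 * k * D * η ^ 2 *
                (L ^ 2 * (10 - 4 * q + L ^ 2 * η ^ 2 / 6 + 2 * k * L ^ 2 * η) +
                  6 * k * D * Lt ^ 2 +
                  ((2 + 4 * η ^ 2 * L ^ 2 * (2 - q) + L ^ 2 * (1 - q)) / m) *
                    (L ^ 4 * ((8 - 4 * q) * η + 3 * k)) +
                  L ^ 4 * (η + 3 * k) / m) := by
  set j := 1 / (2 * m) with hj
  have hj0 : 0 < j := by positivity
  have hk0 : 0 < k := hj0.trans_le hk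
  have h1 : 0 ≤ 1 - q := by linarith
  have h2 : 0 ≤ 2 - q := by linarith
  have h4 : 0 ≤ 10 - 4 * q := by linarith
  have h8 : 0 ≤ 8 - 4 * q := by linarith
  have hL : 0 < L := hm.trans_le hmL
  have e1 : (η ^ 2 * D * L ^ 2 / m) * (10 - 4 * q) + 3 * (η ^ 2 * D ^ 2 * Lt ^ 2 / m ^ 2)
      + 9 / 2 * (η ^ 2 * D * L ^ 4 / m ^ 3) = 2 * j * D * η ^ 2 * (L ^ 2 * (10 - 4 * q) + 6 * j * D * Lt ^ 2 + 2 / m * (L ^ 4 * (3 * j)) + L ^ 4 * (3 * j) / m) := by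
    rw [hj]; field_simp; ring
  rw [e1]
  have a1 : L ^ 2 * (10 - 4 * q) ≤ L ^ 2 * (10 - 4 * q + L ^ 2 * η ^ 2 / 6 + 2 * k * L ^ 2 * η) := by
    refine mul_le_mul_of_nonneg_left ?_ (by positivity)
    have : 0 ≤ L ^ 2 * η ^ 2 / 6 + 2 * k * L ^ 2 * η := by positivity
    linarith
  have a2 : 2 / m * (L ^ 4 * (3 * j)) ≤ ((2 + 4 * η ^ 2 * L ^ 2 * (2 - q) + L ^ 2 * (1 - q)) / m) *
                    (L ^ 4 * ((8 - 4 * q) * η + 3 * k)) := by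
    have : 0 ≤ 4 * η ^ 2 * L ^ 2 * (2 - q) + L ^ 2 * (1 - q) := by positivity
    have : 0 ≤ (8 - 4 * q) * η := by positivity
    gcongr
    · linarith
    · linarith
  have a3 : L ^ 4 * (3 * j) / m ≤ L ^ 4 * (η + 3 * k) / m := by
    gcongr; linarith
  have a4 : 6 * j * D * Lt ^ 2 ≤ 6 * k * D * Lt ^ 2 := by gcongr
  have a5 : 2 * j * D * η ^ 2 ≤ 2 * k * D * η ^ 2 := by gcongr
  refine mul_le_mul a5 ?_ (by positivity) (by positivity)
  linarith

lemma kap_inv_ge {m L : ℝ} (hm : 0 < m) (hmL : m ≤ L) : 1 / (2 * m) ≤ (kap m L)⁻¹ := by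
  have hL : 0 < L := hm.trans_le hmL
  unfold kap
  rw [inv_div, div_le_div_iff₀ (by positivity) (by positivity)]
  nlinarith

lemma pS_zero_L2 {d K : ℕ} {U : Euc d → ℝ} {m L η : ℝ} (hK : 1 ≤ K) (hU : StrongAssumption U m L) (hη : 0 ≤ η) :
    ∃ A, L2le (prlmcNoise d K) (pS U η K 0) A := by
  have := noise_prob d hK
  have := piB_prob hK
  have hK1 : (K : ℝ)⁻¹ ≤ 1 := inv_le_one_of_one_le₀ (by exact_mod_cast hK)
  have h3 := noise_N3 hK hU hη (0 : Euc d)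
  set R := η ^ 2 * (2 - (K : ℝ)⁻¹) * L ^ 2 * (η * d * (1 - (K : ℝ)⁻¹) + η ^ 2 * L ^ 2 * ‖(0 : Euc d)‖ ^ 2) with hR
  have hR0 : 0 ≤ R := by
    have h1 : 0 ≤ 1 - (K : ℝ)⁻¹ := by linarith
    have h2 : 0 ≤ 2 - (K : ℝ)⁻¹ := by linarith
    positivity
  have hc : Continuous (fun r : (Fin K → ℝ) × (Fin K → Euc d) × Euc d => pE U η K (0 : Euc d) r) :=
    (pE_cont (K := K) (η := η) hU).comp (Continuous.prodMk continuous_const continuous_id)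
  have hE : L2le (prlmcNoise d K) (fun r => pE U η K (0 : Euc d) r) (Real.sqrt R) := by
    refine L2le.of_lintegral hc.measurable.aestronglyMeasurable (Real.sqrt_nonneg _) ?_
    rw [Real.sq_sqrt hR0]; exact h3
  have hg := gau_L2 d
  have hZ : L2le (prlmcNoise d K) (fun r => r.2.2) (Real.sqrt d) :=
    L2le.lift_snd (P := piB K) (L2le.lift_snd (P := piG d K) hg)
  have h := (hZ.smul (Real.sqrt (2 * η))).sub hE
  have e : (fun x : (Fin K → ℝ) × (Fin K → Euc d) × Euc d => Real.sqrt (2 * η) • x.2.2 - pE U η K (0 : Euc d) x) = pS U η K 0 := by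
    funext r
    rw [pS_eq, hU.2.2.2.2]
    simp only [smul_zero, sub_zero, zero_sub]
    abel
  rw [e] at h
  exact ⟨_, h⟩

/-- Under Assumptions 1 and 3, for any `η ∈ (0, η₀ ∧ 1/(m+L))` the
stationary distribution `π_η` of the PRLMC chain satisfies the sharp `O(η)` bound
on `W₂²(π, π_η)` stated in Corollary 2.9. -/
theorem stmt7 (m L Lt : ℝ) (hm : 0 < m) (hmL : m ≤ L) :
    ∃ η₀ : ℝ, η₀ ∈ Set.Ioo (0 : ℝ) 1 ∧
      ∀ (d K : ℕ), 1 ≤ K → ∀ U : Euc d → ℝ, StrongAssumption U m L →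
        ThirdDerivBounded U Lt →
        ∀ η : ℝ, η ∈ Set.Ioo (0 : ℝ) (min η₀ (1 / (m + L))) →
          ∃ πη : Measure (Euc d), IsProbabilityMeasure πη ∧
            πη.bind (prlmcKernel U η K) = πη ∧
            (∀ μ : Measure (Euc d), IsProbabilityMeasure μ →
              μ.bind (prlmcKernel U η K) = μ → μ = πη) ∧
            (W2 (gibbs U) πη) ^ 2 ≤
              ENNReal.ofReal (2 * (kap m L)⁻¹ * (d : ℝ) * η ^ 2 *
                (L ^ 2 * (10 - 4 / (K : ℝ) + L ^ 2 * η ^ 2 / 6 + 2 * (kap m L)⁻¹ * L ^ 2 * η) +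
                  6 * (kap m L)⁻¹ * (d : ℝ) * Lt ^ 2 +
                  ((2 + 4 * η ^ 2 * L ^ 2 * (2 - 1 / (K : ℝ)) + L ^ 2 * (1 - 1 / (K : ℝ))) / m) *
                    (L ^ 4 * ((8 - 4 / (K : ℝ)) * η + 3 * (kap m L)⁻¹)) +
                  L ^ 4 * (η + 3 * (kap m L)⁻¹) / m)) := by
  have hL : 0 < L := hm.trans_le hmL
  refine ⟨min (1 / 2) (m / (1000 * L ^ 2)), ⟨lt_min (by norm_num) (by positivity), (min_le_left _ _).trans_lt (by norm_num)⟩, ?_⟩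
  intro d K hK U hU hU3 η hη
  obtain ⟨hη0, hη2⟩ := hη
  have hηa : η < 1 / 2 := hη2.trans_le ((min_le_left _ _).trans (min_le_left _ _))
  have hηb : η < m / (1000 * L ^ 2) := hη2.trans_le ((min_le_left _ _).trans (min_le_right _ _))
  have hηc : η < 1 / (m + L) := hη2.trans_le (min_le_right _ _)
  have hb : η * (1000 * L ^ 2) < m := (lt_div_iff₀ (by positivity)).1 hηb
  have hηL : η * L ≤ 1 := by
    have := (lt_div_iff₀ (by positivity)).1 hηc
    nlinarith [mul_pos hη0 hm]
  have hmη : η * m ≤ η * L := mul_le_mul_of_nonneg_left hmL hη0.le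
  have hρ : 0 ≤ 1 - 2 * m * η + 33 * η ^ 2 * L ^ 2 := by
    nlinarith [sq_nonneg (1 - η * L), sq_nonneg (η * L)]
  have hρlt : 1 - 2 * m * η + 33 * η ^ 2 * L ^ 2 < 1 := by
    nlinarith [mul_pos hη0 (sub_pos.2 hb), mul_pos hη0 hm]
  set ρ := Real.sqrt (1 - 2 * m * η + 33 * η ^ 2 * L ^ 2) with hρdef
  have hρ0 : 0 ≤ ρ := Real.sqrt_nonneg _
  have hρ1 : ρ < 1 := by
    rw [hρdef, Real.sqrt_lt' one_pos, one_pow]; exact hρlt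
  have hρ2 : ρ ^ 2 = 1 - 2 * m * η + 33 * η ^ 2 * L ^ 2 := Real.sq_sqrt hρ
  have hN := noise_prob d hK
  have hS := (pS_cont (K := K) (η := η) hU).measurable
  have h1 : ∀ x y, ∫⁻ r, ‖pS U η K x r - pS U η K y r‖ₑ ^ 2 ∂(prlmcNoise d K) ≤ ENNReal.ofReal (ρ ^ 2 * ‖x - y‖ ^ 2) := by
    intro x y
    rw [hρ2]
    exact noise_N1 hK hU hη0.le hηL x y
  obtain ⟨A, hA⟩ := pS_zero_L2 hK hU hη0.le
  obtain ⟨ν, hν, hνS, hνA⟩ := stat_exists hS hρ0 hρ1 h1 hA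
  have hG : L2le (gibbs U) (fun x => x) (Real.sqrt (d / m)) := by
    have h2 := gibbs_second hU
    refine L2le.of_integral (gibbs_memLp hU 2 (by norm_num)) (Real.sqrt_nonneg _) ?_
    rw [Real.sq_sqrt (by positivity)]
    exact h2
  refine ⟨ν, hν, (bind_eq hK hU ν).trans hνS, ?_, ?_⟩
  · intro μ hμ hμS
    exact stat_unique hS hρ0 hρ1 h1 ((bind_eq hK hU μ).symm.trans hμS) hνS
  · obtain ⟨W, hW0, hWe, hW⟩ := W2_rec hK hU hU3 hη0 (by linarith) hηL hρ hνS hνA hG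
    rw [hWe, ← ENNReal.ofReal_pow hW0]
    refine ENNReal.ofReal_le_ofReal ?_
    have hq0 : (0 : ℝ) ≤ (K : ℝ)⁻¹ := by positivity
    have hq1 : (K : ℝ)⁻¹ ≤ 1 := inv_le_one_of_one_le₀ (by exact_mod_cast hK)
    have he : η * L ^ 2 / m ≤ 1 / 1000 := by
      rw [div_le_div_iff₀ hm (by norm_num)]; linarith
    have hd : (0 : ℝ) ≤ d := Nat.cast_nonneg d
    have b1 := arith_bd hm hη0 hd (Real.sq_sqrt hd) (Real.sq_sqrt hη0.le) (Real.sq_sqrt (by positivity)) hq0 hq1 he hW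
    have b2 := arith_tgt (Lt := Lt) hm hmL hη0 hd hq0 hq1 (kap_inv_ge hm hmL)
    simp only [← div_eq_mul_inv, one_div] at b1 b2 ⊢
    exact b1.trans b2

end
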